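/- Adopt the setup of the weakly coupled system: Ω = ℝⁿ₊; B_∥ locally Lipschitz, uniformly elliptic (λ,Λ), Lu = div_∥(B_∥∇_∥u) + ∂²_t u; M = max( Carleson norm of |∇_x B_∥|² t dx dt , sup (t|∇_x B_∥|)² ) finite; ∇_x f ∈ L²(ℝ^{n-1}); v_m energy solutions of Lv_m = 0 with traces ∂_m f, V = (v₁,…,v_{n-1}); η = (η₁,…,η_{n-1}) the weak solution with zero trace of L η_m = Σ_{i,j<n} ∂_i((∂_m b_{ij})(v_j + η_j)). Fix a sufficiently large aperture a > 0 and let b = b(a) be as in the local estimate of Lemma 5.1, and let c(M) → 0 as M → 0 be the associated small constant. Let Δ_d = Δ_d(q₀) ⊂ ℝ^{n-1} be a ball of radius d, A_d = (q₀, d/2) its corkscrew point, and ν₀ = |η(A_d)|. Then there is an enlargement constant m = m(a) ≥ 2 such that: for each γ ∈ (0,1) there exists C(γ) > 0 with C(γ) → 0 as γ → 0, such that for every ν > 2ν₀: |{ x ∈ ℝ^{n-1} : N_a(η χ_{T(Δ_d)})(x) > ν, (M_HL(S_b²(η)))^{1/2}(x) ≤ γν, ( c(M)[ M_HL(N_a²(η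 χ_{T(Δ_d)}))(x) + M_HL(N_a²(V))(x) ] )^{1/2} ≤ γν, ( M_HL(S_b²(η))(x) · M_HL(N_a²(η χ_{T(Δ_d)}))(x) )^{1/4} ≤ γν }| ≤ C(γ) |{ x ∈ ℝ^{n-1} : N_a(η χ_{T(Δ_d)})(x) > ν/32 }|, where the square function S_b is truncated at height 2d and M_HL is taken only over balls contained in Δ_{md}. -/

import Mathlib

open MeasureTheory Set Filter
open scoped ENNReal NNReal

noncomputable section

/-! ## Basic geometry of the upper half-space `ℝⁿ₊ = ℝ^{n-1} × (0,∞)` -/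

abbrev EE (n : ℕ) := EuclideanSpace ℝ (Fin (n - 1))
abbrev Pt (n : ℕ) := EE n × ℝ

/-- The upper half-space `ℝⁿ₊`. -/
def UHS (n : ℕ) : Set (Pt n) := {X | 0 < X.2}

/-- Euclidean distance on `ℝ^{n-1} × ℝ`. -/
def dist2 {n : ℕ} (X Y : Pt n) : ℝ := Real.sqrt (dist X.1 Y.1 ^ 2 + (X.2 - Y.2) ^ 2)

/-- Euclidean ball in `ℝ^{n-1} × ℝ`. -/
def ball2 {n : ℕ} (X : Pt n) (r : ℝ) : Set (Pt n) := {Y | dist2 Y X < r}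

/-- Whitney ball `B(X, δ(X)/2)` for the upper half-space (`δ(X) = t`). -/
def wball {n : ℕ} (X : Pt n) : Set (Pt n) := ball2 X (X.2 / 2)

/-- Nontangential cone of aperture `a` with vertex `q ∈ ℝ^{n-1} = ∂ℝⁿ₊`. -/
def cone {n : ℕ} (a : ℝ) (q : EE n) : Set (Pt n) :=
  {X | 0 < X.2 ∧ dist2 X (q, 0) ≤ (1 + a) * X.2}

/-- Cone truncated at height `h`. -/
def coneTrunc {n : ℕ} (a h : ℝ) (q : EE n) : Set (Pt n) := cone a q ∩ {X | X.2 < h}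

/-- Doubly truncated cone `Γ_ε(q)`. -/
def coneEps {n : ℕ} (a ε : ℝ) (q : EE n) : Set (Pt n) :=
  cone a q ∩ {X | ε < X.2 ∧ X.2 < 1 / ε}

/-! ## Derivatives -/

/-- The `i`-th coordinate direction in `ℝ^{n-1} × ℝ`. -/
def bvec (n : ℕ) (i : Fin n) : Pt n :=
  if h : (i : ℕ) < n - 1 then (EuclideanSpace.single (⟨i, h⟩ : Fin (n - 1)) 1, 0)
  else ((0 : EE n), 1)

/-- Partial derivative of `u` in the `i`-th coordinate direction. -/
def pd {n : ℕ} (i : Fin n) (u : Pt n → ℝ) (X : Pt n) : ℝ := fderiv ℝ u X (bvec n i)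

/-- Horizontal partial derivative. -/
def pdx {n : ℕ} (i : Fin (n - 1)) (u : Pt n → ℝ) (X : Pt n) : ℝ :=
  fderiv ℝ u X (EuclideanSpace.single i 1, 0)

/-- Vertical partial derivative `∂_t`. -/
def pdt {n : ℕ} (u : Pt n → ℝ) (X : Pt n) : ℝ := fderiv ℝ u X (0, 1)

/-- Squared length of the full gradient of `u`. -/
def gradSq {n : ℕ} (u : Pt n → ℝ) (X : Pt n) : ℝ := ∑ i : Fin n, pd i u X ^ 2

/-- Squared length of the horizontal gradient of `u`. -/
def gradxSq {n : ℕ} (u : Pt n → ℝ) (X : Pt n) : ℝ := ∑ i : Fin (n - 1), pdx i u X ^ 2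

/-- Squared Hilbert–Schmidt norm of the Hessian of `u`. -/
def hessSq {n : ℕ} (u : Pt n → ℝ) (X : Pt n) : ℝ :=
  ∑ i : Fin n, ∑ j : Fin n, pd i (pd j u) X ^ 2

/-- Partial derivative of a function on the boundary `ℝ^{n-1}` (or `ℝ^d`). -/
def pdE {d : ℕ} (i : Fin d) (f : EuclideanSpace ℝ (Fin d) → ℝ)
    (q : EuclideanSpace ℝ (Fin d)) : ℝ :=
  fderiv ℝ f q (EuclideanSpace.single i 1)

/-- Squared length of the gradient of a boundary function. -/
def gradSqE {d : ℕ} (f : EuclideanSpace ℝ (Fin d) → ℝ) (q : EuclideanSpace ℝ (Fin d)) : ℝ :=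
  ∑ i, pdE i f q ^ 2

/-- Frobenius norm of an `m × m` matrix. -/
def mnorm {m : ℕ} (M : Fin m → Fin m → ℝ) : ℝ := Real.sqrt (∑ p, ∑ q, M p q ^ 2)

/-- Norm of the full gradient of a matrix-valued function. -/
def gradA {n m : ℕ} (A : Pt n → Fin m → Fin m → ℝ) (X : Pt n) : ℝ :=
  Real.sqrt (∑ p, ∑ q, gradSq (fun Y => A Y p q) X)

/-- Norm of the horizontal gradient of a matrix-valued function. -/
def gradxA {n m : ℕ} (A : Pt n → Fin m → Fin m → ℝ) (X : Pt n) : ℝ :=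
  Real.sqrt (∑ p, ∑ q, gradxSq (fun Y => A Y p q) X)

/-! ## Nontangential maximal functions, square functions, norms -/

/-- Nontangential maximal function. -/
def NT {n : ℕ} (a : ℝ) (F : Pt n → ℝ) (q : EE n) : ℝ≥0∞ :=
  ⨆ X ∈ cone a q, ENNReal.ofReal |F X|

/-- Nontangential maximal function of a vector-valued function. -/
def NTv {n m : ℕ} (a : ℝ) (w : Fin m → Pt n → ℝ) (q : EE n) : ℝ≥0∞ :=
  ⨆ X ∈ cone a q, ENNReal.ofReal (Real.sqrt (∑ k, w k X ^ 2))

/-- `L²`-averaged nontangential maximal function `Ñ`, applied to the *squared*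
density `G` (e.g. `G = |∇u|²`). -/
def NTav {n : ℕ} (a : ℝ) (G : Pt n → ℝ) (q : EE n) : ℝ≥0∞ :=
  ⨆ X ∈ cone a q,
    ((volume (wball X))⁻¹ * ∫⁻ Y in wball X, ENNReal.ofReal (G Y)) ^ (1 / 2 : ℝ)

/-- Truncated version of `NTav` (cones truncated at height `h`). -/
def NTavTr {n : ℕ} (a h : ℝ) (G : Pt n → ℝ) (q : EE n) : ℝ≥0∞ :=
  ⨆ X ∈ coneTrunc a h q,
    ((volume (wball X))⁻¹ * ∫⁻ Y in wball X, ENNReal.ofReal (G Y)) ^ (1 / 2 : ℝ)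

/-- `L¹`-averaged nontangential maximal function, over a general family `Γ` of points. -/
def NT1on {n : ℕ} (Γ : Set (Pt n)) (F : Pt n → ℝ) : ℝ≥0∞ :=
  ⨆ X ∈ Γ, (volume (wball X))⁻¹ * ∫⁻ Y in wball X, ENNReal.ofReal |F Y|

/-- Square function over a region `Γ`, applied to the *squared* density `G = |∇v|²`. -/
def SFon {n : ℕ} (Γ : Set (Pt n)) (G : Pt n → ℝ) : ℝ≥0∞ :=
  (∫⁻ X in Γ, ENNReal.ofReal (G X) * ENNReal.ofReal (X.2 ^ ((2 : ℝ) - n))) ^ (1 / 2 : ℝ)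

/-- Square function with aperture `a`, applied to the squared density `G = |∇v|²`. -/
def SF {n : ℕ} (a : ℝ) (G : Pt n → ℝ) (q : EE n) : ℝ≥0∞ := SFon (cone a q) G

/-- `L^p` (quasi-)norm over `ℝ^{n-1}` of an `ℝ≥0∞`-valued function. -/
def bLp {d : ℕ} (p : ℝ) (g : EuclideanSpace ℝ (Fin d) → ℝ≥0∞) : ℝ≥0∞ :=
  (∫⁻ q, g q ^ p) ^ (1 / p)

/-- `L^p` (quasi-)norm over a subset `S ⊆ ℝ^{n-1}`. -/
def bLpOn {d : ℕ} (p : ℝ) (S : Set (EuclideanSpace ℝ (Fin d)))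
    (g : EuclideanSpace ℝ (Fin d) → ℝ≥0∞) : ℝ≥0∞ :=
  (∫⁻ q in S, g q ^ p) ^ (1 / p)

/-- Localized Hardy–Littlewood maximal function, over balls contained in `R`. -/
def MHL {d : ℕ} (R : Set (EuclideanSpace ℝ (Fin d))) (g : EuclideanSpace ℝ (Fin d) → ℝ≥0∞)
    (x : EuclideanSpace ℝ (Fin d)) : ℝ≥0∞ :=
  ⨆ (z : EuclideanSpace ℝ (Fin d)) (ρ : ℝ) (_ : 0 < ρ) (_ : x ∈ Metric.ball z ρ)
      (_ : Metric.ball z ρ ⊆ R),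
    (volume (Metric.ball z ρ))⁻¹ * ∫⁻ y in Metric.ball z ρ, g y

/-! ## Carleson measures on the half-space -/

/-- `μ` is a Carleson measure on `ℝⁿ₊` with norm at most `K`. -/
def CarlNormLE {n : ℕ} (μ : Measure (Pt n)) (K : ℝ) : Prop :=
  ∀ (q : EE n) (r : ℝ), 0 < r →
    μ (Metric.ball q r ×ˢ Ioo 0 r) ≤ ENNReal.ofReal K * volume (Metric.ball q r)

/-- `μ` is a Carleson measure on `ℝⁿ₊`. -/
def IsCarleson {n : ℕ} (μ : Measure (Pt n)) : Prop := ∃ K : ℝ, 0 ≤ K ∧ CarlNormLE μ K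

/-- The measure with density `g` with respect to Lebesgue measure. -/
def densM {n : ℕ} (g : Pt n → ℝ≥0∞) : Measure (Pt n) := volume.withDensity g

/-! ## Ellipticity, weak solutions, solvability (half-space) -/

/-- Uniform ellipticity of an `m × m` matrix-valued function on `Ω`. -/
def EllipticOn {n m : ℕ} (Ω : Set (Pt n)) (A : Pt n → Fin m → Fin m → ℝ)
    (lam Lam : ℝ) : Prop :=
  ∀ X ∈ Ω,
    (∀ ξ : Fin m → ℝ, lam * ∑ i, ξ i ^ 2 ≤ ∑ i, ∑ j, A X i j * ξ j * ξ i) ∧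
    (∀ ξ η : Fin m → ℝ, |∑ i, ∑ j, A X i j * ξ j * η i| ≤
      Lam * Real.sqrt (∑ i, ξ i ^ 2) * Real.sqrt (∑ i, η i ^ 2))

/-- Smooth compactly supported test function with support in `Ω`. -/
def TestFun {n : ℕ} (Ω : Set (Pt n)) (ϕ : Pt n → ℝ) : Prop :=
  ContDiff ℝ (⊤ : ℕ∞) ϕ ∧ HasCompactSupport ϕ ∧ tsupport ϕ ⊆ Ω

/-- Weak solution of `div(A∇u)=0` in `ℝⁿ₊`. -/
def WeakSolution {n : ℕ} (A : Pt n → Fin n → Fin n → ℝ) (u : Pt n → ℝ) : Prop :=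
  (∀ X ∈ UHS n, DifferentiableAt ℝ u X) ∧
  ∀ ϕ : Pt n → ℝ, TestFun (UHS n) ϕ →
    (∫ X in UHS n, ∑ i, ∑ j, A X i j * pd j u X * pd i ϕ X) = 0

/-- Finite Dirichlet energy: `u ∈ Ẇ^{1,2}(ℝⁿ₊)`. -/
def FiniteEnergy {n : ℕ} (u : Pt n → ℝ) : Prop :=
  (∫⁻ X in UHS n, ENNReal.ofReal (gradSq u X)) < ⊤

/-- `u` has (vertical nontangential) boundary trace `f`. -/
def HasTrace {n : ℕ} (u : Pt n → ℝ) (f : EE n → ℝ) : Prop :=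
  ∀ q : EE n, Tendsto (fun t : ℝ => u (q, t)) (nhdsWithin 0 (Ioi 0)) (nhds (f q))

/-- Energy solution of the Dirichlet problem with data `f`. -/
def EnergySolution {n : ℕ} (A : Pt n → Fin n → Fin n → ℝ) (u : Pt n → ℝ)
    (f : EE n → ℝ) : Prop :=
  WeakSolution A u ∧ FiniteEnergy u ∧ HasTrace u f

/-- Solvability of the `L^p` Dirichlet problem in `ℝⁿ₊`. -/
def DirichletSolvable {n : ℕ} (A : Pt n → Fin n → Fin n → ℝ) (p : ℝ) : Prop :=
  ∃ C : ℝ, 0 < C ∧ ∀ u f, EnergySolution A u f →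
    bLp p (NT 1 u) ≤ ENNReal.ofReal C * bLp p (fun q => ENNReal.ofReal |f q|)

/-- Solvability of the `L^p` Regularity problem in `ℝⁿ₊`. -/
def RegularitySolvable {n : ℕ} (A : Pt n → Fin n → Fin n → ℝ) (p : ℝ) : Prop :=
  ∃ C : ℝ, 0 < C ∧ ∀ u f, EnergySolution A u f → (∀ q, DifferentiableAt ℝ f q) →
    bLp p (NTav 1 (gradSq u)) ≤
      ENNReal.ofReal C * bLp p (fun q => ENNReal.ofReal (gradSqE f q) ^ (1 / 2 : ℝ))

/-- The `n × n` block matrix built from an `(n-1) × (n-1)` matrix `A_∥`. -/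
def blockOf {n : ℕ} (Apar : Pt n → Fin (n - 1) → Fin (n - 1) → ℝ) (X : Pt n)
    (i j : Fin n) : ℝ :=
  if h : (i : ℕ) < n - 1 ∧ (j : ℕ) < n - 1 then Apar X ⟨i, h.1⟩ ⟨j, h.2⟩
  else if (i : ℕ) = (j : ℕ) then 1 else 0

/-- The upper-left `(n-1) × (n-1)` block `A_∥` of an `n × n` matrix. -/
def parOf {n : ℕ} (A : Pt n → Fin n → Fin n → ℝ) (X : Pt n)
    (i j : Fin (n - 1)) : ℝ :=
  A X (Fin.castLE (Nat.sub_le n 1) i) (Fin.castLE (Nat.sub_le n 1) j)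

/-- Transpose of a matrix-valued function. -/
def transp {n m : ℕ} (A : Pt n → Fin m → Fin m → ℝ) : Pt n → Fin m → Fin m → ℝ :=
  fun X i j => A X j i

/-! ## Lipschitz graph domains -/

/-- The domain above the graph of `φ`. -/
def gdom {n : ℕ} (φ : EE n → ℝ) : Set (Pt n) := {X | φ X.1 < X.2}

/-- Distance to the boundary (the graph of `φ`). -/
def gdist {n : ℕ} (φ : EE n → ℝ) (X : Pt n) : ℝ := ⨅ q : EE n, dist2 X (q, φ q)

/-- Whitney ball in a graph domain. -/
def gwball {n : ℕ} (φ : EE n → ℝ) (X : Pt n) : Set (Pt n) := ball2 X (gdist φ X / 2)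

/-- Nontangential cone at the boundary point `(q, φ q)`. -/
def gcone {n : ℕ} (φ : EE n → ℝ) (a : ℝ) (q : EE n) : Set (Pt n) :=
  {X | X ∈ gdom φ ∧ dist2 X (q, φ q) ≤ (1 + a) * gdist φ X}

/-- Truncated cone in a graph domain. -/
def gconeTrunc {n : ℕ} (φ : EE n → ℝ) (a h : ℝ) (q : EE n) : Set (Pt n) :=
  gcone φ a q ∩ {X | dist2 X (q, φ q) < h}

/-- Nontangential maximal function in a graph domain. -/
def gNT {n : ℕ} (φ : EE n → ℝ) (a : ℝ) (F : Pt n → ℝ) (q : EE n) : ℝ≥0∞ :=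
  ⨆ X ∈ gcone φ a q, ENNReal.ofReal |F X|

/-- Truncated nontangential maximal function of a vector-valued function. -/
def gNTvTr {n m : ℕ} (φ : EE n → ℝ) (a h : ℝ) (w : Fin m → Pt n → ℝ) (q : EE n) : ℝ≥0∞ :=
  ⨆ X ∈ gconeTrunc φ a h q, ENNReal.ofReal (Real.sqrt (∑ k, w k X ^ 2))

/-- `L²`-averaged nontangential maximal function in a graph domain,
applied to the squared density `G`. -/
def gNTav {n : ℕ} (φ : EE n → ℝ) (a : ℝ) (G : Pt n → ℝ) (q : EE n) : ℝ≥0∞ :=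
  ⨆ X ∈ gcone φ a q,
    ((volume (gwball φ X))⁻¹ * ∫⁻ Y in gwball φ X, ENNReal.ofReal (G Y)) ^ (1 / 2 : ℝ)

/-- Square function over a region in a graph domain (squared density `G`). -/
def gSFon {n : ℕ} (φ : EE n → ℝ) (Γ : Set (Pt n)) (G : Pt n → ℝ) : ℝ≥0∞ :=
  (∫⁻ X in Γ, ENNReal.ofReal (G X) * ENNReal.ofReal (gdist φ X ^ ((2 : ℝ) - n))) ^ (1 / 2 : ℝ)

/-- Carleson measure condition in a graph domain (surface measure of a boundary
ball of radius `r` is comparable to `r^{n-1}`). -/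
def gCarlNormLE {n : ℕ} (φ : EE n → ℝ) (μ : Measure (Pt n)) (K : ℝ) : Prop :=
  ∀ (q : EE n) (r : ℝ), 0 < r →
    μ (ball2 (q, φ q) r ∩ gdom φ) ≤ ENNReal.ofReal (K * r ^ (n - 1))

def gIsCarleson {n : ℕ} (φ : EE n → ℝ) (μ : Measure (Pt n)) : Prop :=
  ∃ K : ℝ, 0 ≤ K ∧ gCarlNormLE φ μ K

/-- The density of the oscillation Carleson measure
`δ(X)^{-1} [sup_{Y,Z ∈ B(X,δ(X)/2)} |A(Y) - A(Z)|]²`. -/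
def oscDens {n : ℕ} (φ : EE n → ℝ) (A : Pt n → Fin n → Fin n → ℝ) (X : Pt n) : ℝ≥0∞ :=
  (ENNReal.ofReal (gdist φ X))⁻¹ *
    (⨆ Y ∈ gwball φ X, ⨆ Z ∈ gwball φ X,
        ENNReal.ofReal (mnorm fun p q => A Y p q - A Z p q)) ^ 2

/-- `u` has boundary trace `f` on the graph (vertical nontangential limits). -/
def gHasTrace {n : ℕ} (φ : EE n → ℝ) (u : Pt n → ℝ) (f : EE n → ℝ) : Prop :=
  ∀ q : EE n, Tendsto (fun t : ℝ => u (q, φ q + t)) (nhdsWithin 0 (Ioi 0)) (nhds (f q))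

/-- Weak solution of `div(A∇u)=0` in the graph domain. -/
def gWeakSolution {n : ℕ} (φ : EE n → ℝ) (A : Pt n → Fin n → Fin n → ℝ)
    (u : Pt n → ℝ) : Prop :=
  (∀ X ∈ gdom φ, DifferentiableAt ℝ u X) ∧
  ∀ ϕ : Pt n → ℝ, TestFun (gdom φ) ϕ →
    (∫ X in gdom φ, ∑ i, ∑ j, A X i j * pd j u X * pd i ϕ X) = 0

def gFiniteEnergy {n : ℕ} (φ : EE n → ℝ) (u : Pt n → ℝ) : Prop :=
  (∫⁻ X in gdom φ, ENNReal.ofReal (gradSq u X)) < ⊤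

def gEnergySolution {n : ℕ} (φ : EE n → ℝ) (A : Pt n → Fin n → Fin n → ℝ)
    (u : Pt n → ℝ) (f : EE n → ℝ) : Prop :=
  gWeakSolution φ A u ∧ gFiniteEnergy φ u ∧ gHasTrace φ u f

/-- Solvability of the `L^p` Dirichlet problem in the graph domain. -/
def gDirichletSolvable {n : ℕ} (φ : EE n → ℝ) (A : Pt n → Fin n → Fin n → ℝ)
    (p : ℝ) : Prop :=
  ∃ C : ℝ, 0 < C ∧ ∀ u f, gEnergySolution φ A u f →
    bLp p (gNT φ 1 u) ≤ ENNReal.ofReal C * bLp p (fun q => ENNReal.ofReal |f q|)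

/-- Solvability of the `L^p` Regularity problem in the graph domain; the boundary
datum is identified with a function `f` of `x ∈ ℝ^{n-1}`, and `∇_T f` with `∇_x f`. -/
def gRegularitySolvable {n : ℕ} (φ : EE n → ℝ) (A : Pt n → Fin n → Fin n → ℝ)
    (p : ℝ) : Prop :=
  ∃ C : ℝ, 0 < C ∧ ∀ u f, gEnergySolution φ A u f → (∀ q, DifferentiableAt ℝ f q) →
    bLp p (gNTav φ 1 (gradSq u)) ≤
      ENNReal.ofReal C * bLp p (fun q => ENNReal.ofReal (gradSqE f q) ^ (1 / 2 : ℝ))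

/-- Solvability of the `L^p` Neumann problem in the graph domain. The co-normal
data `f` is identified with a function of `x ∈ ℝ^{n-1}`. -/
def gNeumannSolvable {n : ℕ} (φ : EE n → ℝ) (A : Pt n → Fin n → Fin n → ℝ)
    (p : ℝ) : Prop :=
  ∃ C : ℝ, 0 < C ∧ ∀ (u : Pt n → ℝ) (f : EE n → ℝ),
    (∀ X ∈ gdom φ, DifferentiableAt ℝ u X) → gFiniteEnergy φ u →
    Integrable f → (∫ q, f q) = 0 →
    (∀ η : Pt n → ℝ, ContDiff ℝ (⊤ : ℕ∞) η → HasCompactSupport η →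
      (∫ X in gdom φ, ∑ i, ∑ j, A X i j * pd j u X * pd i η X) = ∫ q, f q * η (q, φ q)) →
    bLp p (gNTav φ 1 (gradSq u)) ≤ ENNReal.ofReal C * bLp p (fun q => ENNReal.ofReal |f q|)

/-! ## The weakly coupled system of Section 5 -/

/-- The common setup for the weakly coupled system: `B_∥` satisfies the Carleson
condition with constant `M`, the `v_m` are energy solutions of the block-form
operator with data `∂_m f`, and `η` solves the weakly coupled system with zero
boundary data. -/
def WCSetup {n : ℕ} (Bpar : Pt n → Fin (n - 1) → Fin (n - 1) → ℝ) (M : ℝ)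
    (f : EE n → ℝ) (v η : Fin (n - 1) → Pt n → ℝ) : Prop :=
  LocallyLipschitz Bpar ∧
  CarlNormLE (densM fun X => ENNReal.ofReal (gradxA Bpar X ^ 2 * X.2)) M ∧
  (∀ X ∈ UHS n, (X.2 * gradxA Bpar X) ^ 2 ≤ M) ∧
  (∫⁻ q, ENNReal.ofReal (gradSqE f q)) < ⊤ ∧
  (∀ q, DifferentiableAt ℝ f q) ∧
  (∀ m : Fin (n - 1), EnergySolution (blockOf Bpar) (v m) (fun q => pdE m f q)) ∧
  (∀ m : Fin (n - 1),
    (∀ X ∈ UHS n, DifferentiableAt ℝ (η m) X) ∧ FiniteEnergy (η m) ∧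
    HasTrace (η m) (fun _ => 0) ∧
    ∀ ϕ : Pt n → ℝ, TestFun (UHS n) ϕ →
      (∫ X in UHS n, (∑ i : Fin (n - 1), ∑ j : Fin (n - 1),
          Bpar X i j * pdx j (η m) X * pdx i ϕ X) + pdt (η m) X * pdt ϕ X) =
        -∫ X in UHS n, ∑ i : Fin (n - 1), ∑ j : Fin (n - 1),
            pdx m (fun Z => Bpar Z i j) X * (v j X + η j X) * pdx i ϕ X)


section abstractE
open scoped Convolution Topology
open ContinuousLinearMap

theorem conv_fderiv_apply {E : Type*} [NormedAddCommGroup E] [NormedSpace ℝ E]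
    [FiniteDimensional ℝ E] [MeasurableSpace E] [BorelSpace E] (μ : Measure E)
    [μ.IsAddHaarMeasure] (ρ ϕ : E → ℝ) (hρ : ContDiff ℝ 1 ρ) (hρc : HasCompactSupport ρ)
    (hϕ : Differentiable ℝ ϕ) (v : E)
    (hi : Integrable (fun X => fderiv ℝ ϕ X v) μ) (x : E) :
    fderiv ℝ (ρ ⋆[lsmul ℝ ℝ, μ] ϕ) x v = ∫ t, ρ t * fderiv ℝ ϕ (x - t) v ∂μ := by
  have hloc : LocallyIntegrable ϕ μ := hϕ.continuous.locallyIntegrable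
  rw [(hρc.hasFDerivAt_convolution_left (lsmul ℝ ℝ) hρ hloc x).fderiv]
  have hex := (hρc.fderiv ℝ).convolutionExists_left (L := (lsmul ℝ ℝ : ℝ →L[ℝ] ℝ →L[ℝ] ℝ).precompL E) (μ := μ) (hρ.continuous_fderiv one_ne_zero) hloc x
  have h1 : ((fderiv ℝ ρ ⋆[(lsmul ℝ ℝ : ℝ →L[ℝ] ℝ →L[ℝ] ℝ).precompL E, μ] ϕ) x) v
      = ∫ t, fderiv ℝ ρ t v * ϕ (x - t) ∂μ := by
    unfold convolution
    rw [ContinuousLinearMap.integral_apply hex]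
    rfl
  rw [h1]
  have hd : ∀ t, fderiv ℝ (fun s => ϕ (x - s)) t v = - fderiv ℝ ϕ (x - t) v := by
    intro t
    have := (hϕ (x - t)).hasFDerivAt.comp t ((hasFDerivAt_id t).const_sub x)
    have h2 : fderiv ℝ (fun s => ϕ (x - s)) t = _ := this.fderiv
    rw [h2]; simp
  have hcont : Continuous fun t => ϕ (x - t) := hϕ.continuous.comp (by fun_prop)
  have hb : ∃ C, ∀ t, ‖ρ t‖ ≤ C := hρ.continuous.bounded_above_of_compact_support hρc
  obtain ⟨C, hC⟩ := hb
  have hi2 : Integrable (fun t => fderiv ℝ ϕ (x - t) v) μ := hi.comp_sub_left x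
  have ibp := integral_mul_fderiv_eq_neg_fderiv_mul_of_integrable (μ := μ) (v := v)
    (f := ρ) (g := fun s => ϕ (x - s)) ?_ ?_ ?_ ?_ ?_
  · simp only [hd] at ibp
    simp only [mul_neg, integral_neg, neg_inj] at ibp
    exact ibp.symm
  · apply Continuous.integrable_of_hasCompactSupport
    · exact ((hρ.continuous_fderiv one_ne_zero).clm_apply continuous_const).mul hcont
    · exact ((hρc.fderiv ℝ).comp_left (g := fun L : E →L[ℝ] ℝ => L v) (by simp)).mul_right
  · simp only [hd]
    exact (hi2.neg).bdd_mul hρ.continuous.aestronglyMeasurable (ae_of_all _ hC)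
  · apply Continuous.integrable_of_hasCompactSupport
    · exact hρ.continuous.mul hcont
    · exact hρc.mul_right
  · exact fun t _ => hρ.differentiable one_ne_zero t
  · intro t _
    exact (hϕ (x - t)).comp t ((differentiableAt_const x).sub differentiableAt_id)


theorem continuous_translate_pair {E : Type*} [NormedAddCommGroup E] [NormedSpace ℝ E]
    [FiniteDimensional ℝ E] [MeasurableSpace E] [BorelSpace E] (μ : Measure E)
    [μ.IsAddHaarMeasure] (G h : E → ℝ) (hG : MemLp G 2 μ) (hh : MemLp h 2 μ) :
    Continuous (fun z => ∫ X, G X * h (z + X) ∂μ) := by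
  have : Fact ((2 : ℝ≥0∞) ≠ ∞) := ⟨by simp⟩
  have key : ∀ z : E, ∫ X, G X * h (z + X) ∂μ =
      inner ℝ (hG.toLp G) ((DomAddAct.mk z) +ᵥ (hh.toLp h) : Lp ℝ 2 μ) := by
    intro z
    rw [L2.inner_def]
    apply integral_congr_ae
    have h1 := hG.coeFn_toLp
    have h2 := hh.coeFn_toLp
    have h3 : ((DomAddAct.mk z +ᵥ (hh.toLp h) : Lp ℝ 2 μ) : E → ℝ) =ᵐ[μ] (hh.toLp h) ∘ (fun X => z + X) :=
      Lp.coeFn_compMeasurePreserving _ (measurePreserving_add_left μ z)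
    have h4 := (measurePreserving_add_left μ z).quasiMeasurePreserving.ae_eq_comp h2
    filter_upwards [h1, h3, h4] with X a1 a3 a4
    simp only [Function.comp_apply] at a3 a4
    rw [a1, a3, a4]
    simp [mul_comm]
  simp_rw [key]
  have : Continuous fun z : E => (DomAddAct.mk z +ᵥ (hh.toLp h) : Lp ℝ 2 μ) :=
    (DomAddAct.continuous_mk).vadd continuous_const
  exact continuous_const.inner this


theorem shear_integrable {E : Type*} [NormedAddCommGroup E] [NormedSpace ℝ E]
    [FiniteDimensional ℝ E] [MeasurableSpace E] [BorelSpace E] (μ : Measure E)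
    [μ.IsAddHaarMeasure] (G h : E → ℝ) (hG : Integrable G μ) (hh : Integrable h μ) :
    Integrable (fun p : E × E => G p.1 * h (p.1 - p.2)) (μ.prod μ) := by
  have h1 : Integrable (fun p : E × E => G p.1 * h p.2) (μ.prod μ) := hG.mul_prod hh
  have mp : MeasurePreserving (fun p : E × E => (p.1, -(-p.1 + p.2))) (μ.prod μ) (μ.prod μ) :=
    ((MeasurePreserving.id μ).prod (Measure.measurePreserving_neg μ)).comp
      (measurePreserving_prod_neg_add μ μ)
  have := mp.integrable_comp_of_integrable h1
  refine this.congr (ae_of_all _ fun p => ?_)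
  simp only [Function.comp_apply]
  congr 2
  abel

/-- bump functions shrinking to zero -/
def bumpSeq (E : Type*) [NormedAddCommGroup E] (k : ℕ) : ContDiffBump (0 : E) where
  rIn := 1 / (2 * ((k : ℝ) + 1))
  rOut := 1 / ((k : ℝ) + 1)
  rIn_pos := by positivity
  rIn_lt_rOut := by
    apply one_div_lt_one_div_of_lt <;> nlinarith [Nat.cast_nonneg (α := ℝ) k]

theorem bumpSeq_tendsto (E : Type*) [NormedAddCommGroup E] :
    Tendsto (fun k => (bumpSeq E k).rOut) atTop (𝓝 0) :=
  tendsto_one_div_add_atTop_nhds_zero_nat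

/-- Extension of a weak identity from smooth test functions to everywhere differentiable
test functions with square integrable gradients. -/
theorem extend_test {E : Type*} [NormedAddCommGroup E] [NormedSpace ℝ E]
    [FiniteDimensional ℝ E] [MeasurableSpace E] [BorelSpace E] (μ : Measure E)
    [μ.IsAddHaarMeasure] {ι : Type*} [Fintype ι] (e : ι → E) (U : Set E) (hU : IsOpen U)
    (G : ι → E → ℝ) (hG : ∀ i, MemLp (G i) 2 μ) (hG1 : ∀ i, Integrable (G i) μ)
    (hw : ∀ ψ : E → ℝ, ContDiff ℝ (⊤ : ℕ∞) ψ → HasCompactSupport ψ → tsupport ψ ⊆ U →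
      ∫ X, ∑ i, G i X * fderiv ℝ ψ X (e i) ∂μ = 0)
    (ϕ : E → ℝ) (hϕ : Differentiable ℝ ϕ) (hϕc : HasCompactSupport ϕ) (hϕU : tsupport ϕ ⊆ U)
    (hL2 : ∀ i, MemLp (fun X => fderiv ℝ ϕ X (e i)) 2 μ)
    (hL1 : ∀ i, Integrable (fun X => fderiv ℝ ϕ X (e i)) μ) :
    ∫ X, ∑ i, G i X * fderiv ℝ ϕ X (e i) ∂μ = 0 := by
  have hρ : ∀ k, ContDiff ℝ (⊤ : ℕ∞) ((bumpSeq E k).normed μ) := fun k => (bumpSeq E k).contDiff_normed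
  have hρc : ∀ k, HasCompactSupport ((bumpSeq E k).normed μ) := fun k => (bumpSeq E k).hasCompactSupport_normed
  set I : E → ℝ := fun z => ∑ i, ∫ X, G i X * fderiv ℝ ϕ (z + X) (e i) ∂μ with hI
  have hIc : Continuous I :=
    continuous_finsetSum _ fun i _ => continuous_translate_pair μ _ _ (hG i) (hL2 i)
  have hGm : ∀ i, Integrable (fun X => G i X * fderiv ℝ ϕ X (e i)) μ := fun i => by
    have := (hG i).integrable_mul (hL2 i)
    exact this
  have hI0 : I 0 = ∫ X, ∑ i, G i X * fderiv ℝ ϕ X (e i) ∂μ := by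
    rw [integral_finsetSum _ (fun i _ => hGm i)]
    simp [hI]
  rw [← hI0]
  have hlim := ContDiffBump.convolution_tendsto_right_of_continuous (μ := μ)
    (bumpSeq_tendsto E) hIc 0
  -- eventually the convolution vanishes
  obtain ⟨δ, hδ, hδU⟩ := hϕc.isCompact.exists_cthickening_subset_open hU hϕU
  have hev : ∀ᶠ k in atTop, (((bumpSeq E k).normed μ ⋆[lsmul ℝ ℝ, μ] I) 0) = 0 := by
    have hsm : ∀ᶠ k in atTop, (bumpSeq E k).rOut < δ := (bumpSeq_tendsto E).eventually_lt_const hδ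
    filter_upwards [hsm] with k hk
    set ρ := (bumpSeq E k).normed μ with hρdef
    have hψc : HasCompactSupport (ρ ⋆[lsmul ℝ ℝ, μ] ϕ) := (hρc k).convolution _ hϕc
    have hψs : ContDiff ℝ (⊤ : ℕ∞) (ρ ⋆[lsmul ℝ ℝ, μ] ϕ) :=
      (hρc k).contDiff_convolution_left _ (hρ k) hϕ.continuous.locallyIntegrable
    have hψU : tsupport (ρ ⋆[lsmul ℝ ℝ, μ] ϕ) ⊆ U := by
      refine subset_trans ?_ hδU
      apply closure_minimal _ Metric.isClosed_cthickening
      refine (support_convolution_subset _).trans ?_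
      rintro x ⟨z, hz, y, hy, rfl⟩
      rw [hρdef, (bumpSeq E k).support_normed_eq] at hz
      apply Metric.mem_cthickening_of_dist_le _ y _ _ (subset_tsupport _ hy)
      simp only [Metric.mem_ball, dist_zero_right] at hz
      simp only [dist_eq_norm, add_sub_cancel_right]
      linarith
    have h0 := hw _ hψs hψc hψU
    have hd : ∀ i X, fderiv ℝ (ρ ⋆[lsmul ℝ ℝ, μ] ϕ) X (e i) =
        ∫ t, ρ t * fderiv ℝ ϕ (X - t) (e i) ∂μ := fun i X =>
      conv_fderiv_apply μ ρ ϕ ((hρ k).of_le (by exact_mod_cast le_top)) (hρc k) hϕ (e i) (hL1 i) X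
    obtain ⟨C, hC⟩ := (hρ k).continuous.bounded_above_of_compact_support (hρc k)
    have hintg : ∀ i, Integrable (fun p : E × E => G i p.1 * (ρ p.2 * fderiv ℝ ϕ (p.1 - p.2) (e i))) (μ.prod μ) := by
      intro i
      have := (shear_integrable μ _ _ (hG1 i) (hL1 i)).bdd_mul (f := fun p : E × E => ρ p.2) (c := C)
        ((hρ k).continuous.comp continuous_snd).aestronglyMeasurable (ae_of_all _ fun p => hC p.2)
      refine this.congr (ae_of_all _ fun p => ?_)
      simp only; ring
    have hswap : ∀ i, ∫ X, G i X * fderiv ℝ (ρ ⋆[lsmul ℝ ℝ, μ] ϕ) X (e i) ∂μ =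
        ∫ t, ρ t * ∫ X, G i X * fderiv ℝ ϕ (X - t) (e i) ∂μ ∂μ := by
      intro i
      calc _ = ∫ X, ∫ t, G i X * (ρ t * fderiv ℝ ϕ (X - t) (e i)) ∂μ ∂μ := by
            apply integral_congr_ae (ae_of_all _ fun X => ?_)
            simp only [hd, integral_const_mul]
        _ = ∫ t, ∫ X, G i X * (ρ t * fderiv ℝ ϕ (X - t) (e i)) ∂μ ∂μ :=
            integral_integral_swap (hintg i)
        _ = _ := by
            apply integral_congr_ae (ae_of_all _ fun t => ?_)
            rw [← integral_const_mul]
            congr 1; ext X; ring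
    have hfin : ∀ i, Integrable (fun t => ρ t * ∫ X, G i X * fderiv ℝ ϕ (-t + X) (e i) ∂μ) μ := by
      intro i
      apply Continuous.integrable_of_hasCompactSupport
      · exact (hρ k).continuous.mul ((continuous_translate_pair μ _ _ (hG i) (hL2 i)).comp continuous_neg)
      · exact (hρc k).mul_right
    have hsum : ∫ X, ∑ i, G i X * fderiv ℝ (ρ ⋆[lsmul ℝ ℝ, μ] ϕ) X (e i) ∂μ =
        ∑ i, ∫ X, G i X * fderiv ℝ (ρ ⋆[lsmul ℝ ℝ, μ] ϕ) X (e i) ∂μ := by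
      apply integral_finsetSum
      intro i _
      have := (hintg i).integral_prod_left
      refine this.congr (ae_of_all _ fun X => ?_)
      simp only [hd, integral_const_mul]
    rw [hsum] at h0
    simp_rw [hswap] at h0
    rw [← h0]
    unfold convolution
    simp only [lsmul_apply, smul_eq_mul, hI, zero_sub]
    simp_rw [Finset.mul_sum]
    rw [integral_finsetSum _ (fun i _ => hfin i)]
    simp_rw [sub_eq_neg_add]
  exact tendsto_nhds_unique hlim (tendsto_const_nhds.congr' (hev.mono fun k hk => hk.symm))

/-- Gagliardo-Nirenberg-Sobolev for everywhere differentiable functions. -/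
theorem sobolev_diff {E : Type*} [NormedAddCommGroup E] [NormedSpace ℝ E]
    [FiniteDimensional ℝ E] [MeasurableSpace E] [BorelSpace E] (μ : Measure E)
    [μ.IsAddHaarMeasure] {ι : Type*} [Fintype ι] (e : ι → E)
    (he : ∀ L : E →L[ℝ] ℝ, ‖L‖ ≤ ∑ i, |L (e i)|) (p : ℝ)
    (hp : Real.HolderConjugate (Module.finrank ℝ E) p) :
    ∃ C : ℝ≥0, ∀ w : E → ℝ, Differentiable ℝ w → HasCompactSupport w →
      (∀ i, Integrable (fun X => fderiv ℝ w X (e i)) μ) →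
      ∫⁻ X, ‖w X‖ₑ ^ p ∂μ ≤ C * (∑ i, ∫⁻ X, ‖fderiv ℝ w X (e i)‖ₑ ∂μ) ^ p := by
  refine ⟨lintegralPowLePowLIntegralFDerivConst μ p, fun w hw hwc hL1 => ?_⟩
  have hp0 : 0 < p := hp.symm.pos
  have hρ : ∀ k, ContDiff ℝ (⊤ : ℕ∞) ((bumpSeq E k).normed μ) := fun k => (bumpSeq E k).contDiff_normed
  have hρc : ∀ k, HasCompactSupport ((bumpSeq E k).normed μ) := fun k => (bumpSeq E k).hasCompactSupport_normed
  set ψ : ℕ → E → ℝ := fun k => ((bumpSeq E k).normed μ ⋆[lsmul ℝ ℝ, μ] w) with hψ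
  have hψs : ∀ k, ContDiff ℝ (⊤ : ℕ∞) (ψ k) := fun k =>
      (hρc k).contDiff_convolution_left _ (hρ k) hw.continuous.locallyIntegrable
  have hψc : ∀ k, HasCompactSupport (ψ k) := fun k => (hρc k).convolution _ hwc
  have hbd : ∀ k, ∫⁻ X, ‖ψ k X‖ₑ ^ p ∂μ ≤ lintegralPowLePowLIntegralFDerivConst μ p *
      (∑ i, ∫⁻ X, ‖fderiv ℝ w X (e i)‖ₑ ∂μ) ^ p := by
    intro k
    refine (lintegral_pow_le_pow_lintegral_fderiv μ ((hψs k).of_le (by exact_mod_cast le_top)) (hψc k) hp).trans ?_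
    gcongr
    have hfm : ∀ i, Measurable fun X => ‖fderiv ℝ w X (e i)‖ₑ := fun i => (measurable_fderiv_apply_const ℝ w (e i)).enorm
    calc ∫⁻ X, ‖fderiv ℝ (ψ k) X‖ₑ ∂μ ≤ ∫⁻ X, ∑ i, ‖fderiv ℝ (ψ k) X (e i)‖ₑ ∂μ := by
          apply lintegral_mono
          intro X
          have := he (fderiv ℝ (ψ k) X)
          simp only [← ofReal_norm]
          rw [← ENNReal.ofReal_sum_of_nonneg (fun i _ => norm_nonneg _)]
          exact ENNReal.ofReal_le_ofReal this
      _ = ∑ i, ∫⁻ X, ‖fderiv ℝ (ψ k) X (e i)‖ₑ ∂μ := by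
          apply lintegral_finsetSum
          intro i _
          exact (measurable_fderiv_apply_const ℝ (ψ k) (e i)).enorm
      _ ≤ _ := by
          apply Finset.sum_le_sum
          intro i _
          set ρ := (bumpSeq E k).normed μ with hρdef
          calc ∫⁻ X, ‖fderiv ℝ (ψ k) X (e i)‖ₑ ∂μ
              ≤ ∫⁻ X, ∫⁻ t, ‖ρ t‖ₑ * ‖fderiv ℝ w (X - t) (e i)‖ₑ ∂μ ∂μ := by
                apply lintegral_mono
                intro X
                simp only
                rw [conv_fderiv_apply μ ρ w ((hρ k).of_le (by exact_mod_cast le_top)) (hρc k) hw (e i) (hL1 i) X]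
                refine (enorm_integral_le_lintegral_enorm _).trans ?_
                simp [enorm_mul]
            _ = ∫⁻ t, ∫⁻ X, ‖ρ t‖ₑ * ‖fderiv ℝ w (X - t) (e i)‖ₑ ∂μ ∂μ := by
                apply lintegral_lintegral_swap
                apply Measurable.aemeasurable
                exact Measurable.mul (f := fun q : E × E => ‖ρ q.2‖ₑ)
                  (g := fun q : E × E => ‖fderiv ℝ w (q.1 - q.2) (e i)‖ₑ)
                  ((hρ k).continuous.measurable.comp measurable_snd).enorm
                  ((hfm i).comp (measurable_fst.sub measurable_snd))
            _ = ∫⁻ t, ‖ρ t‖ₑ * ∫⁻ X, ‖fderiv ℝ w X (e i)‖ₑ ∂μ ∂μ := by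
                apply lintegral_congr
                intro t
                rw [lintegral_const_mul]
                · rw [lintegral_sub_right_eq_self (fun X => ‖fderiv ℝ w X (e i)‖ₑ) t]
                · exact (hfm i).comp (measurable_id.sub measurable_const)
            _ = (∫⁻ t, ‖ρ t‖ₑ ∂μ) * ∫⁻ X, ‖fderiv ℝ w X (e i)‖ₑ ∂μ := by
                rw [lintegral_mul_const]
                exact (hρ k).continuous.measurable.enorm
            _ = _ := by
                have h1 : ∫⁻ t, ‖ρ t‖ₑ ∂μ = 1 := by
                  have h2 : ∫⁻ t, ‖ρ t‖ₑ ∂μ = ∫⁻ t, ENNReal.ofReal (ρ t) ∂μ := by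
                    apply lintegral_congr
                    intro t
                    exact Real.enorm_of_nonneg ((bumpSeq E k).nonneg_normed t)
                  rw [h2, ← ofReal_integral_eq_lintegral_ofReal (bumpSeq E k).integrable_normed
                    (ae_of_all _ fun t => (bumpSeq E k).nonneg_normed t), (bumpSeq E k).integral_normed]
                  simp
                rw [h1, one_mul]
  have hpt : ∀ X, Tendsto (fun k => ‖ψ k X‖ₑ ^ p) atTop (𝓝 (‖w X‖ₑ ^ p)) := by
    intro X
    have := ContDiffBump.convolution_tendsto_right_of_continuous (μ := μ)
      (bumpSeq_tendsto E) hw.continuous X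
    exact (ENNReal.continuous_rpow_const.tendsto _).comp ((continuous_enorm.tendsto _).comp this)
  calc ∫⁻ X, ‖w X‖ₑ ^ p ∂μ = ∫⁻ X, liminf (fun k => ‖ψ k X‖ₑ ^ p) atTop ∂μ := by
        apply lintegral_congr; intro X; exact (hpt X).liminf_eq.symm
    _ ≤ liminf (fun k => ∫⁻ X, ‖ψ k X‖ₑ ^ p ∂μ) atTop := by
        apply lintegral_liminf_le
        intro k
        exact ((hψs k).continuous.measurable.enorm).pow_const p
    _ ≤ _ := by
        refine (liminf_le_liminf (Eventually.of_forall hbd)).trans ?_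
        simp

end abstractE

theorem cut_hasFDerivAt {E : Type*} [NormedAddCommGroup E] [NormedSpace ℝ E]
    (U : Set E) (χ h : E → ℝ) (hχ : Differentiable ℝ χ) (hχU : tsupport χ ⊆ U)
    (hh : ∀ X ∈ U, DifferentiableAt ℝ h X) (X : E) :
    HasFDerivAt (fun Y => χ Y ^ 2 * h Y)
      ((2 * χ X * h X) • fderiv ℝ χ X + (χ X ^ 2) • fderiv ℝ h X) X := by
  by_cases hX : X ∈ tsupport χ
  · have h1 := (hχ X).hasFDerivAt
    have h2 := (hh X (hχU hX)).hasFDerivAt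
    have h3 := (h1.pow 2).mul h2
    refine h3.congr_fderiv ?_
    ext v
    simp
    ring
  · have h0 : χ =ᶠ[nhds X] 0 := notMem_tsupport_iff_eventuallyEq.mp hX
    have hx0 : χ X = 0 := h0.eq_of_nhds
    have hd0 : fderiv ℝ χ X = 0 := by rw [h0.fderiv_eq]; simp
    rw [hx0, hd0]
    simp only [mul_zero, zero_mul, smul_zero, ne_eq, OfNat.ofNat_ne_zero, not_false_eq_true,
      zero_pow, zero_smul, add_zero]
    refine (hasFDerivAt_const (0 : ℝ) X).congr_of_eventuallyEq ?_
    filter_upwards [h0] with Y hY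
    simp [hY]

theorem young1 (l a b : ℝ) (hl : 0 < l) : -(l * a ^ 2 + b ^ 2 / (4 * l)) ≤ a * b := by
  have : 0 ≤ (2 * l * a + b) ^ 2 / (4 * l) := by positivity
  have h2 : (2 * l * a + b) ^ 2 / (4 * l) = l * a ^ 2 + a * b + b ^ 2 / (4 * l) := by
    field_simp; ring
  linarith

theorem energy_alg {ι J : Type*} [Fintype ι] [Fintype J] (H : J → ι → ℝ) (u : J → ℝ)
    (c q : ι → ℝ) (g : J → ι → ℝ) (x Pr P r : ℝ) :
    ∑ m, ∑ i, H m i * (2 * x * (Pr * u m) * c i + x ^ 2 * (u m * (r * (Pr / P) * (2 * q i)) + Pr * g m i))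
    = Pr * (2 * x * ∑ m, ∑ i, H m i * (u m * c i) + x ^ 2 * (2 * r / P * ∑ m, ∑ i, H m i * (u m * q i))
      + x ^ 2 * ∑ m, ∑ i, H m i * g m i) := by
  simp only [Finset.mul_sum, ← Finset.sum_add_distrib]
  refine Finset.sum_congr rfl fun m _ => Finset.sum_congr rfl fun i _ => ?_
  ring

theorem energy_scal (a b p z r : ℝ) (ha : 0 ≤ a) (hb : 0 ≤ b) (hp : 0 ≤ p) (hz : 0 ≤ z) (hr : 0 ≤ r) :
    4 * a * p + (p + z) + b * (r * z / 2) + b * z ≤ (4 * a + 2 * b + 1) * (1 + r) * (p + z) := by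
  have h : (4 * a + 2 * b + 1) * (1 + r) * (p + z) - (4 * a * p + (p + z) + b * (r * z / 2) + b * z) =
    4 * a * z + 2 * b * p + b * z + r * (4 * a * p + 4 * a * z + 2 * b * p + (3 / 2) * b * z + p + z) := by ring
  have : 0 ≤ 4 * a * z + 2 * b * p + b * z + r * (4 * a * p + 4 * a * z + 2 * b * p + (3 / 2) * b * z + p + z) := by positivity
  linarith

/-- pointwise algebraic inequality in the energy estimate -/
theorem energy_pointwise {ι J : Type*} [Fintype ι] [Fintype J] (lam Lam : ℝ) (hlam : 0 < lam)
    (A : ι → ι → ℝ)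
    (hA1 : ∀ ξ : ι → ℝ, lam * ∑ i, ξ i ^ 2 ≤ ∑ i, ∑ j, A i j * ξ j * ξ i)
    (hA2 : ∀ ξ η : ι → ℝ, (∑ i, ∑ j, A i j * ξ j * η i) ^ 2 ≤ Lam ^ 2 * (∑ i, ξ i ^ 2) * ∑ i, η i ^ 2)
    (u : J → ℝ) (g F : J → ι → ℝ) (c : ι → ℝ) (x P f0 r Pr : ℝ) (hP : 0 < P) (hr : 0 ≤ r)
    (hPr : 0 ≤ Pr) (hu : ∑ m, u m ^ 2 ≤ P) (hF : ∑ m, ∑ i, F m i ^ 2 ≤ f0 ^ 2 * P) :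
    Pr * (lam / 2 * (x ^ 2 * ∑ m, ∑ i, g m i ^ 2)
      - (4 * Lam ^ 2 / lam + 2 / lam + 1) * (1 + r) * P * (∑ i, c i ^ 2 + f0 ^ 2 * x ^ 2)) ≤
    ∑ m, ∑ i, ((∑ j, A i j * g m j) + F m i) *
      (2 * x * (Pr * u m) * c i + x ^ 2 * (u m * (r * (Pr / P) * (2 * ∑ k, u k * g k i)) + Pr * g m i)) := by
  set T1 := ∑ m, ∑ i, ((∑ j, A i j * g m j) + F m i) * (u m * c i) with hT1
  set q : ι → ℝ := fun i => ∑ k, u k * g k i with hq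
  set T2 := ∑ m, ∑ i, ((∑ j, A i j * g m j) + F m i) * (u m * q i) with hT2
  set T3 := ∑ m, ∑ i, ((∑ j, A i j * g m j) + F m i) * g m i with hT3
  set D2 := ∑ m, ∑ i, g m i ^ 2 with hD2
  set c2 := ∑ i, c i ^ 2 with hc2
  have hc20 : 0 ≤ c2 := Finset.sum_nonneg fun i _ => sq_nonneg _
  have hD20 : 0 ≤ D2 := Finset.sum_nonneg fun m _ => Finset.sum_nonneg fun i _ => sq_nonneg _
  have e0 : ∑ m, ∑ i, ((∑ j, A i j * g m j) + F m i) *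
      (2 * x * (Pr * u m) * c i + x ^ 2 * (u m * (r * (Pr / P) * (2 * ∑ k, u k * g k i)) + Pr * g m i))
      = Pr * (2 * x * T1 + x ^ 2 * (2 * r / P * T2) + x ^ 2 * T3) := by
    exact energy_alg (fun m i => (∑ j, A i j * g m j) + F m i) u c q g x Pr P r
  rw [e0]
  apply mul_le_mul_of_nonneg_left _ hPr
  -- T3
  have b3 : lam * D2 - (lam / 4 * D2 + f0 ^ 2 * P / lam) ≤ T3 := by
    have h1 : ∑ m, (lam * ∑ i, g m i ^ 2) ≤ ∑ m, ∑ i, (∑ j, A i j * g m j) * g m i := by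
      refine Finset.sum_le_sum fun m _ => (hA1 (g m)).trans (le_of_eq ?_)
      refine Finset.sum_congr rfl fun i _ => ?_
      rw [Finset.sum_mul]
    have h2 : -(lam / 4 * D2 + (∑ m, ∑ i, F m i ^ 2) / lam) ≤ ∑ m, ∑ i, g m i * F m i := by
      have : -(lam / 4 * D2 + (∑ m, ∑ i, F m i ^ 2) / lam) =
          ∑ m, ∑ i, -(lam / 4 * g m i ^ 2 + F m i ^ 2 / (4 * (lam / 4))) := by
        simp only [hD2, Finset.mul_sum, Finset.sum_div, ← Finset.sum_add_distrib, ← Finset.sum_neg_distrib]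
        refine Finset.sum_congr rfl fun m _ => Finset.sum_congr rfl fun i _ => ?_
        congr 3; ring
      rw [this]
      exact Finset.sum_le_sum fun m _ => Finset.sum_le_sum fun i _ => young1 (lam / 4) _ _ (by positivity)
    have h3 : (∑ m, ∑ i, F m i ^ 2) / lam ≤ f0 ^ 2 * P / lam := by gcongr
    have h4 : T3 = ∑ m, ∑ i, (∑ j, A i j * g m j) * g m i + ∑ m, ∑ i, g m i * F m i := by
      rw [hT3, ← Finset.sum_add_distrib]
      refine Finset.sum_congr rfl fun m _ => ?_
      rw [← Finset.sum_add_distrib]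
      refine Finset.sum_congr rfl fun i _ => by ring
    rw [← Finset.mul_sum] at h1
    linarith
  -- uF
  have buF : ∑ i, (∑ m, u m * F m i) ^ 2 ≤ P * (f0 ^ 2 * P) := by
    calc ∑ i, (∑ m, u m * F m i) ^ 2 ≤ ∑ i, (∑ m, u m ^ 2) * ∑ m, F m i ^ 2 :=
          Finset.sum_le_sum fun i _ => Finset.sum_mul_sq_le_sq_mul_sq _ _ _
      _ = (∑ m, u m ^ 2) * ∑ m, ∑ i, F m i ^ 2 := by
          rw [← Finset.mul_sum, Finset.sum_comm]
      _ ≤ _ := by gcongr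
  -- T2
  have b2 : - (P * (f0 ^ 2 * P) / (4 * lam)) ≤ T2 := by
    have h1 : T2 = ∑ i, ∑ j, A i j * q j * q i + ∑ i, q i * ∑ m, u m * F m i := by
      rw [hT2, Finset.sum_comm, ← Finset.sum_add_distrib]
      refine Finset.sum_congr rfl fun i _ => ?_
      have : ∑ j, A i j * q j * q i = ∑ m, (∑ j, A i j * g m j) * (u m * q i) := by
        simp only [Finset.sum_mul]
        rw [Finset.sum_comm]
        refine Finset.sum_congr rfl fun j _ => ?_
        simp only [hq]
        generalize (∑ k, u k * g k i) = z
        rw [Finset.mul_sum, Finset.sum_mul]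
        refine Finset.sum_congr rfl fun k _ => by ring
      rw [this, Finset.mul_sum, ← Finset.sum_add_distrib]
      refine Finset.sum_congr rfl fun m _ => by ring
    have h2 : -(lam * ∑ i, q i ^ 2 + (∑ i, (∑ m, u m * F m i) ^ 2) / (4 * lam)) ≤ ∑ i, q i * ∑ m, u m * F m i := by
      have : -(lam * ∑ i, q i ^ 2 + (∑ i, (∑ m, u m * F m i) ^ 2) / (4 * lam)) =
          ∑ i, -(lam * q i ^ 2 + (∑ m, u m * F m i) ^ 2 / (4 * lam)) := by
        simp only [Finset.mul_sum, Finset.sum_div, ← Finset.sum_add_distrib, ← Finset.sum_neg_distrib]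
      rw [this]
      exact Finset.sum_le_sum fun i _ => young1 lam _ _ hlam
    have h3 : (∑ i, (∑ m, u m * F m i) ^ 2) / (4 * lam) ≤ P * (f0 ^ 2 * P) / (4 * lam) := by gcongr
    have := hA1 q
    linarith
  -- T1
  have b1 : -(lam / 4 * (x ^ 2 * D2) + 4 * Lam ^ 2 / lam * (P * c2) + (P * c2 + x ^ 2 * (f0 ^ 2 * P))) ≤ 2 * x * T1 := by
    have h1 : T1 = ∑ m, u m * (∑ i, ∑ j, A i j * g m j * c i) + ∑ i, c i * ∑ m, u m * F m i := by
      have : ∑ i, c i * ∑ m, u m * F m i = ∑ m, ∑ i, c i * (u m * F m i) := by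
        simp only [Finset.mul_sum]; rw [Finset.sum_comm]
      rw [this, hT1, ← Finset.sum_add_distrib]
      refine Finset.sum_congr rfl fun m _ => ?_
      rw [Finset.mul_sum, ← Finset.sum_add_distrib]
      refine Finset.sum_congr rfl fun i _ => ?_
      rw [← Finset.sum_mul]; ring
    have h2 : -(lam / 4 * (x ^ 2 * D2) + 4 * Lam ^ 2 / lam * ((∑ m, u m ^ 2) * c2)) ≤
        2 * x * ∑ m, u m * (∑ i, ∑ j, A i j * g m j * c i) := by
      rw [hD2]
      simp only [Finset.mul_sum (s := (Finset.univ : Finset J)), Finset.sum_mul (s := (Finset.univ : Finset J)),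
        ← Finset.sum_add_distrib, ← Finset.sum_neg_distrib]
      refine Finset.sum_le_sum fun m _ => ?_
      have hh := hA2 (g m) c
      set S := ∑ i, ∑ j, A i j * g m j * c i with hS
      set gm := ∑ i, g m i ^ 2 with hgm
      have hg0 : 0 ≤ gm := Finset.sum_nonneg fun i _ => sq_nonneg _
      -- (2 x u S) ≥ -(lam/4 x²gm + 4/lam u² Λ² c2)
      have key : (2 * x * (u m * S)) ^ 2 ≤ (lam / 4 * (x ^ 2 * gm) + 4 * Lam ^ 2 / lam * (u m ^ 2 * c2)) ^ 2 := by
        have e1 : (2 * x * (u m * S)) ^ 2 ≤ 4 * (x ^ 2 * (u m ^ 2 * (Lam ^ 2 * gm * c2))) := by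
          have : (2 * x * (u m * S)) ^ 2 = 4 * (x ^ 2 * (u m ^ 2 * S ^ 2)) := by ring
          rw [this]; gcongr
        have e2 : 4 * (x ^ 2 * (u m ^ 2 * (Lam ^ 2 * gm * c2))) =
            4 * (lam / 4 * (x ^ 2 * gm)) * (4 * Lam ^ 2 / lam * (u m ^ 2 * c2)) := by
          field_simp
        rw [e2] at e1
        nlinarith [sq_nonneg (lam / 4 * (x ^ 2 * gm) - 4 * Lam ^ 2 / lam * (u m ^ 2 * c2))]
      have := (abs_le_of_sq_le_sq key (by positivity))
      exact (abs_le.mp this).1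
    have h3 : -(P * c2 + x ^ 2 * (f0 ^ 2 * P)) ≤ 2 * x * ∑ i, c i * ∑ m, u m * F m i := by
      have e1 : ∑ i, -(P * c i ^ 2 + x ^ 2 * (∑ m, u m * F m i) ^ 2 / P) ≤ 2 * x * ∑ i, c i * ∑ m, u m * F m i := by
        rw [Finset.mul_sum]
        refine Finset.sum_le_sum fun i _ => ?_
        have := young1 P (c i) (2 * x * ∑ m, u m * F m i) hP
        have e : (2 * x * ∑ m, u m * F m i) ^ 2 / (4 * P) = x ^ 2 * (∑ m, u m * F m i) ^ 2 / P := by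
          field_simp; ring
        rw [e] at this
        linarith
      have e2 : ∑ i, -(P * c i ^ 2 + x ^ 2 * (∑ m, u m * F m i) ^ 2 / P) =
          -(P * c2 + x ^ 2 * (∑ i, (∑ m, u m * F m i) ^ 2) / P) := by
        simp only [hc2, Finset.mul_sum (s := (Finset.univ : Finset ι)), Finset.sum_div, ← Finset.sum_add_distrib, ← Finset.sum_neg_distrib]
      have e3 : x ^ 2 * (∑ i, (∑ m, u m * F m i) ^ 2) / P ≤ x ^ 2 * (P * (f0 ^ 2 * P)) / P := by gcongr
      have e4 : x ^ 2 * (P * (f0 ^ 2 * P)) / P = x ^ 2 * (f0 ^ 2 * P) := by field_simp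
      linarith
    have h4 : 4 * Lam ^ 2 / lam * ((∑ m, u m ^ 2) * c2) ≤ 4 * Lam ^ 2 / lam * (P * c2) := by gcongr
    rw [h1, mul_add]
    linarith
  have b2' : - (r * x ^ 2 * (f0 ^ 2 * P) / (2 * lam)) ≤ x ^ 2 * (2 * r / P * T2) := by
    have : x ^ 2 * (2 * r / P * (- (P * (f0 ^ 2 * P) / (4 * lam)))) ≤ x ^ 2 * (2 * r / P * T2) := by gcongr
    refine le_trans (le_of_eq ?_) this
    field_simp; ring
  have b3' : x ^ 2 * (lam * D2 - (lam / 4 * D2 + f0 ^ 2 * P / lam)) ≤ x ^ 2 * T3 := by gcongr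
  have hx : 0 ≤ x ^ 2 * (f0 ^ 2 * P) := by positivity
  have hPc : 0 ≤ P * c2 := by positivity
  have hil : 0 < 1 / lam := by positivity
  have hL : 0 ≤ Lam ^ 2 / lam := by positivity
  set z := x ^ 2 * (f0 ^ 2 * P) with hz
  have fin : (4 * Lam ^ 2 / lam + 2 / lam + 1) * (1 + r) * P * (c2 + f0 ^ 2 * x ^ 2) ≥
      4 * Lam ^ 2 / lam * (P * c2) + (P * c2 + z) + r * z / (2 * lam) + z / lam := by
    have i1 : (4 * Lam ^ 2 / lam + 2 / lam + 1) * (1 + r) * P * (c2 + f0 ^ 2 * x ^ 2) =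
      (4 * (Lam ^ 2 / lam) + 2 * (1 / lam) + 1) * (1 + r) * (P * c2 + z) := by rw [hz]; ring
    rw [i1]
    have i2 : 4 * Lam ^ 2 / lam * (P * c2) + (P * c2 + z) + r * z / (2 * lam) + z / lam =
      4 * (Lam ^ 2 / lam) * (P * c2) + (P * c2 + z) + (1 / lam) * (r * z / 2) + (1 / lam) * z := by
      field_simp
    rw [i2]
    exact energy_scal _ _ _ _ _ hL hil.le hPc hx hr
  have hzz : r * x ^ 2 * (f0 ^ 2 * P) / (2 * lam) = r * z / (2 * lam) := by rw [hz]; ring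
  have hzz2 : x ^ 2 * (lam * D2 - (lam / 4 * D2 + f0 ^ 2 * P / lam)) = (3 / 4) * (lam * (x ^ 2 * D2)) - z / lam := by
    rw [hz]; ring
  rw [hzz] at b2'
  rw [hzz2] at b3'
  linarith

structure MData {E : Type*} [NormedAddCommGroup E] [NormedSpace ℝ E]
    [MeasurableSpace E] (μ : Measure E) {ι J : Type*} [Fintype ι] [Fintype J]
    (e : ι → E) (U : Set E) (u : J → E → ℝ) (A : E → ι → ι → ℝ) (F : J → E → ι → ℝ)
    (G : J → ι → E → ℝ) (lam Lam kap f0 : ℝ) : Prop where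
  hU : IsOpen U
  hlam : 0 < lam
  hkap : 0 < kap
  hf0 : 0 ≤ f0
  hd : ∀ m, ∀ X ∈ U, DifferentiableAt ℝ (u m) X
  hG2 : ∀ m i, MemLp (G m i) 2 μ
  hG1 : ∀ m i, Integrable (G m i) μ
  hGeq : ∀ m i, ∀ X ∈ U, G m i X = ∑ j, A X i j * fderiv ℝ (u m) X (e j) + F m X i
  hA1 : ∀ X ∈ U, ∀ ξ : ι → ℝ, lam * ∑ i, ξ i ^ 2 ≤ ∑ i, ∑ j, A X i j * ξ j * ξ i
  hA2 : ∀ X ∈ U, ∀ ξ η : ι → ℝ, (∑ i, ∑ j, A X i j * ξ j * η i) ^ 2 ≤ Lam ^ 2 * (∑ i, ξ i ^ 2) * ∑ i, η i ^ 2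
  hF : ∀ X ∈ U, ∑ m, ∑ i, F m X i ^ 2 ≤ f0 ^ 2 * (∑ m, u m X ^ 2 + kap ^ 2)
  hg : ∀ m i, MemLp (U.indicator fun X => fderiv ℝ (u m) X (e i)) 2 μ
  hw : ∀ m, ∀ ψ : E → ℝ, ContDiff ℝ (⊤ : ℕ∞) ψ → HasCompactSupport ψ → tsupport ψ ⊆ U →
      ∫ X, ∑ i, G m i X * fderiv ℝ ψ X (e i) ∂μ = 0

def Pf {E J : Type*} [Fintype J] (u : J → E → ℝ) (kap : ℝ) (X : E) : ℝ := ∑ m, u m X ^ 2 + kap ^ 2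

structure Cutoff {E : Type*} [NormedAddCommGroup E] [NormedSpace ℝ E] {ι : Type*}
    (e : ι → E) (U : Set E) (χ : E → ℝ) (f : ℝ) : Prop where
  smooth : ContDiff ℝ (⊤ : ℕ∞) χ
  cpt : HasCompactSupport χ
  sub : tsupport χ ⊆ U
  nonneg : ∀ X, 0 ≤ χ X
  le_one : ∀ X, χ X ≤ 1
  grad : ∀ X i, |fderiv ℝ χ X (e i)| ≤ f

section
variable {E : Type*} [NormedAddCommGroup E] [NormedSpace ℝ E]
    [FiniteDimensional ℝ E] [MeasurableSpace E] [BorelSpace E] {μ : Measure E}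
    [μ.IsAddHaarMeasure] {ι J : Type*} [Fintype ι] [Fintype J]
    {e : ι → E} {U : Set E} {u : J → E → ℝ} {A : E → ι → ι → ℝ} {F : J → E → ι → ℝ}
    {G : J → ι → E → ℝ} {lam Lam kap f0 : ℝ}

theorem Pf_pos {E J : Type*} [Fintype J] (u : J → E → ℝ) {kap : ℝ} (hk : 0 < kap) (X : E) : 0 < Pf u kap X := by
  unfold Pf
  have : 0 ≤ ∑ m, u m X ^ 2 := Finset.sum_nonneg fun m _ => sq_nonneg _
  positivity

theorem Pf_hasFDerivAt {E : Type*} [NormedAddCommGroup E] [NormedSpace ℝ E] {J : Type*} [Fintype J]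
    (u : J → E → ℝ) {kap : ℝ} (hk : 0 < kap) (X : E)
    (hd : ∀ m, DifferentiableAt ℝ (u m) X) (r : ℝ) :
    HasFDerivAt (fun Y => Pf u kap Y ^ r)
      ((r * Pf u kap X ^ (r - 1)) • ((2 : ℝ) • ∑ m, u m X • fderiv ℝ (u m) X)) X := by
  have h1 : HasFDerivAt (fun Y => Pf u kap Y) ((2 : ℝ) • ∑ m, u m X • fderiv ℝ (u m) X) X := by
    unfold Pf
    have := (HasFDerivAt.fun_sum (u := Finset.univ) (fun m _ => ((hd m).hasFDerivAt.pow 2))).add_const (kap ^ 2)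
    refine this.congr_fderiv ?_
    ext v
    simp [Finset.mul_sum]
    refine Finset.sum_congr rfl fun m _ => by ring
  exact h1.rpow_const (Or.inl (Pf_pos u hk X).ne')

theorem bdd_on_compact {E : Type*} [TopologicalSpace E] (K U : Set E) (hK : IsCompact K) (hKU : K ⊆ U) (h : E → ℝ)
    (hc : ContinuousOn h U) : ∃ C, 0 ≤ C ∧ ∀ X ∈ K, |h X| ≤ C := by
  obtain ⟨C, hC⟩ := hK.exists_bound_of_continuousOn (hc.mono hKU)
  exact ⟨max C 0, le_max_right _ _, fun X hX => (hC X hX).trans (le_max_left _ _)⟩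

/-- test function derivative formula -/
theorem test_deriv (D : MData μ e U u A F G lam Lam kap f0) (χ : E → ℝ) {f : ℝ}
    (hχ : Cutoff e U χ f) (r : ℝ) (m : J) (X : E) :
    HasFDerivAt (fun Y => χ Y ^ 2 * (Pf u kap Y ^ r * u m Y))
      ((2 * χ X * (Pf u kap X ^ r * u m X)) • fderiv ℝ χ X
        + (χ X ^ 2) • fderiv ℝ (fun Y => Pf u kap Y ^ r * u m Y) X) X := by
  apply cut_hasFDerivAt U χ _ (hχ.smooth.differentiable (by simp)) hχ.sub
  intro Y hY
  exact (Pf_hasFDerivAt u D.hkap Y (fun m => D.hd m Y hY) r).differentiableAt.mul (D.hd m Y hY)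

theorem test_deriv_apply (D : MData μ e U u A F G lam Lam kap f0) (χ : E → ℝ) {f : ℝ}
    (hχ : Cutoff e U χ f) (r : ℝ) (m : J) (X : E) (v : E) (hX : X ∈ U) :
    fderiv ℝ (fun Y => χ Y ^ 2 * (Pf u kap Y ^ r * u m Y)) X v =
      2 * χ X * (Pf u kap X ^ r * u m X) * fderiv ℝ χ X v +
       χ X ^ 2 * (u m X * (r * (Pf u kap X ^ r / Pf u kap X) * (2 * ∑ k, u k X * fderiv ℝ (u k) X v))
        + Pf u kap X ^ r * fderiv ℝ (u m) X v) := by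
  rw [(test_deriv D χ hχ r m X).fderiv]
  have h1 := (Pf_hasFDerivAt u D.hkap X (fun m => D.hd m X hX) r).mul (D.hd m X hX).hasFDerivAt
  have h2 : fderiv ℝ (fun Y => Pf u kap Y ^ r * u m Y) X = _ := h1.fderiv
  rw [h2, Real.rpow_sub_one (Pf_pos u D.hkap X).ne']
  simp
  ring

theorem fderiv_eq_zero_off {E : Type*} [NormedAddCommGroup E] [NormedSpace ℝ E] (χ h : E → ℝ) (X : E)
    (hX : X ∉ tsupport χ) : fderiv ℝ (fun Y => χ Y ^ 2 * h Y) X = 0 := by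
  have h0 : χ =ᶠ[nhds X] 0 := notMem_tsupport_iff_eventuallyEq.mp hX
  have : (fun Y => χ Y ^ 2 * h Y) =ᶠ[nhds X] fun _ => (0 : ℝ) := by
    filter_upwards [h0] with Y hY
    simp [hY]
  rw [this.fderiv_eq]; simp

theorem hasCompactSupport_cut {E : Type*} [TopologicalSpace E] (χ h : E → ℝ)
    (hc : HasCompactSupport χ) : HasCompactSupport (fun Y => χ Y ^ 2 * h Y) ∧
      tsupport (fun Y => χ Y ^ 2 * h Y) ⊆ tsupport χ := by
  have hs : tsupport (fun Y => χ Y ^ 2 * h Y) ⊆ tsupport χ := by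
    apply closure_mono
    intro Y hY
    simp only [Function.mem_support] at hY ⊢
    intro h0
    apply hY
    simp [h0]
  exact ⟨hc.of_isClosed_subset (isClosed_tsupport _) hs, hs⟩

theorem contOn_u (D : MData μ e U u A F G lam Lam kap f0) (m : J) : ContinuousOn (u m) U :=
  fun X hX => (D.hd m X hX).continuousAt.continuousWithinAt

theorem contOn_P (D : MData μ e U u A F G lam Lam kap f0) (r : ℝ) :
    ContinuousOn (fun X => Pf u kap X ^ r) U :=
  fun X hX => (Pf_hasFDerivAt u D.hkap X (fun m => D.hd m X hX) r).continuousAt.continuousWithinAt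

/-- majorant for derivatives -/
theorem memLp_dom (D : MData μ e U u A F G lam Lam kap f0) (K : Set E) (hK : IsCompact K) (hKU : K ⊆ U)
    (i : ι) (h : E → ℝ) (hm : AEStronglyMeasurable h μ) (C : ℝ)
    (hC : ∀ X ∈ K, |h X| ≤ C * (1 + ∑ k, |fderiv ℝ (u k) X (e i)|)) (h0 : ∀ X ∉ K, h X = 0) :
    MemLp h 2 μ ∧ Integrable h μ := by
  have hKm : MeasurableSet K := hK.measurableSet
  have h1 : MemLp (K.indicator fun _ => (1 : ℝ)) 2 μ := memLp_indicator_const 2 hKm 1 (Or.inr hK.measure_lt_top.ne)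
  have h2 : MemLp (fun X => C * (K.indicator (fun _ => (1 : ℝ)) X + ∑ k, |U.indicator (fun X => fderiv ℝ (u k) X (e i)) X|)) 2 μ := by
    apply MemLp.const_mul
    exact h1.add (memLp_finsetSum _ fun k _ => (D.hg k i).abs)
  have h3 : MemLp h 2 μ := by
    refine h2.mono hm (ae_of_all _ fun X => ?_)
    by_cases hX : X ∈ K
    · have := hC X hX
      simp only [Real.norm_eq_abs, indicator_of_mem hX, indicator_of_mem (hKU hX)]
      exact this.trans (le_abs_self _)
    · rw [h0 X hX, norm_zero]; exact norm_nonneg _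
  refine ⟨h3, ?_⟩
  have h4 : MemLp (K.indicator h) 2 μ := h3.indicator hKm
  have h5 : IntegrableOn h K μ := by
    have : IsFiniteMeasure (μ.restrict K) := ⟨by simpa using hK.measure_lt_top⟩
    exact ((h3.restrict K).integrable (by norm_num))
  refine h5.integrable_of_forall_notMem_eq_zero h0

theorem test_mem (D : MData μ e U u A F G lam Lam kap f0) (χ : E → ℝ) {f : ℝ}
    (hχ : Cutoff e U χ f) (r : ℝ) (m : J) (i : ι) :
    MemLp (fun X => fderiv ℝ (fun Y => χ Y ^ 2 * (Pf u kap Y ^ r * u m Y)) X (e i)) 2 μ ∧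
    Integrable (fun X => fderiv ℝ (fun Y => χ Y ^ 2 * (Pf u kap Y ^ r * u m Y)) X (e i)) μ := by
  have hχc := hχ.smooth.continuous
  have hdc : Continuous fun X => fderiv ℝ χ X (e i) :=
    (hχ.smooth.continuous_fderiv (by simp)).clm_apply continuous_const
  obtain ⟨C1, hC10, hC1⟩ := bdd_on_compact (tsupport χ) U hχ.cpt.isCompact hχ.sub
    (fun X => 2 * χ X * (Pf u kap X ^ r * u m X) * fderiv ℝ χ X (e i))
    ((((continuous_const.mul hχc).continuousOn).mul ((contOn_P D r).mul (contOn_u D m))).mul hdc.continuousOn)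
  have hb2 : ∀ k, ∃ C, 0 ≤ C ∧ ∀ X ∈ tsupport χ, |χ X ^ 2 * (u m X * (r * (Pf u kap X ^ r / Pf u kap X) * (2 * u k X)))| ≤ C := by
    intro k
    apply bdd_on_compact (tsupport χ) U hχ.cpt.isCompact hχ.sub
    have hP1 : ContinuousOn (fun X => Pf u kap X) U := by simpa using contOn_P D 1
    exact (hχc.pow 2).continuousOn.mul ((contOn_u D m).mul ((continuousOn_const.mul
      ((contOn_P D r).div hP1 (fun X _ => (Pf_pos u D.hkap X).ne'))).mul (continuousOn_const.mul (contOn_u D k))))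
  choose C2 hC20 hC2 using hb2
  obtain ⟨C3, hC30, hC3⟩ := bdd_on_compact (tsupport χ) U hχ.cpt.isCompact hχ.sub
    (fun X => χ X ^ 2 * (Pf u kap X ^ r)) ((hχc.pow 2).continuousOn.mul (contOn_P D r))
  apply memLp_dom D (tsupport χ) hχ.cpt.isCompact hχ.sub i _
    (measurable_fderiv_apply_const ℝ _ (e i)).aestronglyMeasurable (C1 + ∑ k, C2 k + C3)
  · intro X hX
    rw [test_deriv_apply D χ hχ r m X (e i) (hχ.sub hX)]
    have hs : χ X ^ 2 * (u m X * (r * (Pf u kap X ^ r / Pf u kap X) * (2 * ∑ k, u k X * fderiv ℝ (u k) X (e i)))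
        + Pf u kap X ^ r * fderiv ℝ (u m) X (e i)) =
        ∑ k, (χ X ^ 2 * (u m X * (r * (Pf u kap X ^ r / Pf u kap X) * (2 * u k X)))) * fderiv ℝ (u k) X (e i)
        + (χ X ^ 2 * (Pf u kap X ^ r)) * fderiv ℝ (u m) X (e i) := by
      rw [mul_add]
      congr 1
      · simp only [Finset.mul_sum]
        refine Finset.sum_congr rfl fun k _ => by ring
      · ring
    rw [hs]
    set S := ∑ k, |fderiv ℝ (u k) X (e i)| with hS
    have hS0 : 0 ≤ S := Finset.sum_nonneg fun k _ => abs_nonneg _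
    have hk : ∀ k, |fderiv ℝ (u k) X (e i)| ≤ S := fun k =>
      Finset.single_le_sum (f := fun k => |fderiv ℝ (u k) X (e i)|) (fun k _ => abs_nonneg _) (Finset.mem_univ k)
    have a1 := hC1 X hX
    have a2 : |∑ k, (χ X ^ 2 * (u m X * (r * (Pf u kap X ^ r / Pf u kap X) * (2 * u k X)))) * fderiv ℝ (u k) X (e i)| ≤ (∑ k, C2 k) * S := by
      refine (Finset.abs_sum_le_sum_abs _ _).trans ?_
      rw [Finset.sum_mul]
      refine Finset.sum_le_sum fun k _ => ?_
      rw [abs_mul]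
      exact mul_le_mul (hC2 k X hX) (hk k) (abs_nonneg _) (hC20 k)
    have a3 : |(χ X ^ 2 * (Pf u kap X ^ r)) * fderiv ℝ (u m) X (e i)| ≤ C3 * S := by
      rw [abs_mul]
      exact mul_le_mul (hC3 X hX) (hk m) (abs_nonneg _) hC30
    have hC2s : 0 ≤ ∑ k, C2 k := Finset.sum_nonneg fun k _ => hC20 k
    refine (abs_add_le _ _).trans ((add_le_add a1 ((abs_add_le _ _).trans (add_le_add a2 a3))).trans ?_)
    nlinarith [mul_nonneg hC10 hS0]
  · intro X hX
    rw [fderiv_eq_zero_off χ _ X hX]; simp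

theorem energy_est (D : MData μ e U u A F G lam Lam kap f0) (χ : E → ℝ) {f : ℝ}
    (hχ : Cutoff e U χ f) (hf : f0 ≤ f) (r : ℝ) (hr : 0 ≤ r) :
    Integrable (fun X => χ X ^ 2 * Pf u kap X ^ r * ∑ m, ∑ i, fderiv ℝ (u m) X (e i) ^ 2) μ ∧
    ∫ X, χ X ^ 2 * Pf u kap X ^ r * ∑ m, ∑ i, fderiv ℝ (u m) X (e i) ^ 2 ∂μ ≤
      (2 / lam * ((4 * Lam ^ 2 / lam + 2 / lam + 1) * (Fintype.card ι + 1))) * (1 + r) * f ^ 2 *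
        ∫ X in tsupport χ, Pf u kap X ^ (r + 1) ∂μ := by
  have hχc := hχ.smooth.continuous
  have hlam := D.hlam
  have hKm : MeasurableSet (tsupport χ) := hχ.cpt.isCompact.measurableSet
  set K0 := (4 * Lam ^ 2 / lam + 2 / lam + 1) with hK0
  have hK00 : 0 ≤ K0 := by positivity
  -- integrability of main term
  have hintg : Integrable (fun X => χ X ^ 2 * Pf u kap X ^ r * ∑ m, ∑ i, fderiv ℝ (u m) X (e i) ^ 2) μ := by
    obtain ⟨C3, hC30, hC3⟩ := bdd_on_compact (tsupport χ) U hχ.cpt.isCompact hχ.sub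
      (fun X => χ X ^ 2 * (Pf u kap X ^ r)) ((hχc.pow 2).continuousOn.mul (contOn_P D r))
    have h1 : Integrable (fun X => ∑ m, ∑ i, (U.indicator (fun X => fderiv ℝ (u m) X (e i)) X) ^ 2) μ :=
      integrable_finsetSum _ fun m _ => integrable_finsetSum _ fun i _ => (D.hg m i).integrable_sq
    have hψm : AEStronglyMeasurable (fun X => χ X ^ 2 * Pf u kap X ^ r) μ := by
      have : (fun X => χ X ^ 2 * Pf u kap X ^ r) = fun X => ((tsupport χ).indicator (fun X => χ X ^ 2 * Pf u kap X ^ r)) X := by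
        ext X
        by_cases hX : X ∈ tsupport χ
        · simp [hX]
        · simp [hX, image_eq_zero_of_notMem_tsupport hX]
      rw [this, aestronglyMeasurable_indicator_iff hKm]
      exact (((hχc.pow 2).continuousOn.mul (contOn_P D r)).mono hχ.sub).aestronglyMeasurable hKm
    have h2 := h1.bdd_mul (c := C3) hψm (ae_of_all _ fun X => by
      by_cases hX : X ∈ tsupport χ
      · exact hC3 X hX
      · simp [image_eq_zero_of_notMem_tsupport hX, hC30])
    refine h2.congr (ae_of_all _ fun X => ?_)
    by_cases hX : X ∈ tsupport χ
    · simp [hχ.sub hX]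
    · simp [image_eq_zero_of_notMem_tsupport hX]
  refine ⟨hintg, ?_⟩
  have hPint : IntegrableOn (fun X => Pf u kap X ^ (r + 1)) (tsupport χ) μ :=
    ((contOn_P D (r + 1)).mono hχ.sub).integrableOn_compact hχ.cpt.isCompact
  set T : E → ℝ := fun X => ∑ m, ∑ i, G m i X * fderiv ℝ (fun Y => χ Y ^ 2 * (Pf u kap Y ^ r * u m Y)) X (e i) with hT
  have hTi : ∀ m, Integrable (fun X => ∑ i, G m i X * fderiv ℝ (fun Y => χ Y ^ 2 * (Pf u kap Y ^ r * u m Y)) X (e i)) μ :=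
    fun m => integrable_finsetSum _ fun i _ => (D.hG2 m i).integrable_mul (test_mem D χ hχ r m i).1
  have hTint : Integrable T μ := integrable_finsetSum _ fun m _ => hTi m
  have hT0 : ∫ X, T X ∂μ = 0 := by
    rw [hT, integral_finsetSum _ fun m _ => hTi m]
    apply Finset.sum_eq_zero
    intro m _
    obtain ⟨hc, hs⟩ := hasCompactSupport_cut χ (fun Y => Pf u kap Y ^ r * u m Y) hχ.cpt
    exact extend_test μ e U D.hU (G m) (D.hG2 m) (D.hG1 m) (D.hw m) _
      (fun X => (test_deriv D χ hχ r m X).differentiableAt) hc (hs.trans hχ.sub)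
      (fun i => (test_mem D χ hχ r m i).1) (fun i => (test_mem D χ hχ r m i).2)
  set R : E → ℝ := (tsupport χ).indicator fun X => K0 * (Fintype.card ι + 1) * (1 + r) * f ^ 2 * Pf u kap X ^ (r + 1) with hR
  have hRint : Integrable R μ := by
    rw [hR, integrable_indicator_iff hKm]
    exact hPint.const_mul _
  have hpt : ∀ X, lam / 2 * (χ X ^ 2 * Pf u kap X ^ r * ∑ m, ∑ i, fderiv ℝ (u m) X (e i) ^ 2) - R X ≤ T X := by
    intro X
    by_cases hX : X ∈ tsupport χ
    · have hXU := hχ.sub hX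
      have hP := Pf_pos u D.hkap X
      have := energy_pointwise lam Lam hlam (A X) (D.hA1 X hXU) (D.hA2 X hXU) (fun m => u m X)
        (fun m i => fderiv ℝ (u m) X (e i)) (fun m i => F m X i) (fun i => fderiv ℝ χ X (e i)) (χ X)
        (Pf u kap X) f0 r (Pf u kap X ^ r) hP hr (Real.rpow_nonneg hP.le r)
        (by unfold Pf; nlinarith [sq_nonneg kap]) (D.hF X hXU)
      simp only [hT, D.hGeq _ _ X hXU, test_deriv_apply D χ hχ r _ X _ hXU]
      refine le_trans ?_ this
      rw [hR, indicator_of_mem hX]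
      have hsum : ∑ i, fderiv ℝ χ X (e i) ^ 2 + f0 ^ 2 * χ X ^ 2 ≤ (Fintype.card ι + 1) * f ^ 2 := by
        have h1 : ∑ i, fderiv ℝ χ X (e i) ^ 2 ≤ ∑ _i : ι, f ^ 2 :=
          Finset.sum_le_sum fun i _ => sq_le_sq' (abs_le.mp (hχ.grad X i)).1 (abs_le.mp (hχ.grad X i)).2
        simp only [Finset.sum_const, Finset.card_univ, nsmul_eq_mul] at h1
        have h2 : f0 ^ 2 * χ X ^ 2 ≤ f ^ 2 * 1 := by
          apply mul_le_mul (pow_le_pow_left₀ D.hf0 hf 2) _ (sq_nonneg _) (sq_nonneg _)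
          exact pow_le_one₀ (hχ.nonneg X) (hχ.le_one X)
        linarith
      have hPP : Pf u kap X ^ (r + 1) = Pf u kap X ^ r * Pf u kap X := Real.rpow_add_one hP.ne' r
      have hPr := Real.rpow_nonneg hP.le r
      have hb : K0 * (1 + r) * Pf u kap X * (∑ i, fderiv ℝ χ X (e i) ^ 2 + f0 ^ 2 * χ X ^ 2) ≤
          K0 * (1 + r) * Pf u kap X * ((Fintype.card ι + 1) * f ^ 2) := by gcongr
      have hb2 := mul_le_mul_of_nonneg_left hb hPr
      rw [hPP]
      nlinarith
    · rw [hR, indicator_of_notMem hX]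
      have : T X = 0 := by
        rw [hT]
        simp only
        refine Finset.sum_eq_zero fun m _ => Finset.sum_eq_zero fun i _ => ?_
        rw [fderiv_eq_zero_off χ _ X hX]; simp
      rw [this, image_eq_zero_of_notMem_tsupport hX]; simp
  have hfin := integral_mono ((hintg.const_mul (lam / 2)).sub hRint) hTint hpt
  rw [hT0] at hfin
  simp only [Pi.sub_apply] at hfin
  rw [integral_sub (hintg.const_mul (lam / 2)) hRint, integral_const_mul, hR, integral_indicator hKm, integral_const_mul] at hfin
  set I := ∫ X, χ X ^ 2 * Pf u kap X ^ r * ∑ m, ∑ i, fderiv ℝ (u m) X (e i) ^ 2 ∂μ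
  set Q := ∫ X in tsupport χ, Pf u kap X ^ (r + 1) ∂μ
  have : I ≤ 2 / lam * (K0 * (Fintype.card ι + 1) * (1 + r) * f ^ 2 * Q) := by
    rw [div_mul_eq_mul_div, le_div_iff₀ hlam]; linarith
  linarith
end

theorem moser_rec (a : ℕ → ℝ) (ha : ∀ j, 0 ≤ a j) (θ : ℝ) (hθ : 1 < θ) (b δ : ℝ)
    (h : ∀ j : ℕ, a (j + 1) ≤ (Real.exp (b + j * δ) * a j) ^ θ) (j : ℕ) :
    a j ≤ (Real.exp (θ / (θ - 1) * (b + (θ / (θ - 1) - 1) * δ)) * a 0) ^ (θ ^ j) *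
      Real.exp (-(θ / (θ - 1) * (b + (θ / (θ - 1) - 1) * δ) + j * (θ / (θ - 1)) * δ)) := by
  set σ := θ / (θ - 1) with hσ
  set b' := σ * (b + (σ - 1) * δ) with hb'
  have hσθ : θ * (1 - σ) = -σ := by
    rw [hσ]
    have : θ - 1 ≠ 0 := by linarith
    field_simp; ring
  induction j with
  | zero =>
    simp only [pow_zero, Real.rpow_one, Nat.cast_zero, zero_mul, add_zero]
    rw [mul_right_comm, ← Real.exp_add]; simp
  | succ j ih =>
    set y := (Real.exp b' * a 0) ^ (θ ^ j) with hy
    have hy0 : 0 ≤ Real.exp b' * a 0 := mul_nonneg (Real.exp_pos _).le (ha 0)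
    have hy1 : 0 ≤ y := Real.rpow_nonneg hy0 _
    calc a (j + 1) ≤ (Real.exp (b + j * δ) * a j) ^ θ := h j
      _ ≤ (Real.exp (b + j * δ) * (y * Real.exp (-(b' + j * σ * δ)))) ^ θ := by
          apply Real.rpow_le_rpow (mul_nonneg (Real.exp_pos _).le (ha j)) _ (by linarith)
          gcongr
      _ = (y * Real.exp ((b + j * δ) - (b' + j * σ * δ))) ^ θ := by
          congr 1
          rw [sub_eq_add_neg, Real.exp_add (b + j * δ)]; ring
      _ = y ^ θ * Real.exp (((b + j * δ) - (b' + j * σ * δ)) * θ) := by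
          rw [Real.mul_rpow hy1 (Real.exp_pos _).le, ← Real.exp_mul]
      _ = _ := by
          rw [hy, ← Real.rpow_mul hy0, ← pow_succ]
          congr 2
          rw [hb']
          push_cast
          linear_combination (b + σ * δ + j * δ) * hσθ

theorem ofReal_int_le {E : Type*} [MeasurableSpace E] (μ : Measure E) (h : E → ℝ) (h0 : ∀ X, 0 ≤ h X) :
    ENNReal.ofReal (∫ X, h X ∂μ) ≤ ∫⁻ X, ENNReal.ofReal (h X) ∂μ := by
  by_cases hi : Integrable h μ
  · exact (ofReal_integral_eq_lintegral_ofReal hi (ae_of_all _ h0)).le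
  · rw [integral_undef hi]; simp

section
variable {E : Type*} [NormedAddCommGroup E] [NormedSpace ℝ E]
    [FiniteDimensional ℝ E] [MeasurableSpace E] [BorelSpace E] {μ : Measure E}
    [μ.IsAddHaarMeasure] {ι J : Type*} [Fintype ι] [Fintype J]
    {e : ι → E} {U : Set E} {u : J → E → ℝ} {A : E → ι → ι → ℝ} {F : J → E → ι → ℝ}
    {G : J → ι → E → ℝ} {lam Lam kap f0 : ℝ}

def Ken (ι : Type*) [Fintype ι] (lam Lam : ℝ) : ℝ :=
  (2 / lam * ((4 * Lam ^ 2 / lam + 2 / lam + 1) * (Fintype.card ι + 1)))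

theorem grad_w_est (D : MData μ e U u A F G lam Lam kap f0) (χ : E → ℝ) {f : ℝ}
    (hχ : Cutoff e U χ f) (hf : f0 ≤ f) (hf1 : 0 < f) (r : ℝ) (hr : 0 ≤ r) :
    Differentiable ℝ (fun X => χ X ^ 2 * Pf u kap X ^ (r + 1)) ∧
    ∀ i, Integrable (fun X => fderiv ℝ (fun X => χ X ^ 2 * Pf u kap X ^ (r + 1)) X (e i)) μ ∧
    ∫ X, ‖fderiv ℝ (fun X => χ X ^ 2 * Pf u kap X ^ (r + 1)) X (e i)‖ ∂μ ≤
      (Ken ι lam Lam + 3) * ((1 + r) ^ 2 * f * ∫ X in tsupport χ, Pf u kap X ^ (r + 1) ∂μ) := by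
  have hKm : MeasurableSet (tsupport χ) := hχ.cpt.isCompact.measurableSet
  have hlam := D.hlam
  have hK0 : 0 ≤ Ken ι lam Lam := by unfold Ken; positivity
  obtain ⟨hI, hle⟩ := energy_est D χ hχ hf r hr
  have hder : ∀ X, HasFDerivAt (fun Y => χ Y ^ 2 * Pf u kap Y ^ (r + 1))
      ((2 * χ X * Pf u kap X ^ (r + 1)) • fderiv ℝ χ X
        + (χ X ^ 2) • fderiv ℝ (fun Y => Pf u kap Y ^ (r + 1)) X) X :=
    cut_hasFDerivAt U χ _ (hχ.smooth.differentiable (by simp)) hχ.sub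
      fun Y hY => (Pf_hasFDerivAt u D.hkap Y (fun m => D.hd m Y hY) (r + 1)).differentiableAt
  refine ⟨fun X => (hder X).differentiableAt, fun i => ?_⟩
  have hPint : IntegrableOn (fun X => Pf u kap X ^ (r + 1)) (tsupport χ) μ :=
    ((contOn_P D (r + 1)).mono hχ.sub).integrableOn_compact hχ.cpt.isCompact
  set S : E → ℝ := fun X => χ X ^ 2 * Pf u kap X ^ r * ∑ m, ∑ i, fderiv ℝ (u m) X (e i) ^ 2 with hS
  set R : E → ℝ := (tsupport χ).indicator fun X => (2 * f + (r + 1) * f) * Pf u kap X ^ (r + 1) with hR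
  have hRint : Integrable R μ := by
    rw [hR, integrable_indicator_iff hKm]
    exact hPint.const_mul _
  have hpt : ∀ X, ‖fderiv ℝ (fun X => χ X ^ 2 * Pf u kap X ^ (r + 1)) X (e i)‖ ≤ (r + 1) / f * S X + R X := by
    intro X
    by_cases hX : X ∈ tsupport χ
    · have hXU := hχ.sub hX
      have hP := Pf_pos u D.hkap X
      rw [(hder X).fderiv, (Pf_hasFDerivAt u D.hkap X (fun m => D.hd m X hXU) (r + 1)).fderiv, hR,
        indicator_of_mem hX, hS]
      simp only [add_sub_cancel_right, add_apply, smul_apply, sum_apply, smul_eq_mul, Real.norm_eq_abs]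
      set P := Pf u kap X with hPd
      have hPP : P ^ (r + 1) = P ^ r * P := Real.rpow_add_one hP.ne' r
      have hPr := Real.rpow_nonneg hP.le r
      set D2 := ∑ m, ∑ i, fderiv ℝ (u m) X (e i) ^ 2 with hD2
      have hq : |2 * ∑ m, u m X * fderiv ℝ (u m) X (e i)| ≤ D2 / f + f * P := by
        rw [Finset.mul_sum]
        refine (Finset.abs_sum_le_sum_abs _ _).trans ?_
        have h1 : ∀ m, |2 * (u m X * fderiv ℝ (u m) X (e i))| ≤ (∑ i, fderiv ℝ (u m) X (e i) ^ 2) / f + f * u m X ^ 2 := by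
          intro m
          have h2 : fderiv ℝ (u m) X (e i) ^ 2 ≤ ∑ i, fderiv ℝ (u m) X (e i) ^ 2 :=
            Finset.single_le_sum (f := fun i => fderiv ℝ (u m) X (e i) ^ 2) (fun i _ => sq_nonneg _) (Finset.mem_univ i)
          have h3 : |2 * (u m X * fderiv ℝ (u m) X (e i))| ≤ fderiv ℝ (u m) X (e i) ^ 2 / f + f * u m X ^ 2 := by
            have y1 := young1 f (u m X) (2 * fderiv ℝ (u m) X (e i)) hf1
            have y2 := young1 f (u m X) (-2 * fderiv ℝ (u m) X (e i)) hf1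
            have e1 : (2 * fderiv ℝ (u m) X (e i)) ^ 2 / (4 * f) = fderiv ℝ (u m) X (e i) ^ 2 / f := by field_simp; ring
            have e2 : (-2 * fderiv ℝ (u m) X (e i)) ^ 2 / (4 * f) = fderiv ℝ (u m) X (e i) ^ 2 / f := by field_simp; ring
            rw [e1] at y1; rw [e2] at y2
            rw [abs_le]; constructor <;> nlinarith
          refine h3.trans ?_
          gcongr
        refine (Finset.sum_le_sum fun m _ => h1 m).trans ?_
        rw [Finset.sum_add_distrib, ← Finset.sum_div, ← Finset.mul_sum]
        gcongr
        rw [hPd]; unfold Pf; nlinarith [sq_nonneg kap]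
      have hx0 := hχ.nonneg X
      have hx1 := hχ.le_one X
      have hx2 : χ X ^ 2 ≤ 1 := pow_le_one₀ hx0 hx1
      have t1 : |2 * χ X * P ^ (r + 1) * fderiv ℝ χ X (e i)| ≤ 2 * f * P ^ (r + 1) := by
        rw [abs_mul, abs_of_nonneg (by positivity)]
        have := hχ.grad X i
        calc 2 * χ X * P ^ (r + 1) * |fderiv ℝ χ X (e i)| ≤ 2 * 1 * P ^ (r + 1) * f := by gcongr
          _ = _ := by ring
      have t2 : |χ X ^ 2 * ((r + 1) * P ^ r * (2 * ∑ m, u m X * fderiv ℝ (u m) X (e i)))| ≤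
          (r + 1) / f * (χ X ^ 2 * P ^ r * D2) + (r + 1) * f * P ^ (r + 1) := by
        rw [abs_mul, abs_mul, abs_of_nonneg (sq_nonneg (χ X)), abs_of_nonneg (by positivity : 0 ≤ (r + 1) * P ^ r)]
        calc χ X ^ 2 * ((r + 1) * P ^ r * |2 * ∑ m, u m X * fderiv ℝ (u m) X (e i)|)
            ≤ χ X ^ 2 * ((r + 1) * P ^ r * (D2 / f + f * P)) := by gcongr
          _ = (r + 1) / f * (χ X ^ 2 * P ^ r * D2) + χ X ^ 2 * ((r + 1) * f * P ^ (r + 1)) := by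
              rw [hPP]; field_simp
          _ ≤ (r + 1) / f * (χ X ^ 2 * P ^ r * D2) + 1 * ((r + 1) * f * P ^ (r + 1)) := by gcongr
          _ = _ := by ring
      refine (abs_add_le _ _).trans ((add_le_add t1 t2).trans (le_of_eq ?_))
      ring
    · rw [fderiv_eq_zero_off χ _ X hX, hR, indicator_of_notMem hX, hS]
      simp [image_eq_zero_of_notMem_tsupport hX]
  have hmaj : Integrable (fun X => (r + 1) / f * S X + R X) μ := (hI.const_mul _).add hRint
  have hintg : Integrable (fun X => fderiv ℝ (fun X => χ X ^ 2 * Pf u kap X ^ (r + 1)) X (e i)) μ :=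
    hmaj.mono' (measurable_fderiv_apply_const ℝ _ (e i)).aestronglyMeasurable (ae_of_all _ hpt)
  refine ⟨hintg, ?_⟩
  have hmono := integral_mono hintg.norm hmaj hpt
  refine hmono.trans ?_
  rw [integral_add (hI.const_mul _) hRint, integral_const_mul, hR, integral_indicator hKm, integral_const_mul]
  set Q := ∫ X in tsupport χ, Pf u kap X ^ (r + 1) ∂μ with hQ
  have hQ0 : 0 ≤ Q := setIntegral_nonneg hKm fun X _ => Real.rpow_nonneg (Pf_pos u D.hkap X).le _
  have hle' : ∫ X, S X ∂μ ≤ Ken ι lam Lam * (1 + r) * f ^ 2 * Q := hle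
  have : (r + 1) / f * ∫ X, S X ∂μ ≤ (r + 1) / f * (Ken ι lam Lam * (1 + r) * f ^ 2 * Q) := by gcongr
  have e1 : (r + 1) / f * (Ken ι lam Lam * (1 + r) * f ^ 2 * Q) = Ken ι lam Lam * ((1 + r) ^ 2 * f * Q) := by
    field_simp; ring
  have e2 : (2 * f + (r + 1) * f) * Q ≤ 3 * ((1 + r) ^ 2 * f * Q) := by
    have : 0 ≤ f * Q := by positivity
    have h1 : 3 * ((1 + r) ^ 2 * f * Q) - (2 * f + (r + 1) * f) * Q = (5 * r + 3 * r ^ 2) * (f * Q) := by ring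
    have h2 : 0 ≤ (5 * r + 3 * r ^ 2) * (f * Q) := by positivity
    linarith
  linarith

theorem moser_step (e : ι → E) (he : ∀ L : E →L[ℝ] ℝ, ‖L‖ ≤ ∑ i, |L (e i)|) (θ : ℝ)
    (hp : Real.HolderConjugate (Module.finrank ℝ E) θ) (lam Lam : ℝ) (hlam : 0 < lam) :
    ∃ C : ℝ, 0 < C ∧ ∀ (U : Set E) (u : J → E → ℝ) (A : E → ι → ι → ℝ) (F : J → E → ι → ℝ)
      (G : J → ι → E → ℝ) (kap f0 : ℝ), MData μ e U u A F G lam Lam kap f0 →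
      ∀ (χ : E → ℝ) (f : ℝ), Cutoff e U χ f → f0 ≤ f → 0 < f → ∀ r : ℝ, 0 ≤ r →
      ∀ S K : Set E, MeasurableSet S → IsCompact K → K ⊆ U → tsupport χ ⊆ K → (∀ X ∈ S, χ X = 1) →
      ∫ X in S, Pf u kap X ^ ((r + 1) * θ) ∂μ ≤
        (C * ((1 + r) ^ 2 * f * ∫ X in K, Pf u kap X ^ (r + 1) ∂μ)) ^ θ := by
  obtain ⟨C1, hC1⟩ := sobolev_diff μ e he θ hp
  have hθ : 1 < θ := hp.symm.lt
  have hθ0 : 0 < θ := by linarith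
  set c2 : ℝ := (C1 : ℝ) ^ (1 / θ) * (Fintype.card ι * (Ken ι lam Lam + 3)) with hc2
  have hK0 : 0 ≤ Ken ι lam Lam := by unfold Ken; positivity
  have hc20 : 0 ≤ c2 := by positivity
  refine ⟨c2 + 1, by positivity, ?_⟩
  intro U u A F G kap f0 D χ f hχ hf hf1 r hr S K hS hK hKU hsK h1
  obtain ⟨hdiff, hgr⟩ := grad_w_est D χ hχ hf hf1 r hr
  set w : E → ℝ := fun X => χ X ^ 2 * Pf u kap X ^ (r + 1) with hw
  have hP := fun X => Pf_pos u D.hkap X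
  have hw0 : ∀ X, 0 ≤ w X := fun X => mul_nonneg (sq_nonneg _) (Real.rpow_nonneg (hP X).le _)
  have hsob := hC1 w hdiff (hasCompactSupport_cut χ _ hχ.cpt).1 fun i => (hgr i).1
  set Q' := ∫ X in tsupport χ, Pf u kap X ^ (r + 1) ∂μ with hQ'
  set Q := ∫ X in K, Pf u kap X ^ (r + 1) ∂μ with hQ
  have hQ'0 : 0 ≤ Q' := setIntegral_nonneg hχ.cpt.isCompact.measurableSet fun X _ => Real.rpow_nonneg (hP X).le _
  have hQQ : Q' ≤ Q := by
    apply setIntegral_mono_set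
    · exact ((contOn_P D (r + 1)).mono hKU).integrableOn_compact hK
    · exact ae_of_all _ fun X => Real.rpow_nonneg (hP X).le _
    · exact hsK.eventuallyLE
  set Z := (1 + r) ^ 2 * f * Q with hZ
  have hQ0 : 0 ≤ Q := hQ'0.trans hQQ
  have hZ0 : 0 ≤ Z := by positivity
  have hsum : ∑ i, ∫⁻ X, ‖fderiv ℝ w X (e i)‖ₑ ∂μ ≤ ENNReal.ofReal (Fintype.card ι * (Ken ι lam Lam + 3) * Z) := by
    calc ∑ i, ∫⁻ X, ‖fderiv ℝ w X (e i)‖ₑ ∂μ ≤ ∑ _i : ι, ENNReal.ofReal ((Ken ι lam Lam + 3) * Z) := by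
          refine Finset.sum_le_sum fun i _ => ?_
          rw [← ofReal_integral_norm_eq_lintegral_enorm (hgr i).1]
          apply ENNReal.ofReal_le_ofReal
          refine (hgr i).2.trans ?_
          have : (1 + r) ^ 2 * f * Q' ≤ Z := by rw [hZ]; gcongr
          gcongr
      _ = _ := by
          rw [Finset.sum_const, Finset.card_univ, nsmul_eq_mul, mul_assoc, ENNReal.ofReal_mul (p := (Fintype.card ι : ℝ)) (by positivity)]
          simp
  have hlow : ENNReal.ofReal (∫ X in S, Pf u kap X ^ ((r + 1) * θ) ∂μ) ≤ ∫⁻ X, ‖w X‖ₑ ^ θ ∂μ := by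
    refine (ofReal_int_le (μ.restrict S) _ fun X => Real.rpow_nonneg (hP X).le _).trans ?_
    refine le_trans ?_ (setLIntegral_le_lintegral S _)
    refine setLIntegral_mono' hS fun X hX => ?_
    have : w X = Pf u kap X ^ (r + 1) := by rw [hw]; simp [h1 X hX]
    rw [Real.enorm_of_nonneg (hw0 X), ENNReal.ofReal_rpow_of_nonneg (hw0 X) hθ0.le, this, ← Real.rpow_mul (hP X).le]
  have hall : ENNReal.ofReal (∫ X in S, Pf u kap X ^ ((r + 1) * θ) ∂μ) ≤
      ENNReal.ofReal (((c2 + 1) * Z) ^ θ) := by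
    refine hlow.trans (hsob.trans ?_)
    calc (C1 : ℝ≥0∞) * (∑ i, ∫⁻ X, ‖fderiv ℝ w X (e i)‖ₑ ∂μ) ^ θ
        ≤ C1 * (ENNReal.ofReal (Fintype.card ι * (Ken ι lam Lam + 3) * Z)) ^ θ := by gcongr
      _ = ENNReal.ofReal ((c2 * Z) ^ θ) := by
          rw [ENNReal.ofReal_rpow_of_nonneg (by positivity) hθ0.le, ← ENNReal.ofReal_coe_nnreal,
            ← ENNReal.ofReal_mul (by positivity)]
          congr 1
          rw [hc2, mul_assoc ((C1 : ℝ) ^ (1 / θ)), Real.mul_rpow (x := (C1 : ℝ) ^ (1 / θ)) (by positivity) (by positivity), ← Real.rpow_mul (by positivity)]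
          rw [one_div_mul_cancel hθ0.ne', Real.rpow_one]
      _ ≤ _ := by
          apply ENNReal.ofReal_le_ofReal
          apply Real.rpow_le_rpow (by positivity) _ hθ0.le
          gcongr; linarith
  exact (ENNReal.ofReal_le_ofReal_iff (by positivity)).mp hall

end

section
variable {E : Type*} [NormedAddCommGroup E] [NormedSpace ℝ E]
    [FiniteDimensional ℝ E] [MeasurableSpace E] [BorelSpace E] {μ : Measure E}
    [μ.IsAddHaarMeasure] {ι J : Type*} [Fintype ι] [Fintype J]

theorem moser (e : ι → E) (he : ∀ L : E →L[ℝ] ℝ, ‖L‖ ≤ ∑ i, |L (e i)|) (θ : ℝ)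
    (hp : Real.HolderConjugate (Module.finrank ℝ E) θ) (hθ2 : θ ≤ 2) (lam Lam : ℝ) (hlam : 0 < lam)
    (C0 : ℝ) (hC0 : 0 ≤ C0)
    (hcut : ∀ (X : E) (ρ R : ℝ), 0 < ρ → ρ < R → ∃ χ : E → ℝ, Cutoff e univ χ (C0 / (R - ρ)) ∧
      (∀ Y ∈ Metric.closedBall X ρ, χ Y = 1) ∧ tsupport χ ⊆ Metric.closedBall X R)
    (Cf : ℝ) (hCf : 0 ≤ Cf) :
    ∃ C : ℝ, 0 < C ∧ ∀ (U : Set E) (u : J → E → ℝ) (A : E → ι → ι → ℝ) (F : J → E → ι → ℝ)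
      (G : J → ι → E → ℝ) (kap f0 : ℝ), MData μ e U u A F G lam Lam kap f0 →
      ∀ (X : E) (R : ℝ), 0 < R → Metric.closedBall X R ⊆ U → f0 ≤ Cf / R →
      Pf u kap X ≤ C / R ^ (Module.finrank ℝ E) * ∫ Y in Metric.closedBall X R, Pf u kap Y ∂μ := by
  obtain ⟨C1, hC1, hstep⟩ := moser_step (μ := μ) (J := J) e he θ hp lam Lam hlam
  have hθ : 1 < θ := hp.symm.lt
  set σ := θ / (θ - 1) with hσ
  have hσn : σ = Module.finrank ℝ E := hp.symm.conjugate_eq.symm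
  set C2 := C1 * (4 * (C0 + Cf + 1)) with hC2
  have hC20 : 0 < C2 := by positivity
  set δ := Real.log 16 with hδ
  have hδ0 : 0 < δ := Real.log_pos (by norm_num)
  refine ⟨Real.exp (σ * (Real.log C2 + (σ - 1) * δ)), Real.exp_pos _, ?_⟩
  intro U u A F G kap f0 D X R hR hXU hf0
  set ρ : ℕ → ℝ := fun j => R / 2 * (1 + (1 / 2) ^ j) with hρ
  have hρ0 : ∀ j, R / 2 < ρ j := fun j => by
    have : (0 : ℝ) < (1 / 2) ^ j := by positivity
    simp only [hρ]; nlinarith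
  have hρR : ∀ j, ρ j ≤ R := fun j => by
    have : ((1 : ℝ) / 2) ^ j ≤ 1 := pow_le_one₀ (by norm_num) (by norm_num)
    simp only [hρ]; nlinarith
  have hρd : ∀ j, ρ j - ρ (j + 1) = R / (4 * 2 ^ j) := fun j => by
    simp only [hρ, pow_succ, one_div, inv_pow]; field_simp; ring
  have hsubU : ∀ j, Metric.closedBall X (ρ j) ⊆ U := fun j => (Metric.closedBall_subset_closedBall (hρR j)).trans hXU
  have hP := fun Y => Pf_pos u D.hkap Y
  set a : ℕ → ℝ := fun j => ∫ Y in Metric.closedBall X (ρ j), Pf u kap Y ^ (θ ^ j) ∂μ with ha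
  have ha0 : ∀ j, 0 ≤ a j := fun j => setIntegral_nonneg measurableSet_closedBall fun Y _ => Real.rpow_nonneg (hP Y).le _
  have hrec : ∀ j : ℕ, a (j + 1) ≤ (Real.exp ((Real.log C2 - Real.log R) + j * δ) * a j) ^ θ := by
    intro j
    have hlt : ρ (j + 1) < ρ j := by
      have := hρd j
      have : 0 < R / (4 * 2 ^ j) := by positivity
      linarith
    obtain ⟨χ, hχ, hχ1, hχs⟩ := hcut X (ρ (j + 1)) (ρ j) (by linarith [hρ0 (j + 1)]) hlt
    rw [hρd] at hχ
    set f := 4 * (C0 + Cf + 1) * 2 ^ j / R with hf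
    have hfpos : 0 < f := by positivity
    have hχ' : Cutoff e U χ f := ⟨hχ.smooth, hχ.cpt, hχs.trans (hsubU j), hχ.nonneg, hχ.le_one, fun Y i => by
      refine (hχ.grad Y i).trans ?_
      have : C0 / (R / (4 * 2 ^ j)) = 4 * C0 * 2 ^ j / R := by field_simp
      rw [this, hf]
      gcongr; linarith⟩
    have hff : f0 ≤ f := by
      refine hf0.trans ?_
      rw [hf]
      gcongr
      have : (1 : ℝ) ≤ 2 ^ j := one_le_pow₀ (by norm_num)
      nlinarith
    have hr : 0 ≤ θ ^ j - 1 := by linarith [one_le_pow₀ hθ.le (n := j)]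
    have := hstep U u A F G kap f0 D χ f hχ' hff hfpos (θ ^ j - 1) hr (Metric.closedBall X (ρ (j + 1)))
      (Metric.closedBall X (ρ j)) measurableSet_closedBall (isCompact_closedBall _ _) (hsubU j) hχs hχ1
    simp only [sub_add_cancel, add_sub_cancel] at this
    have hpow : θ ^ j * θ = θ ^ (j + 1) := (pow_succ _ _).symm
    rw [hpow] at this
    refine this.trans ?_
    have haj : ∫ Y in Metric.closedBall X (ρ j), Pf u kap Y ^ (θ ^ j) ∂μ = a j := rfl
    rw [haj]
    have haj0 := ha0 j
    apply Real.rpow_le_rpow (by positivity) _ (by linarith)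
    have hexp : Real.exp ((Real.log C2 - Real.log R) + j * δ) = C2 / R * 16 ^ j := by
      rw [Real.exp_add, Real.exp_sub, Real.exp_log hC20, Real.exp_log hR, mul_comm (j : ℝ), hδ, Real.exp_mul,
        Real.exp_log (by norm_num), Real.rpow_natCast]
    rw [hexp]
    have h4 : (θ ^ j) ^ 2 * 2 ^ j ≤ 16 ^ j := by
      calc (θ ^ j) ^ 2 * 2 ^ j ≤ (2 ^ j) ^ 2 * 2 ^ j := by gcongr
        _ = 8 ^ j := by rw [← pow_mul, mul_comm j 2, pow_mul, ← mul_pow]; norm_num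
        _ ≤ 16 ^ j := by gcongr; norm_num
    calc C1 * ((θ ^ j) ^ 2 * f * a j) = C2 / R * ((θ ^ j) ^ 2 * 2 ^ j) * a j := by rw [hf, hC2]; ring
      _ ≤ _ := by gcongr
  have hsol := moser_rec a ha0 θ hθ _ δ hrec
  rw [← hσ] at hsol
  set b' := σ * (Real.log C2 - Real.log R + (σ - 1) * δ) with hb'
  have ha00 : a 0 = ∫ Y in Metric.closedBall X R, Pf u kap Y ∂μ := by
    simp only [ha, hρ, pow_zero, Real.rpow_one]
    rw [show R / 2 * (1 + 1) = R by ring]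
  have hb'e : Real.exp b' = Real.exp (σ * (Real.log C2 + (σ - 1) * δ)) / R ^ (Module.finrank ℝ E) := by
    rw [hb', show σ * (Real.log C2 - Real.log R + (σ - 1) * δ) = σ * (Real.log C2 + (σ - 1) * δ) - Real.log R * σ by ring,
      Real.exp_sub, Real.exp_mul (Real.log R), Real.exp_log hR, hσn, Real.rpow_natCast]
  rw [← hb'e, ← ha00]
  by_contra hcon
  push Not at hcon
  set L := Real.exp b' * a 0 with hL
  have hL0 : 0 ≤ L := mul_nonneg (Real.exp_pos _).le (ha0 0)
  have hXin : X ∈ U := hXU (Metric.mem_closedBall_self hR.le)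
  have hPc : ContinuousAt (fun Y => Pf u kap Y) X := by
    have := (contOn_P D 1).continuousAt (D.hU.mem_nhds hXin)
    simpa using this
  obtain ⟨s, hs, hsL⟩ := Metric.eventually_nhds_iff_ball.mp (hPc.eventually_const_lt hcon)
  set s' := min s (R / 2) with hs'
  have hs'0 : 0 < s' := lt_min hs (by linarith)
  set V := μ.real (Metric.ball X s') with hV
  have hV0 : 0 < V := by
    rw [hV, Measure.real, ENNReal.toReal_pos_iff]
    exact ⟨Metric.measure_ball_pos μ X hs'0, measure_ball_lt_top⟩
  have hintg : ∀ j, IntegrableOn (fun Y => Pf u kap Y ^ (θ ^ j)) (Metric.closedBall X (ρ j)) μ := fun j =>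
    ((contOn_P D _).mono (hsubU j)).integrableOn_compact (isCompact_closedBall _ _)
  have hsub : ∀ j, Metric.ball X s' ⊆ Metric.closedBall X (ρ j) := fun j =>
    Metric.ball_subset_closedBall.trans (Metric.closedBall_subset_closedBall ((min_le_right _ _).trans (hρ0 j).le))
  have hlow : ∀ j, V * L ^ (θ ^ j) ≤ a j := by
    intro j
    have h1 : ∫ Y in Metric.ball X s', L ^ (θ ^ j) ∂μ ≤ ∫ Y in Metric.ball X s', Pf u kap Y ^ (θ ^ j) ∂μ := by
      apply setIntegral_mono_on
      · exact integrableOn_const measure_ball_lt_top.ne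
      · exact (hintg j).mono_set (hsub j)
      · exact measurableSet_ball
      · intro Y hY
        exact Real.rpow_le_rpow hL0 (hsL Y (Metric.ball_subset_ball (min_le_left _ _) hY)).le (by positivity)
    rw [setIntegral_const, smul_eq_mul] at h1
    refine h1.trans ?_
    exact setIntegral_mono_set (hintg j) (ae_of_all _ fun Y => Real.rpow_nonneg (hP Y).le _) (hsub j).eventuallyLE
  have ha0pos : 0 < a 0 := by
    have hm : ContinuousOn (fun Y => Pf u kap Y) (Metric.closedBall X R) := by
      have := (contOn_P D 1).mono hXU
      simpa using this
    rw [ha00]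
    have h1 : ∫ Y in Metric.closedBall X R, kap ^ 2 ∂μ ≤ ∫ Y in Metric.closedBall X R, Pf u kap Y ∂μ := by
      apply setIntegral_mono_on
      · exact integrableOn_const measure_closedBall_lt_top.ne
      · exact hm.integrableOn_compact (isCompact_closedBall _ _)
      · exact measurableSet_closedBall
      · intro Y _
        unfold Pf
        have : 0 ≤ ∑ m, u m Y ^ 2 := Finset.sum_nonneg fun m _ => sq_nonneg _
        linarith
    rw [setIntegral_const, smul_eq_mul] at h1
    refine lt_of_lt_of_le ?_ h1
    have hk := D.hkap
    have : 0 < μ.real (Metric.closedBall X R) := by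
      rw [Measure.real, ENNReal.toReal_pos_iff]
      exact ⟨Metric.measure_closedBall_pos μ X hR, measure_closedBall_lt_top⟩
    positivity
  have hLpos : 0 < L := mul_pos (Real.exp_pos _) ha0pos
  have hfin : ∀ j : ℕ, V ≤ Real.exp (-(b' + j * σ * δ)) := by
    intro j
    have := (hlow j).trans (hsol j)
    have hLj : 0 < L ^ (θ ^ j) := Real.rpow_pos_of_pos hLpos _
    rw [mul_comm] at this
    exact le_of_mul_le_mul_left this hLj
  have hσ0 : 0 < σ := by rw [hσ]; apply div_pos <;> linarith
  obtain ⟨j, hj⟩ := exists_nat_gt ((-b' - Real.log V) / (σ * δ))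
  have h1 := hfin j
  rw [← Real.log_le_iff_le_exp hV0] at h1
  rw [div_lt_iff₀ (by positivity)] at hj
  nlinarith
end

theorem ST_deriv_zero {x : ℝ} (h : x ≤ 0 ∨ 1 ≤ x) : deriv Real.smoothTransition x = 0 := by
  rcases h with h | h
  · apply IsLocalMin.deriv_eq_zero
    refine Eventually.of_forall fun y => ?_
    rw [Real.smoothTransition.zero_of_nonpos h]; exact Real.smoothTransition.nonneg y
  · apply IsLocalMax.deriv_eq_zero
    refine Eventually.of_forall fun y => ?_
    rw [Real.smoothTransition.one_of_one_le h]; exact Real.smoothTransition.le_one y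

theorem ST_hasDeriv (x : ℝ) : HasDerivAt Real.smoothTransition (deriv Real.smoothTransition x) x :=
  ((Real.smoothTransition.contDiff (n := 1)).differentiable (by norm_num) x).hasDerivAt

theorem ST_cont_deriv : Continuous (deriv Real.smoothTransition) :=
  (Real.smoothTransition.contDiff (n := 1)).continuous_deriv (by norm_num)

theorem ST_bound : ∃ C0 : ℝ, 0 < C0 ∧ ∀ x, |deriv Real.smoothTransition x| ≤ C0 := by
  obtain ⟨C, hC⟩ := (isCompact_Icc (a := (0:ℝ)) (b := 1)).exists_bound_of_continuousOn
    (f := deriv Real.smoothTransition) ST_cont_deriv.continuousOn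
  refine ⟨max C 1, by positivity, fun x => ?_⟩
  by_cases h : x ∈ Icc (0:ℝ) 1
  · exact (hC x h).trans (le_max_left _ _)
  · rw [ST_deriv_zero, abs_zero]
    · positivity
    · rw [mem_Icc, not_and_or] at h
      rcases h with h | h
      · left; linarith
      · right; linarith

theorem ST_nonneg_deriv (x : ℝ) : 0 ≤ deriv Real.smoothTransition x :=
  Real.smoothTransition.monotone.deriv_nonneg

/-- radial cutoff -/
def rcut {F : Type*} [NormedAddCommGroup F] [InnerProductSpace ℝ F] (p : F) (ρ R : ℝ) (y : F) : ℝ :=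
  Real.smoothTransition ((R ^ 2 - ‖y - p‖ ^ 2) / (R ^ 2 - ρ ^ 2))

section
variable {F : Type*} [NormedAddCommGroup F] [InnerProductSpace ℝ F]

theorem rcut_smooth (p : F) (ρ R : ℝ) : ContDiff ℝ (⊤ : ℕ∞) (rcut p ρ R) := by
  unfold rcut
  refine Real.smoothTransition.contDiff.comp ?_
  exact ((contDiff_const.sub ((contDiff_id.sub contDiff_const).norm_sq ℝ)).div_const _)

theorem rcut_nonneg (p : F) (ρ R : ℝ) (y : F) : 0 ≤ rcut p ρ R y := Real.smoothTransition.nonneg _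
theorem rcut_le_one (p : F) (ρ R : ℝ) (y : F) : rcut p ρ R y ≤ 1 := Real.smoothTransition.le_one _

theorem rcut_one (p : F) {ρ R : ℝ} (hρ : 0 < ρ) (hR : ρ < R) (y : F) (hy : y ∈ Metric.closedBall p ρ) :
    rcut p ρ R y = 1 := by
  apply Real.smoothTransition.one_of_one_le
  rw [mem_closedBall_iff_norm] at hy
  rw [le_div_iff₀ (by nlinarith)]
  nlinarith [norm_nonneg (y - p)]

theorem rcut_zero (p : F) {ρ R : ℝ} (hρ : 0 < ρ) (hR : ρ < R) (y : F) (hy : R ≤ ‖y - p‖) :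
    rcut p ρ R y = 0 := by
  apply Real.smoothTransition.zero_of_nonpos
  apply div_nonpos_of_nonpos_of_nonneg <;> nlinarith [norm_nonneg (y - p)]

theorem rcut_tsupport (p : F) {ρ R : ℝ} (hρ : 0 < ρ) (hR : ρ < R) :
    tsupport (rcut p ρ R) ⊆ Metric.closedBall p R := by
  refine closure_minimal ?_ Metric.isClosed_closedBall
  intro y hy
  rw [mem_closedBall_iff_norm]
  by_contra h
  exact hy (rcut_zero p hρ hR y (by linarith))

theorem rcut_grad {C0 : ℝ} (hC : ∀ x, |deriv Real.smoothTransition x| ≤ C0) (p : F) {ρ R : ℝ} (hρ : 0 < ρ) (hR : ρ < R)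
    (y v : F) : |fderiv ℝ (rcut p ρ R) y v| ≤ 2 * C0 / (R - ρ) * ‖v‖ := by
  have hC0 : 0 ≤ C0 := (abs_nonneg _).trans (hC 0)
  have h1 : HasFDerivAt (fun y : F => (R ^ 2 - ‖y - p‖ ^ 2) / (R ^ 2 - ρ ^ 2))
      ((R ^ 2 - ρ ^ 2)⁻¹ • (-((2 : ℝ) • (innerSL ℝ (y - p) : F →L[ℝ] ℝ)))) y := by
    have := (((((hasFDerivAt_id y).sub_const p).norm_sq).const_sub (R ^ 2)).mul_const (R ^ 2 - ρ ^ 2)⁻¹)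
    simp only [div_eq_mul_inv]
    refine this.congr_fderiv ?_
    ext v; simp
  have h2 := (ST_hasDeriv ((R ^ 2 - ‖y - p‖ ^ 2) / (R ^ 2 - ρ ^ 2))).comp_hasFDerivAt y h1
  have h3 : fderiv ℝ (rcut p ρ R) y = _ := h2.fderiv
  rw [h3]
  by_cases hy : R ≤ ‖y - p‖
  · rw [ST_deriv_zero]
    · simp only [zero_smul, _root_.zero_apply, abs_zero]
      have : 0 < R - ρ := by linarith
      positivity
    · left
      apply div_nonpos_of_nonpos_of_nonneg <;> nlinarith [norm_nonneg (y - p)]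
  · push Not at hy
    have hpos : 0 < R ^ 2 - ρ ^ 2 := by nlinarith
    have hv : |inner ℝ (y - p) v| ≤ R * ‖v‖ := (abs_real_inner_le_norm _ _).trans (by gcongr)
    simp only [_root_.smul_apply, _root_.neg_apply, smul_eq_mul,
      ContinuousLinearMap.comp_id, innerSL_apply_apply, nsmul_eq_mul, abs_mul, abs_neg, abs_inv, abs_of_pos hpos]
    have hR' : 0 < R - ρ := by linarith
    calc _ ≤ C0 * ((R ^ 2 - ρ ^ 2)⁻¹ * (2 * (R * ‖v‖))) := by
          gcongr
          · exact hC _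
          · simp
      _ = 2 * C0 * (R / (R ^ 2 - ρ ^ 2)) * ‖v‖ := by ring
      _ ≤ 2 * C0 * (1 / (R - ρ)) * ‖v‖ := by
          have : R / (R ^ 2 - ρ ^ 2) ≤ 1 / (R - ρ) := by
            rw [div_le_div_iff₀ hpos hR']; nlinarith
          gcongr ?_ * ?_ * ?_
      _ = _ := by ring
end

/-! basis -/
def ev (n : ℕ) : Option (Fin (n - 1)) → Pt n
  | none => (0, 1)
  | some i => (EuclideanSpace.single i 1, 0)

theorem ev_norm (n : ℕ) (i) : ‖(ev n i).1‖ ≤ 1 ∧ ‖(ev n i).2‖ ≤ 1 := by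
  cases i <;> simp [ev]

theorem ev_expand {n : ℕ} (X : Pt n) : X = ∑ i, X.1 i • ev n (some i) + X.2 • ev n none := by
  have h : X.1 = ∑ i, X.1 i • EuclideanSpace.single i (1:ℝ) := by
    ext j
    simp [Finset.sum_apply, Pi.single_apply]
  apply Prod.ext
  · simp only [ev, Prod.fst_add, Prod.fst_sum, Prod.smul_mk]
    simpa using h
  · simp [ev, Prod.snd_sum]

theorem ev_he {n : ℕ} (L : Pt n →L[ℝ] ℝ) : ‖L‖ ≤ ∑ i, |L (ev n i)| := by
  refine L.opNorm_le_bound (Finset.sum_nonneg fun i _ => abs_nonneg _) fun X => ?_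
  conv_lhs => rw [ev_expand X]
  rw [map_add, map_sum, Fintype.sum_option, map_smul, add_comm (|L (ev n none)|), add_mul, Finset.sum_mul]
  refine (norm_add_le _ _).trans (add_le_add ((norm_sum_le _ _).trans (Finset.sum_le_sum fun i _ => ?_)) ?_)
  · rw [map_smul, smul_eq_mul, norm_mul, mul_comm, Real.norm_eq_abs]
    gcongr
    exact (PiLp.norm_apply_le X.1 i).trans (norm_fst_le X)
  · rw [smul_eq_mul, norm_mul, mul_comm, Real.norm_eq_abs]
    gcongr
    exact norm_snd_le X

theorem gradSq_eq {n : ℕ} (hn : 2 ≤ n) (u : Pt n → ℝ) (X : Pt n) :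
    gradSq u X = ∑ i, fderiv ℝ u X (ev n i) ^ 2 := by
  obtain ⟨k, rfl⟩ : ∃ k, n = k + 1 := ⟨n - 1, by omega⟩
  unfold gradSq pd
  rw [Fin.sum_univ_castSucc, Fintype.sum_option, add_comm]
  congr 1
  · simp [bvec, ev]
  · refine Finset.sum_congr rfl fun i _ => ?_
    have : (i : ℕ) < k + 1 - 1 := i.2
    simp [bvec, ev, this]

theorem finrank_Pt {n : ℕ} (hn : 2 ≤ n) : Module.finrank ℝ (Pt n) = n := by
  simp; omega

/-- product cutoff -/
theorem prod_cut {C0 : ℝ} (hC : ∀ x, |deriv Real.smoothTransition x| ≤ C0) (n : ℕ) (X : Pt n) (ρ R : ℝ) (hρ : 0 < ρ) (hR : ρ < R) :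
    ∃ χ : Pt n → ℝ, Cutoff (ev n) univ χ (4 * C0 / (R - ρ)) ∧
      (∀ Y ∈ Metric.closedBall X ρ, χ Y = 1) ∧ tsupport χ ⊆ Metric.closedBall X R := by
  have hC0 : 0 ≤ C0 := (abs_nonneg _).trans (hC 0)
  have hs1 : ContDiff ℝ (⊤ : ℕ∞) (fun Y : Pt n => rcut X.1 ρ R Y.1) := (rcut_smooth X.1 ρ R).comp contDiff_fst
  have hs2 : ContDiff ℝ (⊤ : ℕ∞) (fun Y : Pt n => rcut X.2 ρ R Y.2) := (rcut_smooth X.2 ρ R).comp contDiff_snd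
  have hts : tsupport (fun Y : Pt n => rcut X.1 ρ R Y.1 * rcut X.2 ρ R Y.2) ⊆ Metric.closedBall X R := by
    refine closure_minimal ?_ Metric.isClosed_closedBall
    intro Y hY
    rw [Function.mem_support] at hY
    rw [mem_closedBall_iff_norm]
    by_contra h
    push Not at h
    rw [Prod.norm_def, lt_max_iff] at h
    rcases h with h | h
    · exact hY (by rw [rcut_zero X.1 hρ hR _ h.le, zero_mul])
    · exact hY (by rw [rcut_zero X.2 hρ hR _ h.le, mul_zero])
  refine ⟨fun Y => rcut X.1 ρ R Y.1 * rcut X.2 ρ R Y.2, ⟨hs1.mul hs2, ?_, subset_univ _, ?_, ?_, ?_⟩, ?_, hts⟩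
  · exact (isCompact_closedBall X R).of_isClosed_subset (isClosed_tsupport _) hts
  · intro Y; exact mul_nonneg (rcut_nonneg _ _ _ _) (rcut_nonneg _ _ _ _)
  · intro Y; exact mul_le_one₀ (rcut_le_one _ _ _ _) (rcut_nonneg _ _ _ _) (rcut_le_one _ _ _ _)
  · intro Y i
    have d1 : HasFDerivAt (fun Y : Pt n => rcut X.1 ρ R Y.1) ((fderiv ℝ (rcut X.1 ρ R) Y.1).comp (ContinuousLinearMap.fst ℝ _ _)) Y :=
      (((rcut_smooth X.1 ρ R).differentiable (by simp)) Y.1).hasFDerivAt.comp Y hasFDerivAt_fst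
    have d2 : HasFDerivAt (fun Y : Pt n => rcut X.2 ρ R Y.2) ((fderiv ℝ (rcut X.2 ρ R) Y.2).comp (ContinuousLinearMap.snd ℝ _ _)) Y :=
      (((rcut_smooth X.2 ρ R).differentiable (by simp)) Y.2).hasFDerivAt.comp Y hasFDerivAt_snd
    rw [HasFDerivAt.fderiv (f := fun Y : Pt n => rcut X.1 ρ R Y.1 * rcut X.2 ρ R Y.2) (d1.mul d2)]
    simp only [_root_.add_apply, _root_.smul_apply, ContinuousLinearMap.comp_apply,
      ContinuousLinearMap.coe_fst', ContinuousLinearMap.coe_snd', smul_eq_mul]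
    have b1 := rcut_grad hC X.1 hρ hR Y.1 (ev n i).1
    have b2 := rcut_grad hC X.2 hρ hR Y.2 (ev n i).2
    have hR' : 0 < R - ρ := by linarith
    have e1 : 2 * C0 / (R - ρ) * ‖(ev n i).1‖ ≤ 2 * C0 / (R - ρ) * 1 := by gcongr; exact (ev_norm n i).1
    have e2 : 2 * C0 / (R - ρ) * ‖(ev n i).2‖ ≤ 2 * C0 / (R - ρ) * 1 := by gcongr; exact (ev_norm n i).2
    have h0 : 0 ≤ 2 * C0 / (R - ρ) := by positivity
    refine (abs_add_le _ _).trans ?_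
    rw [abs_mul, abs_mul, abs_of_nonneg (rcut_nonneg _ _ _ _), abs_of_nonneg (rcut_nonneg _ _ _ _)]
    have f1 := mul_le_mul (rcut_le_one X.1 ρ R Y.1) (b2.trans e2) (abs_nonneg _) zero_le_one
    have f2 := mul_le_mul (rcut_le_one X.2 ρ R Y.2) (b1.trans e1) (abs_nonneg _) zero_le_one
    calc _ ≤ _ := add_le_add f1 f2
      _ = _ := by ring
  · intro Y hY
    rw [mem_closedBall_iff_norm, Prod.norm_def] at hY
    show rcut X.1 ρ R Y.1 * rcut X.2 ρ R Y.2 = 1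
    rw [rcut_one X.1 hρ hR, rcut_one X.2 hρ hR, one_mul]
    · rw [mem_closedBall_iff_norm]; exact (le_max_right _ _).trans hY
    · rw [mem_closedBall_iff_norm]; exact (le_max_left _ _).trans hY

section
variable {E : Type*} [NormedAddCommGroup E] [NormedSpace ℝ E]
    [FiniteDimensional ℝ E] [MeasurableSpace E] [BorelSpace E] {μ : Measure E}
    [μ.IsAddHaarMeasure]

theorem line_est (u : E → ℝ) (Y Z : E) (D : ℝ) (hD : ‖Y - Z‖ ≤ D)
    (hd : ∀ τ ∈ Icc (0:ℝ) 1, DifferentiableAt ℝ u (Z + τ • (Y - Z))) :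
    ENNReal.ofReal ((u Y - u Z) ^ 2) ≤
      ∫⁻ τ in Icc (0:ℝ) 1, ENNReal.ofReal ((D * ‖fderiv ℝ u (Z + τ • (Y - Z))‖) ^ 2) := by
  set g : ℝ → ℝ := fun τ => fderiv ℝ u (Z + τ • (Y - Z)) (Y - Z) with hg
  have hcl : Continuous fun τ : ℝ => Z + τ • (Y - Z) := by fun_prop
  have hgm : Measurable g := (measurable_fderiv_apply_const ℝ u (Y - Z)).comp hcl.measurable
  have hD0 : 0 ≤ D := (norm_nonneg _).trans hD
  have hle : ∫⁻ τ in Icc (0:ℝ) 1, ENNReal.ofReal (g τ ^ 2) ≤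
      ∫⁻ τ in Icc (0:ℝ) 1, ENNReal.ofReal ((D * ‖fderiv ℝ u (Z + τ • (Y - Z))‖) ^ 2) := by
    refine lintegral_mono fun τ => ENNReal.ofReal_le_ofReal ?_
    have : |g τ| ≤ D * ‖fderiv ℝ u (Z + τ • (Y - Z))‖ := by
      rw [mul_comm]; exact ((fderiv ℝ u (Z + τ • (Y - Z))).le_opNorm (Y - Z)).trans (by gcongr)
    exact sq_le_sq' (abs_le.1 this).1 (abs_le.1 this).2
  refine le_trans ?_ hle
  by_cases htop : ∫⁻ τ in Icc (0:ℝ) 1, ENNReal.ofReal (g τ ^ 2) = ⊤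
  · rw [htop]; exact le_top
  have hi2 : IntegrableOn (fun τ => g τ ^ 2) (Icc (0:ℝ) 1) := by
    refine ⟨(hgm.pow_const 2).aestronglyMeasurable, ?_⟩
    rw [hasFiniteIntegral_iff_ofReal (Eventually.of_forall fun τ => sq_nonneg _)]
    exact lt_top_iff_ne_top.2 htop
  have hi1 : IntegrableOn g (Icc (0:ℝ) 1) := by
    have := (memLp_two_iff_integrable_sq (μ := volume.restrict (Icc (0:ℝ) 1)) hgm.aestronglyMeasurable).2 hi2
    exact this.integrable (by norm_num)
  have hder : ∀ τ ∈ uIcc (0:ℝ) 1, HasDerivAt (fun τ : ℝ => u (Z + τ • (Y - Z))) (g τ) τ := by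
    intro τ hτ
    rw [uIcc_of_le zero_le_one] at hτ
    have h1 : HasDerivAt (fun τ : ℝ => Z + τ • (Y - Z)) (Y - Z) τ := by
      simpa using ((hasDerivAt_id τ).smul_const (Y - Z)).const_add Z
    exact (hd τ hτ).hasFDerivAt.comp_hasDerivAt τ h1
  have hFTC := intervalIntegral.integral_eq_sub_of_hasDerivAt hder
    (by rw [intervalIntegrable_iff_integrableOn_Ioc_of_le zero_le_one]; exact hi1.mono_set Ioc_subset_Icc_self)
  simp only [one_smul, zero_smul, add_zero, add_sub_cancel] at hFTC
  rw [intervalIntegral.integral_of_le zero_le_one, ← integral_Icc_eq_integral_Ioc] at hFTC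
  rw [← hFTC, ← ofReal_integral_eq_lintegral_ofReal hi2 (Eventually.of_forall fun τ => sq_nonneg _)]
  apply ENNReal.ofReal_le_ofReal
  set c := ∫ τ in Icc (0:ℝ) 1, g τ with hc
  have h0 : 0 ≤ ∫ τ in Icc (0:ℝ) 1, (g τ ^ 2 - 2 * c * g τ + c ^ 2) :=
    integral_nonneg fun τ => by have := sq_nonneg (g τ - c); simp only [Pi.zero_apply]; nlinarith
  have hi3 : IntegrableOn (fun τ => g τ ^ 2 - 2 * c * g τ) (Icc (0:ℝ) 1) := hi2.sub (hi1.const_mul _)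
  rw [integral_add hi3 (integrable_const _), integral_sub hi2 (hi1.const_mul _),
    integral_const_mul] at h0
  simp only [integral_const, measureReal_restrict_apply_univ, Real.volume_real_Icc, smul_eq_mul] at h0
  norm_num at h0
  rw [← hc] at h0
  nlinarith

theorem lint_affine (h : E → ℝ≥0∞) (hh : Measurable h) (c : E) (r : ℝ) (hr : 1 / 2 ≤ r) :
    ∫⁻ Y, h (r • Y + c) ∂μ ≤ ENNReal.ofReal (2 ^ Module.finrank ℝ E) * ∫⁻ Y, h Y ∂μ := by
  have h1 : ∫⁻ Y, h (r • Y + c) ∂μ = ∫⁻ Y, h (Y + c) ∂(Measure.map (r • ·) μ) := by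
    rw [lintegral_map (f := fun Y => h (Y + c)) (hh.comp (measurable_add_const c)) (measurable_const_smul r)]
  rw [h1, Measure.map_addHaar_smul μ (by linarith : r ≠ 0), lintegral_smul_measure, smul_eq_mul,
    lintegral_add_right_eq_self (fun Y => h Y) c]
  gcongr
  rw [abs_of_pos (by positivity), ← inv_pow]
  gcongr
  rw [inv_le_comm₀ (by linarith) (by norm_num)]; linarith

theorem poincare (u : E → ℝ) (K : Set E) (hK : Convex ℝ K) (hKm : MeasurableSet K) (hKf : μ K ≠ ⊤) (D : ℝ)
    (hD : ∀ Y ∈ K, ∀ Z ∈ K, ‖Y - Z‖ ≤ D) (hd : ∀ Y ∈ K, DifferentiableAt ℝ u Y) :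
    ∫⁻ Y in K, ∫⁻ Z in K, ENNReal.ofReal ((u Y - u Z) ^ 2) ∂μ ∂μ ≤
      ENNReal.ofReal (2 ^ Module.finrank ℝ E) * μ K *
        ∫⁻ X in K, ENNReal.ofReal ((D * ‖fderiv ℝ u X‖) ^ 2) ∂μ := by
  haveI : IsFiniteMeasure (μ.restrict K) := ⟨by rw [Measure.restrict_apply_univ]; exact lt_top_iff_ne_top.2 hKf⟩
  set h : E → ℝ≥0∞ := fun X => ENNReal.ofReal ((D * ‖fderiv ℝ u X‖) ^ 2) with hh
  have hm : Measurable h := by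
    have := (measurable_fderiv ℝ u).norm
    exact ((this.const_mul D).pow_const 2).ennreal_ofReal
  have hseg : ∀ Y ∈ K, ∀ Z ∈ K, ∀ τ ∈ Icc (0:ℝ) 1, Z + τ • (Y - Z) ∈ K := fun Y hY Z hZ τ hτ =>
    hK.add_smul_sub_mem hZ hY hτ
  set k := K.indicator h with hk
  have hkm : Measurable k := hm.indicator hKm
  have hkint : ∫⁻ X, k X ∂μ = ∫⁻ X in K, h X ∂μ := lintegral_indicator hKm _
  have mY : Measurable fun q : (E × E) × ℝ => k (q.1.2 + q.2 • (q.1.1 - q.1.2)) :=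
    hkm.comp (by fun_prop)
  have mY2 : Measurable fun q : ℝ × E × E => k (q.2.2 + q.1 • (q.2.1 - q.2.2)) :=
    hkm.comp (by fun_prop)
  calc ∫⁻ Y in K, ∫⁻ Z in K, ENNReal.ofReal ((u Y - u Z) ^ 2) ∂μ ∂μ
      ≤ ∫⁻ Y in K, ∫⁻ Z in K, (∫⁻ τ in Icc (0:ℝ) 1, k (Z + τ • (Y - Z))) ∂μ ∂μ := by
        refine setLIntegral_mono' hKm fun Y hY => setLIntegral_mono' hKm fun Z hZ => ?_
        refine (line_est u Y Z D (hD Y hY Z hZ) fun τ hτ => hd _ (hseg Y hY Z hZ τ hτ)).trans ?_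
        refine setLIntegral_mono' measurableSet_Icc fun τ hτ => ?_
        rw [hk, indicator_of_mem (hseg Y hY Z hZ τ hτ)]
    _ = ∫⁻ q in K ×ˢ K, (∫⁻ τ in Icc (0:ℝ) 1, k (q.2 + τ • (q.1 - q.2))) ∂(μ.prod μ) := by
        rw [← Measure.prod_restrict, lintegral_prod]
        exact (Measurable.lintegral_prod_right' mY).aemeasurable
    _ = ∫⁻ τ in Icc (0:ℝ) 1, ∫⁻ q in K ×ˢ K, k (q.2 + τ • (q.1 - q.2)) ∂(μ.prod μ) := by
        rw [← Measure.prod_restrict, lintegral_lintegral_swap]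
        exact mY.aemeasurable
    _ ≤ ∫⁻ τ in Icc (0:ℝ) 1, ENNReal.ofReal (2 ^ Module.finrank ℝ E) * μ K * ∫⁻ X, k X ∂μ := by
        refine setLIntegral_mono' measurableSet_Icc fun τ hτ => ?_
        have mq : Measurable fun q : E × E => k (q.2 + τ • (q.1 - q.2)) := hkm.comp (by fun_prop)
        rw [← Measure.prod_restrict]
        have key : ∀ c : E, ∀ r : ℝ, 1 / 2 ≤ r → ∫⁻ Y in K, k (r • Y + c) ∂μ ≤ ENNReal.ofReal (2 ^ Module.finrank ℝ E) * ∫⁻ Y, k Y ∂μ :=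
          fun c r hr => (setLIntegral_le_lintegral _ _).trans (lint_affine k hkm c r hr)
        rcases le_total (1 / 2) τ with hτ2 | hτ2
        · rw [lintegral_prod_symm _ mq.aemeasurable]
          calc _ ≤ ∫⁻ Z in K, ENNReal.ofReal (2 ^ Module.finrank ℝ E) * ∫⁻ Y, k Y ∂μ ∂μ := by
                refine lintegral_mono fun Z => ?_
                refine le_trans (le_of_eq ?_) (key (Z - τ • Z) τ hτ2)
                refine lintegral_congr fun Y => ?_
                congr 1; simp only [smul_sub]; abel
            _ = _ := by rw [setLIntegral_const]; ring
        · rw [lintegral_prod _ mq.aemeasurable]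
          calc _ ≤ ∫⁻ Z in K, ENNReal.ofReal (2 ^ Module.finrank ℝ E) * ∫⁻ Y, k Y ∂μ ∂μ := by
                refine lintegral_mono fun Y => ?_
                refine le_trans (le_of_eq ?_) (key (τ • Y) (1 - τ) (by linarith))
                refine lintegral_congr fun Z => ?_
                congr 1; simp only [smul_sub, sub_smul, one_smul]; abel
            _ = _ := by rw [setLIntegral_const]; ring
    _ = _ := by rw [setLIntegral_const, hkint]; simp
end

section
variable {E : Type*} [NormedAddCommGroup E] [NormedSpace ℝ E]
    [FiniteDimensional ℝ E] [MeasurableSpace E] [BorelSpace E] {μ : Measure E}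
    [μ.IsAddHaarMeasure]

theorem cs_int {α : Type*} [MeasurableSpace α] (ν : Measure α) [IsFiniteMeasure ν] (f : α → ℝ) (hf : Integrable f ν)
    (hf2 : Integrable (fun x => f x ^ 2) ν) : (∫ x, f x ∂ν) ^ 2 ≤ ν.real univ * ∫ x, f x ^ 2 ∂ν := by
  set s := ∫ x, f x ∂ν with hs
  set m := ν.real univ with hm
  have hm0 : 0 ≤ m := measureReal_nonneg
  have h0 : 0 ≤ ∫ x, (m ^ 2 * f x ^ 2 - 2 * m * s * f x + s ^ 2) ∂ν :=
    integral_nonneg fun x => by have := sq_nonneg (m * f x - s); simp only [Pi.zero_apply]; nlinarith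
  have hi3 : Integrable (fun x => m ^ 2 * f x ^ 2 - 2 * m * s * f x) ν := (hf2.const_mul _).sub (hf.const_mul _)
  rw [integral_add hi3 (integrable_const _), integral_sub (hf2.const_mul _) (hf.const_mul _),
    integral_const_mul, integral_const_mul, integral_const, smul_eq_mul, ← hs, ← hm] at h0
  rcases hm0.eq_or_lt with h | h
  · have : ν = 0 := by
      rw [← Measure.measure_univ_eq_zero]
      rcases (ENNReal.toReal_eq_zero_iff _).1 (h.symm : (ν univ).toReal = 0) with h | h
      · exact h
      · exact absurd h (measure_ne_top _ _)
    rw [hs, this]; simp [← h]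
  · have : 0 ≤ m * (m * ∫ x, f x ^ 2 ∂ν - s ^ 2) := by nlinarith
    have := nonneg_of_mul_nonneg_right this h
    linarith

theorem mean_est (u w : E → ℝ) (K : Set E) (hKc : IsCompact K) (hu : ContinuousOn u K) (hw : Continuous w)
    (hw0 : ∀ X, 0 ≤ w X) (hwK : ∀ X, X ∉ K → w X = 0) (W A : ℝ) (hW : ∀ X, w X ≤ W) (hA : |∫ X, u X * w X ∂μ| ≤ A) :
    ENNReal.ofReal ((∫ X, w X ∂μ) ^ 2) * ∫⁻ Y in K, ENNReal.ofReal (u Y ^ 2) ∂μ ≤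
      2 * ENNReal.ofReal (W ^ 2) * μ K * (∫⁻ Y in K, ∫⁻ Z in K, ENNReal.ofReal ((u Y - u Z) ^ 2) ∂μ ∂μ) +
        2 * ENNReal.ofReal (A ^ 2) * μ K := by
  have hKm := hKc.measurableSet
  have hKf : μ K ≠ ⊤ := hKc.measure_ne_top
  haveI : IsFiniteMeasure (μ.restrict K) := ⟨by rw [Measure.restrict_apply_univ]; exact lt_top_iff_ne_top.2 hKf⟩
  have hA0 : 0 ≤ A := (abs_nonneg _).trans hA
  set I := ∫ X, w X ∂μ with hI
  have hIK : I = ∫ X in K, w X ∂μ := by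
    rw [hI, setIntegral_eq_integral_of_forall_compl_eq_zero]; exact hwK
  have hJK : ∫ X, u X * w X ∂μ = ∫ X in K, u X * w X ∂μ := by
    rw [setIntegral_eq_integral_of_forall_compl_eq_zero]; intro X hX; rw [hwK X hX, mul_zero]
  have hwi : IntegrableOn w K μ := hw.continuousOn.integrableOn_compact hKc
  have huwi : IntegrableOn (fun X => u X * w X) K μ := (hu.mul hw.continuousOn).integrableOn_compact hKc
  have key : ∀ Y ∈ K, ENNReal.ofReal (I ^ 2) * ENNReal.ofReal (u Y ^ 2) ≤
      2 * ENNReal.ofReal (W ^ 2) * μ K * (∫⁻ Z in K, ENNReal.ofReal ((u Y - u Z) ^ 2) ∂μ) + 2 * ENNReal.ofReal (A ^ 2) := by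
    intro Y hY
    have hdc : ContinuousOn (fun Z => u Y - u Z) K := continuousOn_const.sub hu
    have i4 : IntegrableOn (fun Z => (u Y - u Z) * w Z) K μ := (hdc.mul hw.continuousOn).integrableOn_compact hKc
    have h1 : I * u Y = ∫ Z in K, (u Y - u Z) * w Z ∂μ + ∫ X, u X * w X ∂μ := by
      rw [hJK, ← integral_add i4 huwi, hIK, mul_comm, ← integral_const_mul]
      congr 1; ext Z; ring
    have i2 : IntegrableOn (fun Z => (u Y - u Z) ^ 2) K μ := (hdc.pow 2).integrableOn_compact hKc
    have i3 : IntegrableOn (fun Z => ((u Y - u Z) * w Z) ^ 2) K μ := ((hdc.mul hw.continuousOn).pow 2).integrableOn_compact hKc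
    have h2 := cs_int (μ.restrict K) _ i4 i3
    have h3 : ∫ Z in K, ((u Y - u Z) * w Z) ^ 2 ∂μ ≤ W ^ 2 * ∫ Z in K, (u Y - u Z) ^ 2 ∂μ := by
      rw [← integral_const_mul]
      refine integral_mono i3 (i2.const_mul _) fun Z => ?_
      simp only [mul_pow]
      rw [mul_comm]
      gcongr
      · exact hw0 Z
      · exact hW Z
    rw [measureReal_restrict_apply_univ] at h2
    have h4 : (I * u Y) ^ 2 ≤ 2 * W ^ 2 * μ.real K * (∫ Z in K, (u Y - u Z) ^ 2 ∂μ) + 2 * A ^ 2 := by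
      rw [h1]
      have hA2 : (∫ X, u X * w X ∂μ) ^ 2 ≤ A ^ 2 := sq_le_sq' (abs_le.1 hA).1 (abs_le.1 hA).2
      have h5 : μ.real K * ∫ Z in K, ((u Y - u Z) * w Z) ^ 2 ∂μ ≤ μ.real K * (W ^ 2 * ∫ Z in K, (u Y - u Z) ^ 2 ∂μ) := by
        gcongr
      nlinarith [sq_nonneg (∫ Z in K, (u Y - u Z) * w Z ∂μ - ∫ X, u X * w X ∂μ)]
    rw [← ENNReal.ofReal_mul (sq_nonneg _), ← mul_pow]
    refine (ENNReal.ofReal_le_ofReal h4).trans (le_of_eq ?_)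
    have hnn : 0 ≤ ∫ Z in K, (u Y - u Z) ^ 2 ∂μ := integral_nonneg fun Z => sq_nonneg _
    have hm : 0 ≤ μ.real K := measureReal_nonneg
    rw [ENNReal.ofReal_add (by positivity) (by positivity), ENNReal.ofReal_mul (by positivity), ENNReal.ofReal_mul (by positivity),
      ENNReal.ofReal_mul (by positivity), ENNReal.ofReal_mul (by positivity), ← ofReal_integral_eq_lintegral_ofReal i2 (Eventually.of_forall fun Z => sq_nonneg _),
      ofReal_measureReal]
    simp
  rw [← lintegral_const_mul' _ _ ENNReal.ofReal_ne_top]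
  calc _ ≤ ∫⁻ Y in K, (2 * ENNReal.ofReal (W ^ 2) * μ K * (∫⁻ Z in K, ENNReal.ofReal ((u Y - u Z) ^ 2) ∂μ) + 2 * ENNReal.ofReal (A ^ 2)) ∂μ :=
        setLIntegral_mono' hKm key
    _ = _ := by
      rw [lintegral_add_right _ measurable_const, setLIntegral_const, lintegral_const_mul' _ _ (by finiteness)]
end

/-- vertical cutoff -/
def c2 (t s : ℝ) : ℝ := Real.smoothTransition (3 - 4 * s / t)
def c2' (t s : ℝ) : ℝ := deriv Real.smoothTransition (3 - 4 * s / t) * (-(4 / t))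
/-- horizontal cutoff -/
def c1 {n : ℕ} (p : EE n) (t : ℝ) : EE n → ℝ := rcut p (t / 8) (t / 4)
def wt {n : ℕ} (p : EE n) (t : ℝ) (X : Pt n) : ℝ := c1 p t X.1 * (-c2' t X.2)
def SB {n : ℕ} (p : EE n) (t : ℝ) : Set (Pt n) := Metric.closedBall p (t / 4) ×ˢ Ioo 0 t

theorem c2_hasDeriv (t s : ℝ) : HasDerivAt (c2 t) (c2' t s) s := by
  have h : HasDerivAt (fun s => 3 - 4 * s / t) (-(4 / t)) s := by
    have := (((hasDerivAt_id s).const_mul 4).div_const t).const_sub 3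
    simpa using this
  exact (ST_hasDeriv _).comp s h

theorem c2_nonneg (t s : ℝ) : 0 ≤ c2 t s := Real.smoothTransition.nonneg _
theorem c2_le_one (t s : ℝ) : c2 t s ≤ 1 := Real.smoothTransition.le_one _
theorem c2_zero {t s : ℝ} (ht : 0 < t) (h : 3 * t / 4 ≤ s) : c2 t s = 0 := by
  apply Real.smoothTransition.zero_of_nonpos
  rw [sub_nonpos, le_div_iff₀ ht]; linarith
theorem c2'_zero {t s : ℝ} (ht : 0 < t) (h : 3 * t / 4 ≤ s) : c2' t s = 0 := by
  unfold c2'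
  rw [ST_deriv_zero, zero_mul]
  left; rw [sub_nonpos, le_div_iff₀ ht]; linarith
theorem c2'_zero_low {t s : ℝ} (ht : 0 < t) (h : s ≤ t / 2) : c2' t s = 0 := by
  unfold c2'
  rw [ST_deriv_zero, zero_mul]
  right; rw [le_sub_comm, div_le_iff₀ ht]; linarith
theorem c2'_nonpos {t : ℝ} (ht : 0 < t) (s : ℝ) : c2' t s ≤ 0 := by
  unfold c2'
  have := ST_nonneg_deriv (3 - 4 * s / t)
  have h4 : 0 < 4 / t := by positivity
  nlinarith
theorem c2'_abs {C0 : ℝ} (hC : ∀ x, |deriv Real.smoothTransition x| ≤ C0) {t : ℝ} (ht : 0 < t) (s : ℝ) :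
    |c2' t s| ≤ C0 * (4 / t) := by
  unfold c2'
  rw [abs_mul, abs_neg, abs_of_pos (by positivity : 0 < 4 / t)]
  gcongr; exact hC _
theorem c2_contDiff (t : ℝ) : ContDiff ℝ (⊤ : ℕ∞) (c2 t) :=
  Real.smoothTransition.contDiff.comp (by fun_prop)
theorem c2'_cont (t : ℝ) : Continuous (c2' t) := by
  unfold c2'
  exact (ST_cont_deriv.comp (by fun_prop)).mul continuous_const

theorem c1_zero {n : ℕ} (p : EE n) {t : ℝ} (ht : 0 < t) (y : EE n) (hy : y ∉ Metric.closedBall p (t / 4)) : c1 p t y = 0 := by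
  rw [mem_closedBall_iff_norm] at hy
  exact rcut_zero p (by positivity) (by linarith) y (by linarith)
theorem c1_nonneg {n : ℕ} (p : EE n) (t : ℝ) (y : EE n) : 0 ≤ c1 p t y := rcut_nonneg _ _ _ _
theorem c1_le_one {n : ℕ} (p : EE n) (t : ℝ) (y : EE n) : c1 p t y ≤ 1 := rcut_le_one _ _ _ _
theorem c1_smooth {n : ℕ} (p : EE n) (t : ℝ) : ContDiff ℝ (⊤ : ℕ∞) (c1 p t) := rcut_smooth _ _ _

theorem wt_cont {n : ℕ} (p : EE n) (t : ℝ) : Continuous (wt p t) := by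
  unfold wt
  exact ((c1_smooth p t).continuous.comp continuous_fst).mul ((c2'_cont t).comp continuous_snd).neg

theorem wt_nonneg {n : ℕ} (p : EE n) {t : ℝ} (ht : 0 < t) (X : Pt n) : 0 ≤ wt p t X :=
  mul_nonneg (c1_nonneg _ _ _) (by have := c2'_nonpos ht X.2; linarith)

theorem wt_zero {n : ℕ} (p : EE n) {t : ℝ} (ht : 0 < t) (X : Pt n)
    (hX : X ∉ Metric.closedBall p (t / 4) ×ˢ Icc (t / 2) (3 * t / 4)) : wt p t X = 0 := by
  unfold wt
  rw [mem_prod, not_and_or] at hX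
  rcases hX with h | h
  · rw [c1_zero p ht _ h, zero_mul]
  · rw [mem_Icc, not_and_or] at h
    rcases h with h | h
    · rw [c2'_zero_low ht (by linarith)]; simp
    · rw [c2'_zero ht (by linarith)]; simp

theorem UHS_eq (n : ℕ) : UHS n = univ ×ˢ Ioi (0:ℝ) := by ext X; simp [UHS]

theorem UHS_open (n : ℕ) : IsOpen (UHS n) := isOpen_lt continuous_const continuous_snd

theorem vol_UHS (n : ℕ) : (volume : Measure (Pt n)).restrict (UHS n) =
    (volume : Measure (EE n)).prod (volume.restrict (Ioi (0:ℝ))) := by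
  rw [UHS_eq, Measure.volume_eq_prod, ← Measure.prod_restrict, Measure.restrict_univ]

theorem pdt_meas {n : ℕ} (u : Pt n → ℝ) : Measurable (pdt u) := measurable_fderiv_apply_const ℝ u _
theorem pdx_meas {n : ℕ} (i) (u : Pt n → ℝ) : Measurable (pdx i u) := measurable_fderiv_apply_const ℝ u _

theorem trace_int {n : ℕ} (p : EE n) {t : ℝ} (ht : 0 < t) (u : Pt n → ℝ)
    (hd : ∀ X ∈ UHS n, DifferentiableAt ℝ u X) (htr : HasTrace u (fun _ => 0))
    (hi : IntegrableOn (pdt u) (SB p t)) :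
    ∫ X in UHS n, pdt u X * (c1 p t X.1 * c2 t X.2) = ∫ X, u X * wt p t X := by
  have hSm : MeasurableSet (SB p t) := measurableSet_closedBall.prod measurableSet_Ioo
  have hSU : SB p t ⊆ UHS n := fun X hX => hX.2.1
  have hucont : ContinuousOn u (UHS n) := fun X hX => (hd X hX).continuousAt.continuousWithinAt
  have hcc : Continuous fun X : Pt n => c1 p t X.1 * c2 t X.2 :=
    ((c1_smooth p t).continuous.comp continuous_fst).mul ((c2_contDiff t).continuous.comp continuous_snd)
  -- integrability
  have i1 : IntegrableOn (fun X => pdt u X * (c1 p t X.1 * c2 t X.2)) (UHS n) := by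
    have h1 : IntegrableOn (fun X => pdt u X * (c1 p t X.1 * c2 t X.2)) (SB p t) := by
      refine Integrable.mono hi ((pdt_meas u).mul hcc.measurable).aestronglyMeasurable (Eventually.of_forall fun X => ?_)
      rw [norm_mul, Real.norm_eq_abs (c1 p t X.1 * c2 t X.2), abs_of_nonneg (mul_nonneg (c1_nonneg _ _ _) (c2_nonneg _ _))]
      exact mul_le_of_le_one_right (norm_nonneg _) (mul_le_one₀ (c1_le_one _ _ _) (c2_nonneg _ _) (c2_le_one _ _))
    refine h1.of_forall_diff_eq_zero (UHS_open n).measurableSet fun X hX => ?_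
    have : c1 p t X.1 * c2 t X.2 = 0 := by
      by_contra h
      apply hX.2
      refine ⟨by by_contra h2; exact h (by rw [c1_zero p ht _ h2, zero_mul]), hX.1, ?_⟩
      by_contra h2
      exact h (by rw [c2_zero ht (by linarith), mul_zero])
    rw [this, mul_zero]
  set Kc := Metric.closedBall p (t / 4) ×ˢ Icc (t / 2) (3 * t / 4) with hKc
  have hKcpt : IsCompact Kc := (isCompact_closedBall p _).prod isCompact_Icc
  have hKU : Kc ⊆ UHS n := fun X hX => lt_of_lt_of_le (by positivity : (0:ℝ) < t / 2) hX.2.1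
  have i2' : IntegrableOn (fun X => u X * wt p t X) Kc :=
    ((hucont.mono hKU).mul (wt_cont p t).continuousOn).integrableOn_compact hKcpt
  have i2 : IntegrableOn (fun X => u X * wt p t X) (UHS n) :=
    i2'.of_forall_diff_eq_zero (UHS_open n).measurableSet fun X hX => by rw [wt_zero p ht X hX.2, mul_zero]
  have hglob : ∫ X, u X * wt p t X = ∫ X in UHS n, u X * wt p t X := by
    rw [setIntegral_eq_integral_of_forall_compl_eq_zero]
    intro X hX
    rw [wt_zero p ht X fun h => hX (hKU h), mul_zero]
  rw [hglob, ← sub_eq_zero, ← integral_sub i1 i2]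
  have i3 : Integrable (fun X => pdt u X * (c1 p t X.1 * c2 t X.2) - u X * wt p t X) (volume.restrict (UHS n)) := i1.sub i2
  rw [vol_UHS] at i3 ⊢
  rw [integral_prod _ i3]
  rw [integral_eq_zero_of_ae]
  filter_upwards [i3.prod_right_ae] with y hy
  simp only [Pi.zero_apply]
  set F : ℝ → ℝ := fun s => if s ≤ 0 then 0 else c1 p t y * (u (y, s) * c2 t s) with hF
  have hFeq : ∀ s, 0 < s → F s = c1 p t y * (u (y, s) * c2 t s) := fun s hs => by simp [hF, not_le.2 hs]
  have hc : ContinuousWithinAt F (Ici 0) 0 := by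
    rw [← continuousWithinAt_Ioi_iff_Ici]
    have h1 : Tendsto (fun s => c1 p t y * (u (y, s) * c2 t s)) (nhdsWithin 0 (Ioi 0)) (nhds (c1 p t y * (0 * c2 t 0))) :=
      ((htr y).mul (((c2_contDiff t).continuous.tendsto 0).mono_left nhdsWithin_le_nhds)).const_mul _
    have h2 : F 0 = c1 p t y * (0 * c2 t 0) := by simp [hF]
    rw [ContinuousWithinAt, h2]
    refine h1.congr' ?_
    filter_upwards [self_mem_nhdsWithin] with s hs
    exact (hFeq s hs).symm
  have hder : ∀ s ∈ Ioi (0:ℝ), HasDerivAt F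
      (pdt u (y, s) * (c1 p t y * c2 t s) - u (y, s) * wt p t (y, s)) s := by
    intro s hs
    have h0 : HasDerivAt (fun s : ℝ => ((y, s) : Pt n)) (0, 1) s := (hasDerivAt_const s y).prodMk (hasDerivAt_id s)
    have h1 : HasDerivAt (fun s => u (y, s)) (pdt u (y, s)) s :=
      (hd (y, s) hs).hasFDerivAt.comp_hasDerivAt s h0
    have h2 := (h1.mul (c2_hasDeriv t s)).const_mul (c1 p t y)
    have h3 : F =ᶠ[nhds s] fun s => c1 p t y * (u (y, s) * c2 t s) := by
      filter_upwards [Ioi_mem_nhds hs] with r hr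
      exact hFeq r hr
    refine (HasDerivAt.congr_of_eventuallyEq h2 h3).congr_deriv ?_
    unfold wt
    simp only
    ring
  have hlim : Tendsto F atTop (nhds 0) := by
    refine tendsto_const_nhds.congr' ?_
    filter_upwards [eventually_ge_atTop (3 * t / 4), eventually_gt_atTop 0] with s hs hs0
    rw [hFeq s hs0, c2_zero ht hs]; simp
  have := integral_Ioi_of_hasDerivAt_of_tendsto hc hder hy hlim
  refine this.trans ?_
  simp [hF]

theorem int_bound {α : Type*} [MeasurableSpace α] (μ : Measure α) (V S : Set α) (hV : MeasurableSet V) (hS : MeasurableSet S)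
    (f g : α → ℝ) (c a : ℝ) (hc : 0 ≤ c) (ha : 0 ≤ a) (hf : ∀ X ∈ S, |f X| ≤ c * g X) (hf0 : ∀ X ∈ V, X ∉ S → f X = 0)
    (hg : ∫⁻ X in S, ENNReal.ofReal (g X) ∂μ ≤ ENNReal.ofReal a) : |∫ X in V, f X ∂μ| ≤ c * a := by
  have h1 := norm_integral_le_lintegral_norm (μ := μ.restrict V) f
  rw [Real.norm_eq_abs] at h1
  refine h1.trans ?_
  refine ENNReal.toReal_le_of_le_ofReal (by positivity) ?_
  rw [ENNReal.ofReal_mul hc]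
  refine le_trans ?_ (mul_le_mul_right hg _)
  rw [← lintegral_const_mul' _ _ ENNReal.ofReal_ne_top, ← lintegral_indicator hS]
  refine le_trans ?_ (setLIntegral_le_lintegral V _)
  refine setLIntegral_mono' hV fun X hX => ?_
  by_cases h : X ∈ S
  · rw [indicator_of_mem h, ← ENNReal.ofReal_mul hc]
    exact ENNReal.ofReal_le_ofReal (hf X h)
  · rw [hf0 X hX h]; simp

def hh (t ε s : ℝ) : ℝ := s * c2 t s * Real.smoothTransition (s / ε - 1)
def hh' (t ε s : ℝ) : ℝ := (c2 t s + s * c2' t s) * Real.smoothTransition (s / ε - 1) +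
  s * c2 t s * (deriv Real.smoothTransition (s / ε - 1) * (1 / ε))

theorem hh_hasDeriv (t ε s : ℝ) : HasDerivAt (hh t ε) (hh' t ε s) s := by
  have h1 : HasDerivAt (fun s => s / ε - 1) (1 / ε) s := ((hasDerivAt_id s).div_const ε).sub_const 1
  have h2 : HasDerivAt (fun s => Real.smoothTransition (s / ε - 1)) _ s := (ST_hasDeriv _).comp s h1
  have h3 : HasDerivAt (fun s => s * c2 t s) _ s := (hasDerivAt_id s).mul (c2_hasDeriv t s)
  refine (h3.mul h2).congr_deriv ?_
  unfold hh'
  simp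

theorem hh_smooth (t ε : ℝ) : ContDiff ℝ (⊤ : ℕ∞) (hh t ε) := by
  unfold hh
  exact (contDiff_id.mul (c2_contDiff t)).mul (Real.smoothTransition.contDiff.comp (by fun_prop))

theorem hh_low {t ε s : ℝ} (hε : 0 < ε) (h : s ≤ ε) : hh t ε s = 0 := by
  unfold hh
  rw [Real.smoothTransition.zero_of_nonpos, mul_zero]
  rw [sub_nonpos, div_le_one hε]; exact h

theorem hh_high {t ε s : ℝ} (ht : 0 < t) (h : 3 * t / 4 ≤ s) : hh t ε s = 0 := by
  unfold hh; rw [c2_zero ht h]; simp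
theorem hh'_high {t ε s : ℝ} (ht : 0 < t) (h : 3 * t / 4 ≤ s) : hh' t ε s = 0 := by
  unfold hh'; rw [c2_zero ht h, c2'_zero ht h]; simp

theorem hh_abs {t ε s : ℝ} (hs : 0 < s) : |hh t ε s| ≤ s := by
  unfold hh
  rw [abs_of_nonneg (mul_nonneg (mul_nonneg hs.le (c2_nonneg _ _)) (Real.smoothTransition.nonneg _)), mul_assoc]
  exact mul_le_of_le_one_right hs.le (mul_le_one₀ (c2_le_one _ _) (Real.smoothTransition.nonneg _) (Real.smoothTransition.le_one _))

theorem hh'_abs {C0 : ℝ} (hC : ∀ x, |deriv Real.smoothTransition x| ≤ C0) {t ε s : ℝ} (ht : 0 < t) (hε : 0 < ε) (hs : 0 < s) (hst : s < t) :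
    |hh' t ε s| ≤ 1 + 6 * C0 := by
  have hC0 : 0 ≤ C0 := (abs_nonneg _).trans (hC 0)
  unfold hh'
  have e1 : |s * c2' t s| ≤ 4 * C0 := by
    rw [abs_mul, abs_of_pos hs]
    calc s * |c2' t s| ≤ t * (C0 * (4 / t)) := by gcongr; exact c2'_abs hC ht s
      _ = 4 * C0 := by field_simp
  have e2 : |c2 t s + s * c2' t s| ≤ 1 + 4 * C0 := by
    refine (abs_add_le _ _).trans (add_le_add ?_ e1)
    rw [abs_of_nonneg (c2_nonneg _ _)]; exact c2_le_one _ _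
  have e3 : |s * (deriv Real.smoothTransition (s / ε - 1) * (1 / ε))| ≤ 2 * C0 := by
    rw [abs_mul, abs_mul, abs_of_pos hs, abs_of_pos (by positivity : 0 < 1 / ε)]
    by_cases h : s ≤ 2 * ε
    · calc s * (|deriv Real.smoothTransition (s / ε - 1)| * (1 / ε)) ≤ (2 * ε) * (C0 * (1 / ε)) := by
            gcongr; exact hC _
        _ = 2 * C0 := by field_simp
    · rw [ST_deriv_zero]
      · simp; positivity
      · right
        rw [le_sub_iff_add_le, le_div_iff₀ hε]; linarith
  refine (abs_add_le _ _).trans ?_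
  rw [abs_mul, mul_right_comm s, abs_mul (s * _), abs_of_nonneg (c2_nonneg t s), abs_of_nonneg (Real.smoothTransition.nonneg (s / ε - 1))]
  have f1 := mul_le_mul e2 (Real.smoothTransition.le_one (s / ε - 1)) (Real.smoothTransition.nonneg _) (by positivity)
  have f2 := mul_le_mul e3 (c2_le_one t s) (c2_nonneg _ _) (by positivity)
  linarith

theorem sep_fderiv {n : ℕ} (c : EE n → ℝ) (h : ℝ → ℝ) (h' : ℝ) (X : Pt n) (hc : DifferentiableAt ℝ c X.1) (hh : HasDerivAt h h' X.2) :
    (∀ i, pdx i (fun X : Pt n => c X.1 * h X.2) X = fderiv ℝ c X.1 (EuclideanSpace.single i 1) * h X.2) ∧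
    pdt (fun X : Pt n => c X.1 * h X.2) X = c X.1 * h' := by
  have d1 : HasFDerivAt (fun Y : Pt n => c Y.1) ((fderiv ℝ c X.1).comp (ContinuousLinearMap.fst ℝ _ _)) X :=
    hc.hasFDerivAt.comp X hasFDerivAt_fst
  have d2 : HasFDerivAt (fun Y : Pt n => h Y.2) (h' • (ContinuousLinearMap.snd ℝ (EE n) ℝ)) X :=
    hh.comp_hasFDerivAt X hasFDerivAt_snd
  have d3 := HasFDerivAt.fderiv (f := fun X : Pt n => c X.1 * h X.2) (d1.mul d2)
  unfold pdx pdt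
  rw [d3]
  constructor
  · intro i; simp [mul_comm]
  · simp [mul_comm]


def tst {n : ℕ} (p : EE n) (t ε : ℝ) (X : Pt n) : ℝ := c1 p t X.1 * hh t ε X.2

theorem tst_pdx {n : ℕ} (p : EE n) (t ε : ℝ) (X : Pt n) (i : Fin (n - 1)) :
    pdx i (tst p t ε) X = fderiv ℝ (c1 p t) X.1 (EuclideanSpace.single i 1) * hh t ε X.2 :=
  (sep_fderiv (c1 p t) (hh t ε) (hh' t ε X.2) X ((c1_smooth p t).differentiable (by simp) X.1) (hh_hasDeriv t ε X.2)).1 i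

theorem tst_pdt {n : ℕ} (p : EE n) (t ε : ℝ) (X : Pt n) :
    pdt (tst p t ε) X = c1 p t X.1 * hh' t ε X.2 :=
  (sep_fderiv (c1 p t) (hh t ε) (hh' t ε X.2) X ((c1_smooth p t).differentiable (by simp) X.1) (hh_hasDeriv t ε X.2)).2

theorem tst_test {n : ℕ} (p : EE n) {t ε : ℝ} (ht : 0 < t) (hε : 0 < ε) : TestFun (UHS n) (tst p t ε) := by
  have hts : tsupport (tst p t ε) ⊆ Metric.closedBall p (t / 4) ×ˢ Icc ε (3 * t / 4) := by
    refine closure_minimal ?_ (Metric.isClosed_closedBall.prod isClosed_Icc)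
    intro X hX
    rw [Function.mem_support] at hX
    refine ⟨?_, ?_, ?_⟩
    · by_contra h; exact hX (by unfold tst; rw [c1_zero p ht _ h, zero_mul])
    · by_contra h; exact hX (by unfold tst; rw [hh_low hε (by linarith), mul_zero])
    · by_contra h; exact hX (by unfold tst; rw [hh_high ht (by linarith), mul_zero])
  refine ⟨?_, ?_, ?_⟩
  · exact ((c1_smooth p t).comp contDiff_fst).mul ((hh_smooth t ε).comp contDiff_snd)
  · exact ((isCompact_closedBall p _).prod isCompact_Icc).of_isClosed_subset (isClosed_tsupport _) hts
  · intro X hX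
    exact lt_of_lt_of_le hε (hts hX).2.1

theorem c1_fz {n : ℕ} (p : EE n) {t : ℝ} (ht : 0 < t) (y : EE n) (hy : y ∉ Metric.closedBall p (t / 4)) : fderiv ℝ (c1 p t) y = 0 := by
  have : y ∉ tsupport (c1 p t) := fun h => hy (rcut_tsupport p (by positivity) (by linarith) h)
  exact fderiv_of_notMem_tsupport ℝ this

theorem c1_fb {C0 : ℝ} (hC : ∀ x, |deriv Real.smoothTransition x| ≤ C0) {n : ℕ} (p : EE n) {t : ℝ} (ht : 0 < t) (y : EE n) (i : Fin (n - 1)) :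
    |fderiv ℝ (c1 p t) y (EuclideanSpace.single i 1)| ≤ 16 * C0 / t := by
  have := rcut_grad hC p (by positivity : 0 < t / 8) (by linarith : t / 8 < t / 4) y (EuclideanSpace.single i 1)
  refine this.trans (le_of_eq ?_)
  simp; field_simp; ring

set_option maxHeartbeats 1000000 in
theorem flat_est {C0 : ℝ} (hC : ∀ x, |deriv Real.smoothTransition x| ≤ C0) {n : ℕ} (p : EE n) {t : ℝ} (ht : 0 < t) (u : Pt n → ℝ)
    (hd : ∀ X ∈ UHS n, DifferentiableAt ℝ u X) (htr : HasTrace u (fun _ => 0))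
    (hi : IntegrableOn (pdt u) (SB p t)) (P R : Fin (n - 1) → Pt n → ℝ)
    (hPi : ∀ i, IntegrableOn (P i) (SB p t))
    (hw : ∀ ϕ : Pt n → ℝ, TestFun (UHS n) ϕ → ∫ X in UHS n, ((∑ i, P i X * pdx i ϕ X) + pdt u X * pdt ϕ X) =
      -∫ X in UHS n, ∑ i, R i X * pdx i ϕ X)
    (a1 a2 a3 : ℝ) (ha1 : 0 ≤ a1) (ha2 : 0 ≤ a2) (ha3 : 0 ≤ a3)
    (h1 : ∫⁻ X in SB p t, ENNReal.ofReal (X.2 / t * ∑ i, |P i X|) ≤ ENNReal.ofReal a1)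
    (h2 : ∫⁻ X in SB p t, ENNReal.ofReal (X.2 / t * ∑ i, |R i X|) ≤ ENNReal.ofReal a2)
    (h3 : ∫⁻ X in SB p t, ENNReal.ofReal (X.2 / t * |pdt u X|) ≤ ENNReal.ofReal a3) :
    |∫ X, u X * wt p t X| ≤ 16 * C0 * (a1 + a2 + a3) := by
  have hC0 : 0 ≤ C0 := (abs_nonneg _).trans (hC 0)
  have hSm : MeasurableSet (SB p t) := measurableSet_closedBall.prod measurableSet_Ioo
  have hUm := (UHS_open n).measurableSet
  have hSU : SB p t ⊆ UHS n := fun X hX => hX.2.1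
  have hnotS : ∀ X ∈ UHS n, X ∉ SB p t → X.1 ∉ Metric.closedBall p (t / 4) ∨ 3 * t / 4 ≤ X.2 := by
    intro X hX hXS
    by_contra h
    push Not at h
    exact hXS ⟨h.1, hX, by linarith [h.2]⟩
  have hc1z := fun y => c1_fz p ht y
  have hc1b := fun y i => c1_fb hC p ht y i
  have htest : ∀ ε, 0 < ε → TestFun (UHS n) (tst p t ε) := fun ε hε => tst_test p ht hε
  have hpdx := tst_pdx p t
  have hpdt := tst_pdt p t
  have hpdx0 : ∀ ε, ∀ X ∈ UHS n, X ∉ SB p t → ∀ i, pdx i (tst p t ε) X = 0 := by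
    intro ε X hX hXS i
    rw [hpdx]
    rcases hnotS X hX hXS with h | h
    · rw [hc1z _ h]; simp
    · rw [hh_high ht h, mul_zero]
  have hpdt0 : ∀ ε, ∀ X ∈ UHS n, X ∉ SB p t → pdt (tst p t ε) X = 0 := by
    intro ε X hX hXS
    rw [hpdt]
    rcases hnotS X hX hXS with h | h
    · rw [c1_zero p ht _ h, zero_mul]
    · rw [hh'_high ht h, mul_zero]
  have hpdxb : ∀ ε, ∀ X ∈ SB p t, ∀ i, |pdx i (tst p t ε) X| ≤ 16 * C0 * (X.2 / t) := by
    intro ε X hX i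
    rw [hpdx, abs_mul]
    calc _ ≤ 16 * C0 / t * X.2 := by gcongr; exacts [hc1b _ _, hh_abs hX.2.1]
      _ = _ := by ring
  have hpdtb : ∀ ε, 0 < ε → ∀ X ∈ SB p t, |pdt (tst p t ε) X| ≤ 1 + 6 * C0 := by
    intro ε hε X hX
    rw [hpdt, abs_mul, abs_of_nonneg (c1_nonneg _ _ _)]
    calc _ ≤ 1 * (1 + 6 * C0) := by gcongr; exacts [c1_le_one _ _ _, hh'_abs hC ht hε hX.2.1 hX.2.2]
      _ = _ := one_mul _
  have hflux : ∀ (T : Fin (n - 1) → Pt n → ℝ) (a : ℝ), 0 ≤ a → 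
      (∫⁻ X in SB p t, ENNReal.ofReal (X.2 / t * ∑ i, |T i X|) ≤ ENNReal.ofReal a) → ∀ ε,
      |∫ X in UHS n, ∑ i, T i X * pdx i (tst p t ε) X| ≤ 16 * C0 * a := by
    intro T a ha hT ε
    refine int_bound volume _ (SB p t) hUm hSm _ _ _ a (by positivity) ha ?_ ?_ hT
    · intro X hX
      refine (Finset.abs_sum_le_sum_abs _ _).trans ?_
      rw [Finset.mul_sum, Finset.mul_sum]
      refine Finset.sum_le_sum fun i _ => ?_
      rw [abs_mul]
      calc _ ≤ |T i X| * (16 * C0 * (X.2 / t)) := by gcongr; exact hpdxb ε X hX i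
        _ = _ := by ring
    · intro X hX hXS
      exact Finset.sum_eq_zero fun i _ => by rw [hpdx0 ε X hX hXS i, mul_zero]
  have hmeasx : ∀ ε i, Measurable (pdx i (tst p t ε)) := fun ε i => pdx_meas i _
  have hmeast : ∀ ε, Measurable (pdt (tst p t ε)) := fun ε => pdt_meas _
  have hPint : ∀ ε, IntegrableOn (fun X => ∑ i, P i X * pdx i (tst p t ε) X) (UHS n) := by
    intro ε
    refine IntegrableOn.of_forall_diff_eq_zero (s := SB p t) ?_ hUm fun X hX =>
      Finset.sum_eq_zero fun i _ => by rw [hpdx0 ε X hX.1 hX.2 i, mul_zero]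
    refine integrable_finsetSum _ fun i _ => ?_
    refine Integrable.mono ((hPi i).mul_const (16 * C0)) ((hPi i).aestronglyMeasurable.mul (hmeasx ε i).aestronglyMeasurable) ?_
    refine (ae_restrict_iff' hSm).2 (Eventually.of_forall fun X hX => ?_)
    rw [norm_mul, norm_mul]
    gcongr
    rw [Real.norm_eq_abs, Real.norm_of_nonneg (by positivity)]
    refine (hpdxb ε X hX i).trans ?_
    have : X.2 / t ≤ 1 := by rw [div_le_one ht]; exact hX.2.2.le
    nlinarith
  have hTint : ∀ ε, 0 < ε → IntegrableOn (fun X => pdt u X * pdt (tst p t ε) X) (UHS n) := by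
    intro ε hε
    refine IntegrableOn.of_forall_diff_eq_zero (s := SB p t) ?_ hUm fun X hX => by rw [hpdt0 ε X hX.1 hX.2, mul_zero]
    refine Integrable.mono (hi.mul_const (1 + 6 * C0)) (hi.aestronglyMeasurable.mul (hmeast ε).aestronglyMeasurable) ?_
    refine (ae_restrict_iff' hSm).2 (Eventually.of_forall fun X hX => ?_)
    rw [norm_mul, norm_mul]
    gcongr
    rw [Real.norm_eq_abs, Real.norm_of_nonneg (by positivity)]
    exact hpdtb ε hε X hX
  have hmain : ∀ ε, 0 < ε → |∫ X in UHS n, pdt u X * pdt (tst p t ε) X| ≤ 16 * C0 * (a1 + a2) := by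
    intro ε hε
    have e := hw (tst p t ε) (htest ε hε)
    rw [integral_add (hPint ε) (hTint ε hε)] at e
    have e1 := abs_le.1 (hflux P a1 ha1 h1 ε)
    have e2 := abs_le.1 (hflux R a2 ha2 h2 ε)
    rw [abs_le]
    constructor <;> linarith
  -- limit
  have hlim : Tendsto (fun k : ℕ => ∫ X in UHS n, pdt u X * pdt (tst p t (1 / ((k : ℝ) + 1))) X) atTop
      (nhds (∫ X in UHS n, pdt u X * (c1 p t X.1 * (c2 t X.2 + X.2 * c2' t X.2)))) := by
    refine tendsto_integral_of_dominated_convergence ((SB p t).indicator fun X => ‖pdt u X‖ * (1 + 6 * C0)) ?_ ?_ ?_ ?_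
    · intro k; exact ((pdt_meas u).mul (hmeast _)).aestronglyMeasurable
    · have : Integrable ((SB p t).indicator fun X => ‖pdt u X‖ * (1 + 6 * C0)) volume :=
        (integrable_indicator_iff hSm).2 (hi.norm.mul_const _)
      exact this.integrableOn
    · intro k
      refine (ae_restrict_iff' hUm).2 (Eventually.of_forall fun X hX => ?_)
      by_cases h : X ∈ SB p t
      · rw [indicator_of_mem h, norm_mul]
        gcongr
        exact hpdtb _ (by positivity) X h
      · rw [indicator_of_notMem h, hpdt0 _ X hX h]; simp
    · refine (ae_restrict_iff' hUm).2 (Eventually.of_forall fun X hX => ?_)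
      refine Tendsto.const_mul _ ?_
      simp only [hpdt]
      refine Tendsto.const_mul _ ?_
      refine tendsto_const_nhds.congr' ?_
      have h0 : Tendsto (fun k : ℕ => 1 / ((k : ℝ) + 1)) atTop (nhds 0) := tendsto_one_div_add_atTop_nhds_zero_nat
      have hX2 : (0:ℝ) < X.2 / 2 := half_pos hX
      filter_upwards [h0.eventually (gt_mem_nhds hX2)] with k hk
      have hpos : (0:ℝ) < 1 / ((k : ℝ) + 1) := by positivity
      have h5 : 1 ≤ X.2 / (1 / ((k : ℝ) + 1)) - 1 := by
        rw [le_sub_iff_add_le, le_div_iff₀ hpos]; linarith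
      unfold hh'
      rw [Real.smoothTransition.one_of_one_le h5, ST_deriv_zero (Or.inr h5)]
      ring
  have hfin : |∫ X in UHS n, pdt u X * (c1 p t X.1 * (c2 t X.2 + X.2 * c2' t X.2))| ≤ 16 * C0 * (a1 + a2) :=
    le_of_tendsto hlim.abs (Eventually.of_forall fun k => hmain _ (by positivity))
  -- second part
  have hB : |∫ X in UHS n, pdt u X * (c1 p t X.1 * (X.2 * c2' t X.2))| ≤ 4 * C0 * a3 := by
    refine int_bound volume _ (SB p t) hUm hSm _ _ _ a3 (by positivity) ha3 ?_ ?_ h3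
    · intro X hX
      have hX2 : 0 < X.2 := hX.2.1
      rw [abs_mul, abs_mul, abs_mul, abs_of_pos hX2, abs_of_nonneg (c1_nonneg _ _ _)]
      calc _ ≤ |pdt u X| * (1 * (X.2 * (C0 * (4 / t)))) := by
            gcongr
            exacts [c1_le_one _ _ _, c2'_abs hC ht _]
        _ = _ := by ring
    · intro X hX hXS
      rcases hnotS X hX hXS with h | h
      · rw [c1_zero p ht _ h]; simp
      · rw [c2'_zero ht h]; simp
  have hcont1 : Continuous fun X : Pt n => c1 p t X.1 * c2 t X.2 :=
    ((c1_smooth p t).continuous.comp continuous_fst).mul ((c2_contDiff t).continuous.comp continuous_snd)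
  have hcont2 : Continuous fun X : Pt n => c1 p t X.1 * (X.2 * c2' t X.2) :=
    ((c1_smooth p t).continuous.comp continuous_fst).mul (continuous_snd.mul ((c2'_cont t).comp continuous_snd))
  have i1 : IntegrableOn (fun X => pdt u X * (c1 p t X.1 * c2 t X.2)) (UHS n) := by
    refine IntegrableOn.of_forall_diff_eq_zero (s := SB p t) ?_ hUm fun X hX => ?_
    · refine Integrable.mono hi (hi.aestronglyMeasurable.mul hcont1.aestronglyMeasurable) (Eventually.of_forall fun X => ?_)
      rw [norm_mul, Real.norm_eq_abs (c1 p t X.1 * c2 t X.2), abs_of_nonneg (mul_nonneg (c1_nonneg _ _ _) (c2_nonneg _ _))]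
      exact mul_le_of_le_one_right (norm_nonneg _) (mul_le_one₀ (c1_le_one _ _ _) (c2_nonneg _ _) (c2_le_one _ _))
    · rcases hnotS X hX.1 hX.2 with h | h
      · rw [c1_zero p ht _ h]; simp
      · rw [c2_zero ht h]; simp
  have i2 : IntegrableOn (fun X => pdt u X * (c1 p t X.1 * (X.2 * c2' t X.2))) (UHS n) := by
    refine IntegrableOn.of_forall_diff_eq_zero (s := SB p t) ?_ hUm fun X hX => ?_
    · refine Integrable.mono (hi.mul_const (4 * C0)) (hi.aestronglyMeasurable.mul hcont2.aestronglyMeasurable) ?_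
      refine (ae_restrict_iff' hSm).2 (Eventually.of_forall fun X hX => ?_)
      have hX2 : 0 < X.2 := hX.2.1
      rw [norm_mul, norm_mul (pdt u X) (4 * C0)]
      refine mul_le_mul_of_nonneg_left ?_ (norm_nonneg _)
      rw [Real.norm_eq_abs, Real.norm_of_nonneg (by positivity), abs_mul, abs_mul, abs_of_pos hX2, abs_of_nonneg (c1_nonneg _ _ _)]
      calc _ ≤ 1 * (t * (C0 * (4 / t))) := by
            gcongr
            exacts [c1_le_one _ _ _, hX.2.2.le, c2'_abs hC ht _]
        _ = _ := by field_simp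
    · rcases hnotS X hX.1 hX.2 with h | h
      · rw [c1_zero p ht _ h]; simp
      · rw [c2'_zero ht h]; simp
  have hsplit : ∫ X in UHS n, pdt u X * (c1 p t X.1 * (c2 t X.2 + X.2 * c2' t X.2)) =
      (∫ X in UHS n, pdt u X * (c1 p t X.1 * c2 t X.2)) + ∫ X in UHS n, pdt u X * (c1 p t X.1 * (X.2 * c2' t X.2)) := by
    rw [← integral_add i1 i2]
    congr 1; ext X; ring
  rw [hsplit, trace_int p ht u hd htr hi] at hfin
  have e1 := abs_le.1 hfin
  have e2 := abs_le.1 hB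
  have e3 : 0 ≤ C0 * a3 := by positivity
  rw [abs_le]
  constructor <;> nlinarith

/-- volume of the unit ball -/
def kap0 (n : ℕ) : ℝ := (volume (Metric.ball (0 : EE n) 1)).toReal

theorem kap0_pos (n : ℕ) : 0 < kap0 n :=
  ENNReal.toReal_pos (Metric.measure_ball_pos _ _ one_pos).ne' measure_ball_lt_top.ne

theorem vol_cb {n : ℕ} (p : EE n) {r : ℝ} (hr : 0 ≤ r) :
    volume (Metric.closedBall p r) = ENNReal.ofReal (kap0 n * r ^ (n - 1)) := by
  rw [Measure.addHaar_closedBall _ _ hr, mul_comm (kap0 n), ENNReal.ofReal_mul (by positivity), kap0,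
    ENNReal.ofReal_toReal measure_ball_lt_top.ne]
  simp

theorem vol_b {n : ℕ} (p : EE n) {r : ℝ} (hr : 0 < r) :
    volume (Metric.ball p r) = ENNReal.ofReal (kap0 n * r ^ (n - 1)) := by
  rw [Measure.addHaar_ball_of_pos _ _ hr, mul_comm (kap0 n), ENNReal.ofReal_mul (by positivity), kap0,
    ENNReal.ofReal_toReal measure_ball_lt_top.ne]
  simp

theorem int_c2' {t : ℝ} (ht : 0 < t) : ∫ s, -c2' t s = 1 := by
  have h1 : ∫ s, -c2' t s = ∫ s in (0:ℝ)..t, -c2' t s := by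
    rw [intervalIntegral.integral_eq_integral_of_support_subset]
    intro s hs
    rw [Function.mem_support] at hs
    constructor
    · by_contra h; exact hs (by rw [c2'_zero_low ht (by linarith)]; simp)
    · by_contra h; exact hs (by rw [c2'_zero ht (by linarith)]; simp)
  rw [h1, intervalIntegral.integral_neg, intervalIntegral.integral_eq_sub_of_hasDerivAt (fun s _ => c2_hasDeriv t s)
    ((c2'_cont t).intervalIntegrable _ _), c2_zero ht (by linarith)]
  have : c2 t 0 = 1 := by unfold c2; exact Real.smoothTransition.one_of_one_le (by norm_num)
  rw [this]; norm_num

theorem int_wt {n : ℕ} (p : EE n) {t : ℝ} (ht : 0 < t) : kap0 n * (t / 8) ^ (n - 1) ≤ ∫ X, wt p t X := by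
  unfold wt
  have := integral_prod_mul (μ := (volume : Measure (EE n))) (ν := (volume : Measure ℝ)) (c1 p t) (fun s => -c2' t s)
  rw [Measure.volume_eq_prod, this, int_c2' ht, mul_one]
  have hc : HasCompactSupport (c1 p t) := by
    exact (isCompact_closedBall p (t / 4)).of_isClosed_subset (isClosed_tsupport _)
      (rcut_tsupport p (by positivity) (by linarith))
  have hi : Integrable (c1 p t) := (c1_smooth p t).continuous.integrable_of_hasCompactSupport hc
  have h2 : ∫ x, (Metric.closedBall p (t / 8)).indicator (fun _ => (1:ℝ)) x ≤ ∫ x, c1 p t x := by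
    refine integral_mono ?_ hi fun y => ?_
    · exact (integrable_indicator_iff measurableSet_closedBall).2 (integrableOn_const measure_closedBall_lt_top.ne)
    · by_cases h : y ∈ Metric.closedBall p (t / 8)
      · simp only [indicator_of_mem h]
        rw [c1, rcut_one p (by positivity) (by linarith) y h]
      · simp only [indicator_of_notMem h]; exact c1_nonneg _ _ _
  rw [integral_indicator measurableSet_closedBall] at h2
  simp only [integral_const, smul_eq_mul, mul_one] at h2
  refine le_trans (le_of_eq ?_) h2
  rw [measureReal_def, Measure.restrict_apply_univ, vol_cb p (by positivity), ENNReal.toReal_ofReal]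
  have := kap0_pos n
  positivity

theorem wt_le {C0 : ℝ} (hC : ∀ x, |deriv Real.smoothTransition x| ≤ C0) {n : ℕ} (p : EE n) {t : ℝ} (ht : 0 < t) (X : Pt n) :
    wt p t X ≤ 4 * C0 / t := by
  unfold wt
  have h1 := c2'_abs hC ht X.2
  have h2 := c2'_nonpos ht X.2
  rw [abs_of_nonpos h2] at h1
  calc _ ≤ 1 * (C0 * (4 / t)) := by
        refine mul_le_mul (c1_le_one _ _ _) h1 (by linarith) (by norm_num)
    _ = _ := by ring

theorem nrm_sq {n : ℕ} (hn : 2 ≤ n) (u : Pt n → ℝ) (X : Pt n) : ‖fderiv ℝ u X‖ ^ 2 ≤ n * gradSq u X := by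
  have h1 := ev_he (fderiv ℝ u X)
  rw [gradSq_eq hn]
  calc ‖fderiv ℝ u X‖ ^ 2 ≤ (∑ i, |fderiv ℝ u X (ev n i)|) ^ 2 := by gcongr
    _ ≤ (Finset.univ.card (α := Option (Fin (n - 1)))) * ∑ i, |fderiv ℝ u X (ev n i)| ^ 2 := sq_sum_le_card_mul_sum_sq
    _ = _ := by
      simp only [sq_abs]
      congr 1
      simp
      exact_mod_cast Nat.sub_add_cancel (by omega : 1 ≤ n)

def KK {n : ℕ} (p : EE n) (t : ℝ) : Set (Pt n) := Metric.closedBall p (t / 2) ×ˢ Icc (t / 2) (5 * t / 4)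

theorem KK_vol {n : ℕ} (hn : 2 ≤ n) (p : EE n) {t : ℝ} (ht : 0 < t) : volume (KK p t) ≤ ENNReal.ofReal (kap0 n * t ^ n) := by
  have := kap0_pos n
  unfold KK
  rw [Measure.volume_eq_prod, Measure.prod_prod, vol_cb p (by positivity), Real.volume_Icc, ← ENNReal.ofReal_mul (by positivity)]
  refine ENNReal.ofReal_le_ofReal ?_
  have e : t ^ n = t ^ (n - 1) * t := by rw [← pow_succ, Nat.sub_add_cancel (by omega)]
  rw [e, mul_assoc]
  gcongr <;> linarith

theorem KK_cpt {n : ℕ} (p : EE n) (t : ℝ) : IsCompact (KK p t) := (isCompact_closedBall p _).prod isCompact_Icc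

theorem vol_haar (n : ℕ) : (volume : Measure (Pt n)).IsAddHaarMeasure :=
  Measure.prod.instIsAddHaarMeasure (volume : Measure (EE n)) (volume : Measure ℝ)

theorem mean_part {n : ℕ} (hn : 2 ≤ n) (A0 : ℝ) (hA0 : 0 ≤ A0) : ∃ C : ℝ, 0 < C ∧ ∀ (p p' : EE n) (t g : ℝ) (u : Pt n → ℝ),
    0 < t → 0 < g → dist p' p ≤ t / 4 → (∀ X ∈ UHS n, DifferentiableAt ℝ u X) →
    |∫ X, u X * wt p' t X| ≤ A0 * g * t ^ (n - 1) →
    ∫⁻ X in KK p t, ENNReal.ofReal (t ^ 2 * gradSq u X) ≤ ENNReal.ofReal (A0 * g ^ 2 * t ^ n) →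
    ∫⁻ X in KK p t, ENNReal.ofReal (u X ^ 2) ≤ ENNReal.ofReal (C * g ^ 2 * t ^ n) := by
  haveI := vol_haar n
  obtain ⟨C0, hC0, hC⟩ := ST_bound
  have hk := kap0_pos n
  set V := kap0 n with hV
  refine ⟨(2 * (4 * C0) ^ 2 * V * (2 ^ n * V * (n * A0)) + 2 * A0 ^ 2 * V + 1) / (V / 8 ^ (n - 1)) ^ 2, by positivity, ?_⟩
  intro p p' t g u ht hg hpp hd hA hG
  have hKU : ∀ X ∈ KK p t, X ∈ UHS n := fun X hX => lt_of_lt_of_le (by positivity : 0 < t / 2) hX.2.1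
  have hvol := KK_vol hn p ht
  have hP := poincare (μ := (volume : Measure (Pt n))) u (KK p t) ((convex_closedBall p _).prod (convex_Icc _ _)) (KK_cpt p t).measurableSet
    (KK_cpt p t).measure_ne_top t (by
      intro Y hY Z hZ
      rw [Prod.norm_def]
      refine max_le ?_ ?_
      · have h1 := Metric.mem_closedBall.1 hY.1
        have h2 := Metric.mem_closedBall.1 hZ.1
        have h3 := dist_triangle_right Y.1 Z.1 p
        rw [Prod.fst_sub, ← dist_eq_norm]; linarith
      · rw [Prod.snd_sub, Real.norm_eq_abs, abs_le]
        have h1 := hY.2; have h2 := hZ.2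
        constructor <;> linarith [h1.1, h1.2, h2.1, h2.2]) (fun Y hY => hd Y (hKU Y hY))
  have hM := mean_est (μ := (volume : Measure (Pt n))) u (wt p' t) (KK p t) (KK_cpt p t)
    (fun Y hY => (hd Y (hKU Y hY)).continuousAt.continuousWithinAt) (wt_cont p' t) (wt_nonneg p' ht) (by
      intro X hX
      refine wt_zero p' ht X fun h => hX ⟨?_, ?_, ?_⟩
      · have h1 := Metric.mem_closedBall.1 h.1
        have h3 := dist_triangle X.1 p' p
        rw [Metric.mem_closedBall]; linarith
      · exact h.2.1
      · have := h.2.2; linarith) (4 * C0 / t) (A0 * g * t ^ (n - 1)) (wt_le hC p' ht) hA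
  have hG2 : ∫⁻ X in KK p t, ENNReal.ofReal ((t * ‖fderiv ℝ u X‖) ^ 2) ≤ ENNReal.ofReal (n * (A0 * g ^ 2 * t ^ n)) := by
    rw [ENNReal.ofReal_mul (by positivity)]
    refine le_trans ?_ (mul_le_mul_right hG _)
    rw [← lintegral_const_mul' _ _ ENNReal.ofReal_ne_top]
    refine lintegral_mono fun X => ?_
    rw [← ENNReal.ofReal_mul (by positivity)]
    refine ENNReal.ofReal_le_ofReal ?_
    have := nrm_sq hn u X
    nlinarith [sq_nonneg t]
  rw [finrank_Pt hn] at hP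
  have e : t ^ n = t ^ (n - 1) * t := by rw [← pow_succ, Nat.sub_add_cancel (by omega)]
  have hP2 : ∫⁻ Y in KK p t, ∫⁻ Z in KK p t, ENNReal.ofReal ((u Y - u Z) ^ 2) ≤ ENNReal.ofReal (2 ^ n * (V * t ^ n) * (n * (A0 * g ^ 2 * t ^ n))) := by
    refine hP.trans ?_
    rw [ENNReal.ofReal_mul (by positivity), ENNReal.ofReal_mul (by positivity)]
    gcongr
  have hM2 : ENNReal.ofReal ((∫ X, wt p' t X) ^ 2) * ∫⁻ Y in KK p t, ENNReal.ofReal (u Y ^ 2) ≤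
      ENNReal.ofReal (2 * (4 * C0 / t) ^ 2 * (V * t ^ n) * (2 ^ n * (V * t ^ n) * (n * (A0 * g ^ 2 * t ^ n))) + 2 * (A0 * g * t ^ (n - 1)) ^ 2 * (V * t ^ n)) := by
    refine hM.trans ?_
    rw [ENNReal.ofReal_add (by positivity) (by positivity), ENNReal.ofReal_mul (p := 2 * (4 * C0 / t) ^ 2 * (V * t ^ n)) (by positivity),
      ENNReal.ofReal_mul (p := 2 * (4 * C0 / t) ^ 2) (by positivity), ENNReal.ofReal_mul (p := 2) (by positivity),
      ENNReal.ofReal_mul (p := 2 * (A0 * g * t ^ (n - 1)) ^ 2) (by positivity), ENNReal.ofReal_mul (p := 2) (by positivity)]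
    simp only [ENNReal.ofReal_ofNat]
    gcongr
  have hI := int_wt p' ht
  have hI2 : (V * (t / 8) ^ (n - 1)) ^ 2 ≤ (∫ X, wt p' t X) ^ 2 := by gcongr
  have hI3 := (mul_le_mul_left (ENNReal.ofReal_le_ofReal hI2) (∫⁻ Y in KK p t, ENNReal.ofReal (u Y ^ 2))).trans hM2
  have hpos : 0 < (V * (t / 8) ^ (n - 1)) ^ 2 := by positivity
  rw [mul_comm, ← ENNReal.le_div_iff_mul_le (Or.inl (ENNReal.ofReal_pos.2 hpos).ne') (Or.inl ENNReal.ofReal_ne_top),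
    ← ENNReal.ofReal_div_of_pos hpos] at hI3
  refine hI3.trans (ENNReal.ofReal_le_ofReal ?_)
  rw [e]
  rw [div_le_iff₀ hpos]
  have e2 : (V * (t / 8) ^ (n - 1)) ^ 2 = (V / 8 ^ (n - 1)) ^ 2 * (t ^ (n - 1)) ^ 2 := by
    rw [div_pow]; ring
  rw [e2]
  have e3 : ∀ (Z T : ℝ), Z / (V / 8 ^ (n - 1)) ^ 2 * g ^ 2 * T * ((V / 8 ^ (n - 1)) ^ 2 * (t ^ (n - 1)) ^ 2) = Z * g ^ 2 * T * (t ^ (n - 1)) ^ 2 := by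
    intro Z T; field_simp
  rw [e3]
  have e4 : 2 * (4 * C0 / t) ^ 2 * (V * (t ^ (n - 1) * t)) * (2 ^ n * (V * (t ^ (n - 1) * t)) * (n * (A0 * g ^ 2 * (t ^ (n - 1) * t)))) =
    2 * (4 * C0) ^ 2 * V * (2 ^ n * V * (n * A0)) * g ^ 2 * (t ^ (n - 1) * t) * (t ^ (n - 1)) ^ 2 := by
    field_simp
  rw [e4]
  have e5 : 0 ≤ g ^ 2 * (t ^ (n - 1) * t) * (t ^ (n - 1)) ^ 2 := by positivity
  linarith

theorem B_abs {n : ℕ} {B : Pt n → Fin (n - 1) → Fin (n - 1) → ℝ} {lam Lam : ℝ} (hE : EllipticOn (UHS n) B lam Lam)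
    (X : Pt n) (hX : X ∈ UHS n) (i j : Fin (n - 1)) : |B X i j| ≤ Lam := by
  have h := (hE X hX).2 (Pi.single j 1) (Pi.single i 1)
  simpa [Pi.single_apply] using h

theorem dB_sq {n : ℕ} {B : Pt n → Fin (n - 1) → Fin (n - 1) → ℝ} {M : ℝ} (h : ∀ X ∈ UHS n, (X.2 * gradxA B X) ^ 2 ≤ M)
    (X : Pt n) (hX : X ∈ UHS n) (m i j : Fin (n - 1)) : (X.2 * pdx m (fun Z => B Z i j) X) ^ 2 ≤ M := by
  refine le_trans ?_ (h X hX)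
  unfold gradxA
  rw [mul_pow, mul_pow, Real.sq_sqrt]
  · refine mul_le_mul_of_nonneg_left ?_ (sq_nonneg _)
    have h0 : ∀ p q, 0 ≤ gradxSq (fun Y => B Y p q) X := fun p q => Finset.sum_nonneg fun _ _ => sq_nonneg _
    refine le_trans ?_ (Finset.single_le_sum (f := fun p => ∑ q, gradxSq (fun Y => B Y p q) X) (fun p _ => Finset.sum_nonneg fun q _ => h0 p q) (Finset.mem_univ i))
    refine le_trans ?_ (Finset.single_le_sum (f := fun q => gradxSq (fun Y => B Y i q) X) (fun q _ => h0 i q) (Finset.mem_univ j))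
    exact Finset.single_le_sum (f := fun k => pdx k (fun Y => B Y i j) X ^ 2) (fun k _ => sq_nonneg _) (Finset.mem_univ m)
  · exact Finset.sum_nonneg fun p _ => Finset.sum_nonneg fun q _ => Finset.sum_nonneg fun _ _ => sq_nonneg _

theorem B_cont {n : ℕ} {B : Pt n → Fin (n - 1) → Fin (n - 1) → ℝ} (h : LocallyLipschitz B) (i j : Fin (n - 1)) :
    Continuous fun X => B X i j := by
  have := h.continuous
  fun_prop

theorem gradSq_nonneg {n : ℕ} (u : Pt n → ℝ) (X : Pt n) : 0 ≤ gradSq u X := Finset.sum_nonneg fun _ _ => sq_nonneg _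

theorem ev_sq_le {n : ℕ} (hn : 2 ≤ n) (u : Pt n → ℝ) (X : Pt n) (i) : fderiv ℝ u X (ev n i) ^ 2 ≤ gradSq u X := by
  rw [gradSq_eq hn]
  exact Finset.single_le_sum (f := fun i => fderiv ℝ u X (ev n i) ^ 2) (fun _ _ => sq_nonneg _) (Finset.mem_univ i)

theorem pdx_ev {n : ℕ} (u : Pt n → ℝ) (X : Pt n) (i) : pdx i u X = fderiv ℝ u X (ev n (some i)) := rfl
theorem pdt_ev {n : ℕ} (u : Pt n → ℝ) (X : Pt n) : pdt u X = fderiv ℝ u X (ev n none) := rfl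

theorem gradSq_meas {n : ℕ} (u : Pt n → ℝ) : Measurable (gradSq u) := by
  unfold gradSq pd
  exact Finset.measurable_fun_sum _ fun i _ => (measurable_fderiv_apply_const ℝ u _).pow_const 2

theorem ev_memLp {n : ℕ} (hn : 2 ≤ n) {u : Pt n → ℝ} (h : FiniteEnergy u) (i) :
    MemLp (fun X => fderiv ℝ u X (ev n i)) 2 (volume.restrict (UHS n)) := by
  have hm : Measurable (fun X => fderiv ℝ u X (ev n i)) := measurable_fderiv_apply_const ℝ u _
  rw [memLp_two_iff_integrable_sq hm.aestronglyMeasurable]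
  refine ⟨(hm.pow_const 2).aestronglyMeasurable, ?_⟩
  rw [hasFiniteIntegral_iff_ofReal (Eventually.of_forall fun X => sq_nonneg _)]
  exact lt_of_le_of_lt (lintegral_mono fun X => ENNReal.ofReal_le_ofReal (ev_sq_le hn u X i)) h

theorem yg {s t g D G : ℝ} (hs : 0 < s) (hst : s < t) (hg : 0 < g) (hD : D ^ 2 ≤ G) : s / t * |D| ≤ s * G / g + g / t := by
  have ht : 0 < t := hs.trans hst
  have h1 : s * D ^ 2 / g ≤ s * G / g := by gcongr
  refine le_trans ?_ (add_le_add_left h1 _)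
  rw [← sq_abs]
  set y := |D|
  have hy : 0 ≤ y := abs_nonneg D
  have : s * y ^ 2 / g + g / t - s / t * y = (s * (y * t) ^ 2 + g ^ 2 * t - s * (y * t) * g) / (g * t ^ 2) := by
    field_simp
  have h2 : 0 ≤ (s * (y * t) ^ 2 + g ^ 2 * t - s * (y * t) * g) / (g * t ^ 2) := by
    refine div_nonneg ?_ (by positivity)
    nlinarith [mul_nonneg hs.le (sq_nonneg (y * t - g / 2)), mul_pos (pow_pos hg 2) (sub_pos.2 hst), mul_nonneg hs.le (sq_nonneg (y*t)), mul_nonneg hs.le (sq_nonneg g), mul_nonneg hs.le (sq_nonneg (y*t - g))]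
  linarith

theorem yv {q w M V g : ℝ} (hg : 0 < g) (hM : q ^ 2 ≤ M) (hV : w ^ 2 ≤ V) : |q| * |w| ≤ g / 2 + M * V / (2 * g) := by
  have h1 : q ^ 2 * w ^ 2 ≤ M * V := mul_le_mul hM hV (sq_nonneg _) ((sq_nonneg _).trans hM)
  have h2 : q ^ 2 * w ^ 2 / (2 * g) ≤ M * V / (2 * g) := by gcongr
  refine le_trans ?_ (add_le_add_right h2 _)
  rw [← sq_abs q, ← sq_abs w]
  have : g / 2 + |q| ^ 2 * |w| ^ 2 / (2 * g) - |q| * |w| = (|q| * |w| - g) ^ 2 / (2 * g) := by field_simp; ring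
  have h3 : 0 ≤ (|q| * |w| - g) ^ 2 / (2 * g) := by positivity
  linarith

theorem SB_vol {n : ℕ} (hn : 2 ≤ n) (p : EE n) {t : ℝ} (ht : 0 < t) : volume (SB p t) ≤ ENNReal.ofReal (kap0 n * t ^ n) := by
  have := kap0_pos n
  unfold SB
  rw [Measure.volume_eq_prod, Measure.prod_prod, vol_cb p (by positivity), Real.volume_Ioo, ← ENNReal.ofReal_mul (by positivity)]
  refine ENNReal.ofReal_le_ofReal ?_
  have e : t ^ n = t ^ (n - 1) * t := by rw [← pow_succ, Nat.sub_add_cancel (by omega)]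
  rw [e, mul_assoc]
  gcongr <;> linarith

/-- the majorant -/
theorem H_bound {n : ℕ} (hn : 2 ≤ n) (C1 : ℝ) (hC1 : 0 ≤ C1) (p : EE n) {t g : ℝ} (ht : 0 < t) (hg : 0 < g) (G V W : Pt n → ℝ)
    (hG0 : ∀ X, 0 ≤ G X) (hV0 : ∀ X, 0 ≤ V X) (hW0 : ∀ X, 0 ≤ W X) (hGm : Measurable G)
    (hVm : AEMeasurable V (volume.restrict (SB p t))) 
    (hG : ∫⁻ X in SB p t, ENNReal.ofReal (X.2 * G X) ≤ ENNReal.ofReal (C1 * g ^ 2 * t ^ (n - 1)))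
    (hV : ∫⁻ X in SB p t, ENNReal.ofReal (V X) ≤ ENNReal.ofReal (C1 * g ^ 2 * t ^ n))
    (hW : ∫⁻ X in SB p t, ENNReal.ofReal (W X) ≤ ENNReal.ofReal (C1 * g ^ 2 * t ^ n)) :
    ∫⁻ X in SB p t, ENNReal.ofReal (X.2 * G X / g + g / t + V X / (g * t) + W X / (g * t)) ≤
      ENNReal.ofReal ((3 * C1 + kap0 n) * g * t ^ (n - 1)) := by
  have hk := kap0_pos n
  have e : t ^ n = t ^ (n - 1) * t := by rw [← pow_succ, Nat.sub_add_cancel (by omega)]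
  have hSm : MeasurableSet (SB p t) := measurableSet_closedBall.prod measurableSet_Ioo
  calc _ ≤ ∫⁻ X in SB p t, ((ENNReal.ofReal (1 / g) * ENNReal.ofReal (X.2 * G X) + ENNReal.ofReal (g / t)) + ENNReal.ofReal (1 / (g * t)) * ENNReal.ofReal (V X)) + ENNReal.ofReal (1 / (g * t)) * ENNReal.ofReal (W X) := by
        refine setLIntegral_mono' hSm fun X hX => ?_
        have hX2 : 0 < X.2 := hX.2.1
        have := hG0 X; have := hV0 X; have := hW0 X
        rw [← ENNReal.ofReal_mul (by positivity), ← ENNReal.ofReal_mul (by positivity), ← ENNReal.ofReal_mul (by positivity),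
          ← ENNReal.ofReal_add (by positivity) (by positivity), ← ENNReal.ofReal_add (by positivity) (by positivity), ← ENNReal.ofReal_add (by positivity) (by positivity)]
        refine ENNReal.ofReal_le_ofReal (le_of_eq ?_)
        ring
    _ = ENNReal.ofReal (1 / g) * (∫⁻ X in SB p t, ENNReal.ofReal (X.2 * G X)) + ENNReal.ofReal (g / t) * volume (SB p t)
        + ENNReal.ofReal (1 / (g * t)) * (∫⁻ X in SB p t, ENNReal.ofReal (V X)) + ENNReal.ofReal (1 / (g * t)) * ∫⁻ X in SB p t, ENNReal.ofReal (W X) := by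
        have m1 : Measurable fun X : Pt n => ENNReal.ofReal (1 / g) * ENNReal.ofReal (X.2 * G X) := ((measurable_snd.mul hGm).ennreal_ofReal).const_mul _
        have m2 : AEMeasurable (fun X : Pt n => ENNReal.ofReal (1 / (g * t)) * ENNReal.ofReal (V X)) (volume.restrict (SB p t)) := hVm.ennreal_ofReal.const_mul _
        have m3 : AEMeasurable (fun X : Pt n => ENNReal.ofReal (1 / g) * ENNReal.ofReal (X.2 * G X) + ENNReal.ofReal (g / t) +
          ENNReal.ofReal (1 / (g * t)) * ENNReal.ofReal (V X)) (volume.restrict (SB p t)) := (m1.add_const _).aemeasurable.add m2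
        rw [lintegral_add_left' m3, lintegral_add_left (m1.add_const _), lintegral_add_left m1,
          lintegral_const_mul' _ _ ENNReal.ofReal_ne_top, lintegral_const_mul' _ _ ENNReal.ofReal_ne_top, lintegral_const_mul' _ _ ENNReal.ofReal_ne_top,
          lintegral_const, Measure.restrict_apply_univ]
    _ ≤ ENNReal.ofReal (1 / g) * ENNReal.ofReal (C1 * g ^ 2 * t ^ (n - 1)) + ENNReal.ofReal (g / t) * ENNReal.ofReal (kap0 n * t ^ n)
        + ENNReal.ofReal (1 / (g * t)) * ENNReal.ofReal (C1 * g ^ 2 * t ^ n) + ENNReal.ofReal (1 / (g * t)) * ENNReal.ofReal (C1 * g ^ 2 * t ^ n) := by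
        gcongr
        exact SB_vol hn p ht
    _ = _ := by
        rw [← ENNReal.ofReal_mul (by positivity), ← ENNReal.ofReal_mul (by positivity), ← ENNReal.ofReal_mul (by positivity),
          ← ENNReal.ofReal_add (by positivity) (by positivity), ← ENNReal.ofReal_add (by positivity) (by positivity), ← ENNReal.ofReal_add (by positivity) (by positivity)]
        congr 1
        rw [e]; field_simp; ring

theorem M_nonneg {n : ℕ} {B : Pt n → Fin (n - 1) → Fin (n - 1) → ℝ} {M : ℝ} (h : ∀ X ∈ UHS n, (X.2 * gradxA B X) ^ 2 ≤ M) : 0 ≤ M :=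
  (sq_nonneg _).trans (h (0, 1) (by simp [UHS]))

set_option maxHeartbeats 1000000 in
theorem flat_part {n : ℕ} (hn : 2 ≤ n) (lam Lam : ℝ) (hL : 0 ≤ Lam) (C1 : ℝ) (hC1 : 0 ≤ C1) : ∃ A : ℝ, 0 ≤ A ∧
    ∀ (B : Pt n → Fin (n - 1) → Fin (n - 1) → ℝ) (M : ℝ) (f : EE n → ℝ) (v η : Fin (n - 1) → Pt n → ℝ),
    EllipticOn (UHS n) B lam Lam → WCSetup B M f v η → ∀ (p : EE n) (t g : ℝ), 0 < t → 0 < g →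
    (∫⁻ X in SB p t, ENNReal.ofReal (X.2 * ∑ m, gradSq (η m) X) ≤ ENNReal.ofReal (C1 * g ^ 2 * t ^ (n - 1))) →
    (∫⁻ X in SB p t, ENNReal.ofReal (M * ∑ j, v j X ^ 2) ≤ ENNReal.ofReal (C1 * g ^ 2 * t ^ n)) →
    (∫⁻ X in SB p t, ENNReal.ofReal (M * ∑ j, η j X ^ 2) ≤ ENNReal.ofReal (C1 * g ^ 2 * t ^ n)) →
    ∀ m, |∫ X, η m X * wt p t X| ≤ A * g * t ^ (n - 1) := by
  obtain ⟨C0, hC0, hC⟩ := ST_bound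
  have hk := kap0_pos n
  set N : ℝ := ((n - 1 : ℕ) : ℝ) with hN
  have hN0 : 0 ≤ N := Nat.cast_nonneg _
  set c := N ^ 2 * Lam + N ^ 2 + 1 with hc
  have hc0 : 0 ≤ c := by positivity
  refine ⟨16 * C0 * (3 * (c * (3 * C1 + kap0 n))), by positivity, ?_⟩
  intro B M f v η hE hW p t g ht hg hG hV hH m
  obtain ⟨hBl, -, hBM, -, -, hv, hη⟩ := hW
  have hM := M_nonneg hBM
  have hSm : MeasurableSet (SB p t) := measurableSet_closedBall.prod measurableSet_Ioo
  have hSU : SB p t ⊆ UHS n := fun X hX => hX.2.1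
  have hSf : volume (SB p t) ≠ ⊤ := ne_top_of_le_ne_top ENNReal.ofReal_ne_top (SB_vol hn p ht)
  haveI : IsFiniteMeasure (volume.restrict (SB p t)) := ⟨by rw [Measure.restrict_apply_univ]; exact lt_top_iff_ne_top.2 hSf⟩
  have hintg : ∀ i, IntegrableOn (fun X => fderiv ℝ (η m) X (ev n i)) (SB p t) := fun i =>
    ((ev_memLp hn (hη m).2.1 i).mono_measure (Measure.restrict_mono hSU le_rfl)).integrable (by norm_num)
  set H : Pt n → ℝ := fun X => X.2 * (∑ m, gradSq (η m) X) / g + g / t + (M * ∑ j, v j X ^ 2) / (g * t) + (M * ∑ j, η j X ^ 2) / (g * t) with hHdef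
  have hHb : ∫⁻ X in SB p t, ENNReal.ofReal (H X) ≤ ENNReal.ofReal ((3 * C1 + kap0 n) * g * t ^ (n - 1)) := by
    refine H_bound hn C1 hC1 p ht hg _ _ _ (fun X => Finset.sum_nonneg fun m _ => gradSq_nonneg _ _)
      (fun X => mul_nonneg hM (Finset.sum_nonneg fun _ _ => sq_nonneg _)) (fun X => mul_nonneg hM (Finset.sum_nonneg fun _ _ => sq_nonneg _))
      (Finset.measurable_fun_sum _ fun m _ => gradSq_meas _) ?_ hG hV hH
    have : ContinuousOn (fun X => M * ∑ j, v j X ^ 2) (SB p t) := by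
      refine continuousOn_const.mul (continuousOn_finsetSum _ fun j _ => ContinuousOn.pow ?_ 2)
      exact fun X hX => ((hv j).1.1 X (hSU hX)).continuousAt.continuousWithinAt
    exact this.aemeasurable hSm
  have hHc : ∀ T : Pt n → ℝ, (∀ X ∈ SB p t, T X ≤ c * H X) → ∫⁻ X in SB p t, ENNReal.ofReal (T X) ≤ ENNReal.ofReal (c * (3 * C1 + kap0 n) * g * t ^ (n - 1)) := by
    intro T hT
    have e : c * (3 * C1 + kap0 n) * g * t ^ (n - 1) = c * ((3 * C1 + kap0 n) * g * t ^ (n - 1)) := by ring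
    rw [e, ENNReal.ofReal_mul hc0]
    refine le_trans ?_ (mul_le_mul_right hHb _)
    rw [← lintegral_const_mul' _ _ ENNReal.ofReal_ne_top]
    refine setLIntegral_mono' hSm fun X hX => ?_
    rw [← ENNReal.ofReal_mul hc0]
    exact ENNReal.ofReal_le_ofReal (hT X hX)
  have hgs : ∀ X i, fderiv ℝ (η m) X (ev n i) ^ 2 ≤ ∑ m, gradSq (η m) X := fun X i => (ev_sq_le hn _ X i).trans
    (Finset.single_le_sum (f := fun m => gradSq (η m) X) (fun m _ => gradSq_nonneg _ _) (Finset.mem_univ m))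
  have hvs : ∀ X j, v j X ^ 2 ≤ ∑ j, v j X ^ 2 := fun X j => Finset.single_le_sum (f := fun j => v j X ^ 2) (fun m _ => sq_nonneg _) (Finset.mem_univ j)
  have hes : ∀ X j, η j X ^ 2 ≤ ∑ j, η j X ^ 2 := fun X j => Finset.single_le_sum (f := fun j => η j X ^ 2) (fun m _ => sq_nonneg _) (Finset.mem_univ j)
  have hp1 : ∀ X ∈ SB p t, 0 ≤ (M * ∑ j, v j X ^ 2) / (g * t) := fun X hX => by
    have := (sq_nonneg (v ⟨0, by omega⟩ X)).trans (hvs X ⟨0, by omega⟩)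
    positivity
  have hp2 : ∀ X ∈ SB p t, 0 ≤ (M * ∑ j, η j X ^ 2) / (g * t) := fun X hX => by
    have := (sq_nonneg (η ⟨0, by omega⟩ X)).trans (hes X ⟨0, by omega⟩)
    positivity
  have hp3 : ∀ X ∈ SB p t, 0 ≤ X.2 * (∑ m, gradSq (η m) X) / g := fun X hX => by
    have := (sq_nonneg _).trans (hgs X none)
    have := hSU hX
    have : 0 < X.2 := this
    positivity
  have hH1 : ∀ X ∈ SB p t, ∀ i, X.2 / t * |fderiv ℝ (η m) X (ev n i)| ≤ H X := by
    intro X hX i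
    have := yg hX.2.1 hX.2.2 hg (hgs X i)
    have := hp1 X hX; have := hp2 X hX
    simp only [hHdef]; linarith
  have hH2 : ∀ X ∈ SB p t, ∀ i j, X.2 / t * |pdx m (fun Z => B Z i j) X * (v j X + η j X)| ≤ H X := by
    intro X hX i j
    have hX2 : 0 < X.2 := hX.2.1
    have h1 := yv hg (dB_sq hBM X (hSU hX) m i j) (hvs X j)
    have h2 := yv hg (dB_sq hBM X (hSU hX) m i j) (hes X j)
    have h3 : X.2 / t * |pdx m (fun Z => B Z i j) X * (v j X + η j X)| ≤ (|X.2 * pdx m (fun Z => B Z i j) X| * |v j X| + |X.2 * pdx m (fun Z => B Z i j) X| * |η j X|) / t := by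
      rw [abs_mul, abs_mul X.2, abs_of_pos hX2, ← mul_add, div_mul_eq_mul_div, ← mul_assoc]
      gcongr
      exact abs_add_le _ _
    refine h3.trans ?_
    have h4 : (|X.2 * pdx m (fun Z => B Z i j) X| * |v j X| + |X.2 * pdx m (fun Z => B Z i j) X| * |η j X|) / t ≤
      ((g / 2 + (M * ∑ j, v j X ^ 2) / (2 * g)) + (g / 2 + (M * ∑ j, η j X ^ 2) / (2 * g))) / t := by gcongr
    refine h4.trans ?_
    have h5 : ((g / 2 + (M * ∑ j, v j X ^ 2) / (2 * g)) + (g / 2 + (M * ∑ j, η j X ^ 2) / (2 * g))) / t =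
      g / t + (1 / 2) * ((M * ∑ j, v j X ^ 2) / (g * t)) + (1 / 2) * ((M * ∑ j, η j X ^ 2) / (g * t)) := by
      field_simp; ring
    rw [h5]
    have := hp1 X hX; have := hp2 X hX; have := hp3 X hX
    simp only [hHdef]
    linarith
  have hH0 : ∀ X ∈ SB p t, 0 ≤ H X := fun X hX => by
    refine le_trans ?_ (hH1 X hX none)
    have : 0 < X.2 := hX.2.1
    positivity
  have hN2 : ∀ K : ℝ, ∑ _i : Fin (n - 1), ∑ _j : Fin (n - 1), K = N ^ 2 * K := by
    intro K; simp [hN]; ring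
  have key := flat_est hC p ht (η m) (hη m).1 (hη m).2.2.1 (hintg none) (fun i X => ∑ j, B X i j * pdx j (η m) X)
    (fun i X => ∑ j, pdx m (fun Z => B Z i j) X * (v j X + η j X)) ?_ ?_ (c * (3 * C1 + kap0 n) * g * t ^ (n - 1)) (c * (3 * C1 + kap0 n) * g * t ^ (n - 1)) (c * (3 * C1 + kap0 n) * g * t ^ (n - 1))
    (by positivity) (by positivity) (by positivity) ?_ ?_ ?_
  · refine key.trans (le_of_eq ?_); ring
  · intro i
    refine integrable_finsetSum _ fun j _ => ?_
    refine Integrable.mono ((hintg (some j)).const_mul Lam) (((B_cont hBl i j).aestronglyMeasurable).mul (pdx_meas j _).aestronglyMeasurable) ?_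
    refine (ae_restrict_iff' hSm).2 (Eventually.of_forall fun X hX => ?_)
    rw [norm_mul, norm_mul, Real.norm_of_nonneg hL]
    exact mul_le_mul_of_nonneg_right (B_abs hE X (hSU hX) i j) (norm_nonneg _)
  · intro ϕ hϕ
    have := (hη m).2.2.2 ϕ hϕ
    simp only [Finset.sum_mul]
    exact this
  · refine hHc _ fun X hX => ?_
    have hX2 : 0 < X.2 := hX.2.1
    have hh := hH0 X hX
    calc X.2 / t * ∑ i, |∑ j, B X i j * pdx j (η m) X| ≤ ∑ i : Fin (n - 1), ∑ j : Fin (n - 1), Lam * H X := by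
          rw [Finset.mul_sum]
          refine Finset.sum_le_sum fun i _ => ?_
          refine (mul_le_mul_of_nonneg_left (Finset.abs_sum_le_sum_abs _ _) (by positivity)).trans ?_
          rw [Finset.mul_sum]
          refine Finset.sum_le_sum fun j _ => ?_
          have h1 := B_abs hE X (hSU hX) i j
          have h2 := hH1 X hX (some j)
          rw [abs_mul]
          calc _ = |B X i j| * (X.2 / t * |pdx j (η m) X|) := by ring
            _ ≤ _ := mul_le_mul h1 h2 (by positivity) hL
      _ = N ^ 2 * (Lam * H X) := hN2 _
      _ ≤ _ := by rw [hc]; nlinarith [mul_nonneg (sq_nonneg N) hh]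
  · refine hHc _ fun X hX => ?_
    have hX2 : 0 < X.2 := hX.2.1
    have hh := hH0 X hX
    calc X.2 / t * ∑ i, |∑ j, pdx m (fun Z => B Z i j) X * (v j X + η j X)| ≤ ∑ i : Fin (n - 1), ∑ j : Fin (n - 1), H X := by
          rw [Finset.mul_sum]
          refine Finset.sum_le_sum fun i _ => ?_
          refine (mul_le_mul_of_nonneg_left (Finset.abs_sum_le_sum_abs _ _) (by positivity)).trans ?_
          rw [Finset.mul_sum]
          exact Finset.sum_le_sum fun j _ => hH2 X hX i j
      _ = N ^ 2 * H X := hN2 _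
      _ ≤ _ := by rw [hc]; nlinarith [mul_nonneg (mul_nonneg (sq_nonneg N) hL) hh]
  · refine hHc _ fun X hX => ?_
    have hh := hH0 X hX
    refine (hH1 X hX none).trans ?_
    rw [hc]; nlinarith [mul_nonneg (mul_nonneg (sq_nonneg N) hL) hh, mul_nonneg (sq_nonneg N) hh]

def AO {n : ℕ} (B : Pt n → Fin (n - 1) → Fin (n - 1) → ℝ) (X : Pt n) : Option (Fin (n - 1)) → Option (Fin (n - 1)) → ℝ
  | some i, some j => B X i j
  | none, none => 1
  | some _, none => 0
  | none, some _ => 0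

def FO {n : ℕ} (B : Pt n → Fin (n - 1) → Fin (n - 1) → ℝ) (v η : Fin (n - 1) → Pt n → ℝ) (m : Fin (n - 1)) (X : Pt n) :
    Option (Fin (n - 1)) → ℝ
  | some i => ∑ j, pdx m (fun Z => B Z i j) X * (v j X + η j X)
  | none => 0

theorem AO_ell {n : ℕ} {B : Pt n → Fin (n - 1) → Fin (n - 1) → ℝ} {lam Lam : ℝ} (hE : EllipticOn (UHS n) B lam Lam)
    (X : Pt n) (hX : X ∈ UHS n) (ξ : Option (Fin (n - 1)) → ℝ) :
    min lam 1 * ∑ i, ξ i ^ 2 ≤ ∑ i, ∑ j, AO B X i j * ξ j * ξ i := by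
  simp only [Fintype.sum_option, AO, zero_mul, one_mul, Finset.sum_const_zero, add_zero, zero_add]
  have h := (hE X hX).1 (fun i => ξ (some i))
  have h0 : 0 ≤ ∑ i, ξ (some i) ^ 2 := Finset.sum_nonneg fun _ _ => sq_nonneg _
  nlinarith [min_le_left lam 1, min_le_right lam 1, sq_nonneg (ξ none), mul_le_mul_of_nonneg_right (min_le_left lam 1) h0,
    mul_le_mul_of_nonneg_right (min_le_right lam 1) (sq_nonneg (ξ none))]

theorem AO_bd {n : ℕ} {B : Pt n → Fin (n - 1) → Fin (n - 1) → ℝ} {lam Lam : ℝ} (hL : 0 ≤ Lam) (hE : EllipticOn (UHS n) B lam Lam)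
    (X : Pt n) (hX : X ∈ UHS n) (ξ η : Option (Fin (n - 1)) → ℝ) :
    (∑ i, ∑ j, AO B X i j * ξ j * η i) ^ 2 ≤ (Lam + 1) ^ 2 * (∑ i, ξ i ^ 2) * ∑ i, η i ^ 2 := by
  simp only [Fintype.sum_option, AO, zero_mul, one_mul, Finset.sum_const_zero, add_zero, zero_add]
  have h := (hE X hX).2 (fun i => ξ (some i)) (fun i => η (some i))
  set S := ∑ i, ∑ j, B X i j * ξ (some j) * η (some i)
  have h0 : 0 ≤ ∑ i, ξ (some i) ^ 2 := Finset.sum_nonneg fun _ _ => sq_nonneg _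
  have h1 : 0 ≤ ∑ i, η (some i) ^ 2 := Finset.sum_nonneg fun _ _ => sq_nonneg _
  set a := ∑ i, ξ (some i) ^ 2
  set b := ∑ i, η (some i) ^ 2
  have e1 : √a * √b ≤ √(ξ none ^ 2 + a) * √(η none ^ 2 + b) := by
    gcongr <;> linarith [sq_nonneg (ξ none), sq_nonneg (η none)]
  have e2 : |ξ none * η none| ≤ √(ξ none ^ 2 + a) * √(η none ^ 2 + b) := by
    rw [abs_mul, ← Real.sqrt_sq_eq_abs, ← Real.sqrt_sq_eq_abs]
    gcongr <;> linarith
  have e3 : |ξ none * η none + S| ≤ (Lam + 1) * (√(ξ none ^ 2 + a) * √(η none ^ 2 + b)) := by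
    refine (abs_add_le _ _).trans ?_
    nlinarith [mul_le_mul_of_nonneg_left e1 hL]
  have e4 := pow_le_pow_left₀ (abs_nonneg _) e3 2
  rw [sq_abs, mul_pow, mul_pow, Real.sq_sqrt (by positivity), Real.sq_sqrt (by positivity)] at e4
  linarith

theorem AO_abs {n : ℕ} {B : Pt n → Fin (n - 1) → Fin (n - 1) → ℝ} {lam Lam : ℝ} (hL : 0 ≤ Lam) (hE : EllipticOn (UHS n) B lam Lam)
    (X : Pt n) (hX : X ∈ UHS n) (i j) : |AO B X i j| ≤ Lam + 1 := by
  cases i <;> cases j <;> simp only [AO, abs_zero, abs_one]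
  · linarith
  · linarith
  · linarith
  · rename_i i j
    linarith [B_abs hE X hX i j]

theorem AO_meas {n : ℕ} {B : Pt n → Fin (n - 1) → Fin (n - 1) → ℝ} (hB : LocallyLipschitz B) (i j) : Measurable fun X => AO B X i j := by
  cases i <;> cases j <;> simp only [AO]
  · exact measurable_const
  · exact measurable_const
  · exact measurable_const
  · exact (B_cont hB _ _).measurable

theorem ball_KK {n : ℕ} (p : EE n) {t : ℝ} (ht : 0 < t) : Metric.ball ((p, t) : Pt n) (t / 4) ⊆ KK p t := by
  intro X hX
  rw [← ball_prod_same] at hX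
  have h1 := Metric.mem_ball.1 hX.1
  have h2 := Metric.mem_ball.1 hX.2
  rw [Real.dist_eq, abs_lt] at h2
  refine ⟨Metric.mem_closedBall.2 (by linarith), by linarith [h2.1], by linarith [h2.2]⟩

theorem ball_low {n : ℕ} (p : EE n) {t : ℝ} (X : Pt n) (hX : X ∈ Metric.ball ((p, t) : Pt n) (t / 4)) : 3 * t / 4 < X.2 := by
  rw [← ball_prod_same] at hX
  have h2 := Metric.mem_ball.1 hX.2
  rw [Real.dist_eq, abs_lt] at h2
  linarith [h2.1]

theorem FO_bd {n : ℕ} {B : Pt n → Fin (n - 1) → Fin (n - 1) → ℝ} {M : ℝ} (hBM : ∀ X ∈ UHS n, (X.2 * gradxA B X) ^ 2 ≤ M)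
    (v η : Fin (n - 1) → Pt n → ℝ) {C1 g t : ℝ} (ht : 0 < t) (X : Pt n) (hX : 3 * t / 4 < X.2)
    (hM1 : M ≤ C1) (hV : M * ∑ j, v j X ^ 2 ≤ C1 * g ^ 2) :
    ∑ m, ∑ i, FO B v η m X i ^ 2 ≤ (2 * √(((n - 1 : ℕ) : ℝ) ^ 3 * C1) / t) ^ 2 * (∑ m, η m X ^ 2 + g ^ 2) := by
  have hM := M_nonneg hBM
  have hC1 : 0 ≤ C1 := hM.trans hM1
  have hXU : X ∈ UHS n := by show 0 < X.2; linarith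
  have hX0 : 0 < X.2 := hXU
  set N : ℝ := ((n - 1 : ℕ) : ℝ) with hN
  have hN0 : 0 ≤ N := Nat.cast_nonneg _
  set P := ∑ m, η m X ^ 2 with hP
  have hP0 : 0 ≤ P := Finset.sum_nonneg fun _ _ => sq_nonneg _
  have hd : ∀ m i j, pdx m (fun Z => B Z i j) X ^ 2 ≤ 2 * M / t ^ 2 := by
    intro m i j
    have h1 := dB_sq hBM X hXU m i j
    rw [le_div_iff₀ (by positivity)]
    have h2 : t ^ 2 ≤ 2 * X.2 ^ 2 := by nlinarith
    nlinarith [mul_le_mul_of_nonneg_left h2 (sq_nonneg (pdx m (fun Z => B Z i j) X))]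
  have key : ∀ m i, FO B v η m X i ^ 2 ≤ N * (4 * C1 / t ^ 2 * (P + g ^ 2)) := by
    intro m i
    cases i with
    | none =>
      simp only [FO]
      rw [zero_pow two_ne_zero]
      positivity
    | some i =>
      simp only [FO]
      have h1 : (∑ j, pdx m (fun Z => B Z i j) X * (v j X + η j X)) ^ 2 ≤ _ := sq_sum_le_card_mul_sum_sq
      refine h1.trans ?_
      rw [Finset.card_univ, Fintype.card_fin]
      refine mul_le_mul_of_nonneg_left ?_ hN0
      calc ∑ j, (pdx m (fun Z => B Z i j) X * (v j X + η j X)) ^ 2 ≤ ∑ j, 2 * M / t ^ 2 * (2 * (v j X ^ 2 + η j X ^ 2)) := by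
            refine Finset.sum_le_sum fun j _ => ?_
            rw [mul_pow]
            refine mul_le_mul (hd m i j) (by nlinarith [sq_nonneg (v j X - η j X)]) (sq_nonneg _) (by positivity)
        _ = 4 / t ^ 2 * (M * ∑ j, v j X ^ 2 + M * P) := by
            rw [← Finset.mul_sum, ← Finset.mul_sum, Finset.sum_add_distrib]; ring
        _ ≤ 4 / t ^ 2 * (C1 * g ^ 2 + C1 * P) := by gcongr
        _ = _ := by ring
  calc ∑ m, ∑ i, FO B v η m X i ^ 2 = ∑ m, ∑ i, FO B v η m X (some i) ^ 2 := by
        refine Finset.sum_congr rfl fun m _ => ?_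
        rw [Fintype.sum_option]; simp [FO]
    _ ≤ ∑ m : Fin (n - 1), ∑ i : Fin (n - 1), N * (4 * C1 / t ^ 2 * (P + g ^ 2)) :=
        Finset.sum_le_sum fun m _ => Finset.sum_le_sum fun i _ => key m (some i)
    _ = _ := by
        rw [div_pow, mul_pow, Real.sq_sqrt (by positivity)]
        simp [← hN]; ring

theorem WC_MData {n : ℕ} (hn : 2 ≤ n) {lam Lam : ℝ} (hlam : 0 < lam) (hL : 0 ≤ Lam) {C1 : ℝ}
    {B : Pt n → Fin (n - 1) → Fin (n - 1) → ℝ} {M : ℝ} {f : EE n → ℝ} {v η : Fin (n - 1) → Pt n → ℝ}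
    (hE : EllipticOn (UHS n) B lam Lam) (hW : WCSetup B M f v η) (p : EE n) {t g : ℝ} (ht : 0 < t) (hg : 0 < g)
    (hM1 : M ≤ C1) (hV : ∀ X ∈ Metric.ball ((p, t) : Pt n) (t / 4), M * ∑ j, v j X ^ 2 ≤ C1 * g ^ 2) :
    MData volume (ev n) (Metric.ball ((p, t) : Pt n) (t / 4)) η (AO B) (FO B v η)
      (fun m i => (Metric.ball ((p, t) : Pt n) (t / 4)).indicator fun X => ∑ j, AO B X i j * fderiv ℝ (η m) X (ev n j) + FO B v η m X i)
      (min lam 1) (Lam + 1) g (2 * √(((n - 1 : ℕ) : ℝ) ^ 3 * C1) / t) := by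
  obtain ⟨hBl, -, hBM, -, -, hv, hη⟩ := hW
  have hM := M_nonneg hBM
  set U := Metric.ball ((p, t) : Pt n) (t / 4) with hUdef
  have hUm : MeasurableSet U := measurableSet_ball
  have hlow : ∀ X ∈ U, 3 * t / 4 < X.2 := fun X hX => ball_low p X hX
  have hUU : U ⊆ UHS n := fun X hX => by show 0 < X.2; linarith [hlow X hX]
  have hUK : U ⊆ KK p t := ball_KK p ht
  have hKU : KK p t ⊆ UHS n := fun X hX => lt_of_lt_of_le (by positivity : 0 < t / 2) hX.2.1
  have hUf : volume U ≠ ⊤ := ((measure_mono hUK).trans_lt (KK_cpt p t).measure_lt_top).ne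
  have hfin : IsFiniteMeasure (volume.restrict U) := ⟨by rw [Measure.restrict_apply_univ]; exact lt_top_iff_ne_top.2 hUf⟩
  have hg2 : ∀ m i, MemLp (fun X => fderiv ℝ (η m) X (ev n i)) 2 (volume.restrict U) := fun m i =>
    (ev_memLp hn (hη m).2.1 i).mono_measure (Measure.restrict_mono hUU le_rfl)
  have hI1 : ∀ m i, MemLp (fun X => ∑ j, AO B X i j * fderiv ℝ (η m) X (ev n j)) 2 (volume.restrict U) := by
    intro m i
    refine memLp_finsetSum _ fun j _ => ?_
    refine MemLp.of_le_mul (c := Lam + 1) (hg2 m j) ((AO_meas hBl i j).mul (measurable_fderiv_apply_const ℝ _ _)).aestronglyMeasurable ?_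
    refine (ae_restrict_iff' hUm).2 (Eventually.of_forall fun X hX => ?_)
    rw [norm_mul]
    exact mul_le_mul_of_nonneg_right (AO_abs hL hE X (hUU hX) i j) (norm_nonneg _)
  have hwc : ∀ j, ContinuousOn (fun X => v j X + η j X) (KK p t) := fun j X hX =>
    (((hv j).1.1 X (hKU hX)).continuousAt.add ((hη j).1 X (hKU hX)).continuousAt).continuousWithinAt
  have hI2 : ∀ m i, MemLp (fun X => FO B v η m X i) 2 (volume.restrict U) := by
    intro m i
    cases i with
    | none => simp only [FO]; exact MemLp.zero'
    | some i =>
      simp only [FO]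
      refine memLp_finsetSum _ fun j _ => ?_
      obtain ⟨C, hC⟩ := (KK_cpt p t).exists_bound_of_continuousOn (hwc j)
      refine MemLp.of_bound ?_ ((M + 1) * (2 / t) * C) ?_
      · exact (pdx_meas m _).aestronglyMeasurable.mul (((hwc j).mono hUK).aestronglyMeasurable hUm)
      · refine (ae_restrict_iff' hUm).2 (Eventually.of_forall fun X hX => ?_)
        rw [norm_mul]
        refine mul_le_mul ?_ (hC X (hUK hX)) (norm_nonneg _) (by positivity)
        have h1 := dB_sq hBM X (hUU hX) m i j
        have h2 := hlow X hX
        have h0 : 0 < X.2 := hUU hX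
        have h3 : X.2 * |pdx m (fun Z => B Z i j) X| ≤ M + 1 := by
          have : X.2 * |pdx m (fun Z => B Z i j) X| = |X.2 * pdx m (fun Z => B Z i j) X| := by rw [abs_mul, abs_of_pos h0]
          rw [this]
          rw [← sq_abs] at h1
          nlinarith [sq_nonneg (|X.2 * pdx m (fun Z => B Z i j) X| - 1)]
        rw [Real.norm_eq_abs, mul_div_assoc', le_div_iff₀ ht]
        nlinarith [abs_nonneg (pdx m (fun Z => B Z i j) X)]
  have hflux : ∀ m i, MemLp (fun X => ∑ j, AO B X i j * fderiv ℝ (η m) X (ev n j) + FO B v η m X i) 2 (volume.restrict U) :=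
    fun m i => (hI1 m i).add (hI2 m i)
  refine ⟨Metric.isOpen_ball, lt_min hlam one_pos, hg, by positivity, fun m X hX => (hη m).1 X (hUU hX),
    fun m i => (memLp_indicator_iff_restrict hUm).2 (hflux m i), fun m i => (integrable_indicator_iff hUm).2 ((hflux m i).integrable (by norm_num)),
    fun m i X hX => indicator_of_mem hX _, fun X hX ξ => AO_ell hE X (hUU hX) ξ, fun X hX ξ ζ => AO_bd hL hE X (hUU hX) ξ ζ,
    fun X hX => FO_bd hBM v η ht X (hlow X hX) hM1 (hV X hX), fun m i => (memLp_indicator_iff_restrict hUm).2 (hg2 m i), ?_⟩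
  intro m ψ hψ hψc hψU
  have hz : ∀ X, X ∉ U → fderiv ℝ ψ X = 0 := fun X hX => fderiv_of_notMem_tsupport ℝ fun h => hX (hψU h)
  have hbd : ∃ C, ∀ X, ‖fderiv ℝ ψ X‖ ≤ C := by
    have hc : Continuous (fderiv ℝ ψ) := hψ.continuous_fderiv (by simp)
    exact hc.bounded_above_of_compact_support (hψc.fderiv ℝ)
  obtain ⟨C, hC⟩ := hbd
  have hmul : ∀ (T : Pt n → ℝ) (i), MemLp T 2 (volume.restrict U) → Integrable (fun X => T X * fderiv ℝ ψ X (ev n i)) (volume.restrict U) := by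
    intro T i hT
    refine ((hT.integrable (by norm_num)).norm.mul_const (C * ‖ev n i‖)).mono' (hT.1.mul (measurable_fderiv_apply_const ℝ _ _).aestronglyMeasurable) ?_
    refine Eventually.of_forall fun X => ?_
    rw [norm_mul]
    refine mul_le_mul_of_nonneg_left ?_ (norm_nonneg _)
    exact ((fderiv ℝ ψ X).le_opNorm _).trans (mul_le_mul_of_nonneg_right (hC X) (norm_nonneg _))
  have hUHm := (UHS_open n).measurableSet
  have hwk := (hη m).2.2.2 ψ ⟨hψ, hψc, hψU.trans hUU⟩
  rw [setIntegral_eq_of_subset_of_forall_diff_eq_zero hUHm hUU, setIntegral_eq_of_subset_of_forall_diff_eq_zero (s := U) hUHm hUU] at hwk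
  rotate_left
  · intro X hX
    simp [pdx, hz X hX.2]
  · intro X hX
    simp [pdx, pdt, hz X hX.2]
  rw [← setIntegral_eq_integral_of_forall_compl_eq_zero (s := U)]
  swap
  · intro X hX
    simp [hz X hX]
  have e : ∫ X in U, ∑ i, U.indicator (fun X => ∑ j, AO B X i j * fderiv ℝ (η m) X (ev n j) + FO B v η m X i) X * fderiv ℝ ψ X (ev n i) =
      ∫ X in U, ((∑ i, (∑ j, AO B X i j * fderiv ℝ (η m) X (ev n j)) * fderiv ℝ ψ X (ev n i)) + ∑ i, FO B v η m X i * fderiv ℝ ψ X (ev n i)) := by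
    refine setIntegral_congr_fun hUm fun X hX => ?_
    simp only [indicator_of_mem hX]
    rw [← Finset.sum_add_distrib]
    exact Finset.sum_congr rfl fun i _ => by ring
  rw [e, integral_add (integrable_finsetSum _ fun i _ => hmul _ i (hI1 m i)) (integrable_finsetSum _ fun i _ => hmul _ i (hI2 m i))]
  have e1 : ∀ X, ∑ i, (∑ j, AO B X i j * fderiv ℝ (η m) X (ev n j)) * fderiv ℝ ψ X (ev n i) =
      (∑ i : Fin (n - 1), ∑ j : Fin (n - 1), B X i j * pdx j (η m) X * pdx i ψ X) + pdt (η m) X * pdt ψ X := by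
    intro X
    simp only [Fintype.sum_option, AO, zero_mul, one_mul, Finset.sum_const_zero, add_zero, zero_add, Finset.sum_mul]
    rw [add_comm]; rfl
  have e2 : ∀ X, ∑ i, FO B v η m X i * fderiv ℝ ψ X (ev n i) = ∑ i : Fin (n - 1), ∑ j : Fin (n - 1),
            pdx m (fun Z => B Z i j) X * (v j X + η j X) * pdx i ψ X := by
    intro X
    simp only [Fintype.sum_option, FO, zero_mul, zero_add, Finset.sum_mul]
    rfl
  simp only [e1, e2]
  rw [hwk]; ring

theorem core_est {n : ℕ} (hn : 2 ≤ n) (lam Lam : ℝ) (hlam : 0 < lam) (hL : 0 ≤ Lam) (C1 : ℝ) (hC1 : 0 ≤ C1) : ∃ C : ℝ, 0 < C ∧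
    ∀ (B : Pt n → Fin (n - 1) → Fin (n - 1) → ℝ) (M : ℝ) (f : EE n → ℝ) (v η : Fin (n - 1) → Pt n → ℝ),
    EllipticOn (UHS n) B lam Lam → WCSetup B M f v η → ∀ (p p' : EE n) (t g : ℝ), 0 < t → 0 < g →
    dist p' p ≤ t / 4 → M ≤ C1 →
    (∫⁻ X in Metric.ball p t ×ˢ Ioo 0 (2 * t), ENNReal.ofReal (X.2 * ∑ m, gradSq (η m) X) ≤ ENNReal.ofReal (C1 * g ^ 2 * t ^ (n - 1))) →
    (∫⁻ X in SB p' t, ENNReal.ofReal (M * ∑ j, v j X ^ 2) ≤ ENNReal.ofReal (C1 * g ^ 2 * t ^ n)) →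
    (∫⁻ X in SB p' t, ENNReal.ofReal (M * ∑ j, η j X ^ 2) ≤ ENNReal.ofReal (C1 * g ^ 2 * t ^ n)) →
    (∀ X ∈ Metric.ball ((p, t) : Pt n) (t / 4), M * ∑ j, v j X ^ 2 ≤ C1 * g ^ 2) →
    ∑ m, η m (p, t) ^ 2 ≤ C * g ^ 2 := by
  haveI := vol_haar n
  obtain ⟨A, hA0, hA⟩ := flat_part hn lam Lam hL C1 hC1
  obtain ⟨Cm, hCm0, hCm⟩ := mean_part hn (A + 2 * C1) (by positivity)
  obtain ⟨C0, hC0, hC⟩ := ST_bound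
  have hk := kap0_pos n
  have hn1 : (1 : ℝ) < n := by exact_mod_cast (by omega : 1 < n)
  have hn2 : (2 : ℝ) ≤ n := by exact_mod_cast hn
  have hp : Real.HolderConjugate (Module.finrank ℝ (Pt n)) ((n : ℝ) / (n - 1)) := by
    rw [finrank_Pt hn]
    exact Real.HolderConjugate.conjExponent hn1
  have hθ2 : (n : ℝ) / (n - 1) ≤ 2 := by rw [div_le_iff₀ (by linarith)]; linarith
  obtain ⟨Cs, hCs0, hCs⟩ := moser (μ := (volume : Measure (Pt n))) (J := Fin (n - 1)) (ev n) ev_he _ hp hθ2 (min lam 1) (Lam + 1)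
    (lt_min hlam one_pos) (4 * C0) (by positivity) (prod_cut hC n) (2 * √(((n - 1 : ℕ) : ℝ) ^ 3 * C1)) (by positivity)
  set N : ℝ := ((n - 1 : ℕ) : ℝ) with hN
  refine ⟨Cs * 8 ^ n * (N * Cm + kap0 n), by positivity, ?_⟩
  intro B M f v η hE hW p p' t g ht hg hpp hM1 hQ hv hη hV
  have hWη := hW.2.2.2.2.2.2
  have hSQ : SB p' t ⊆ Metric.ball p t ×ˢ Ioo 0 (2 * t) := by
    intro X hX
    refine ⟨?_, hX.2.1, by linarith [hX.2.2]⟩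
    have := Metric.mem_closedBall.1 hX.1
    rw [Metric.mem_ball]
    linarith [dist_triangle X.1 p' p]
  have hKQ : KK p t ⊆ Metric.ball p t ×ˢ Ioo 0 (2 * t) := by
    intro X hX
    have := Metric.mem_closedBall.1 hX.1
    refine ⟨?_, by linarith [hX.2.1], by linarith [hX.2.2]⟩
    rw [Metric.mem_ball]; linarith
  have hfl := hA B M f v η hE hW p' t g ht hg ((lintegral_mono_set hSQ).trans hQ) hv hη
  have hKm : MeasurableSet (KK p t) := (KK_cpt p t).measurableSet
  have hmean : ∀ m, ∫⁻ X in KK p t, ENNReal.ofReal (η m X ^ 2) ≤ ENNReal.ofReal (Cm * g ^ 2 * t ^ n) := by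
    intro m
    refine hCm p p' t g (η m) ht hg hpp (hWη m).1 ((hfl m).trans ?_) ?_
    · have : 0 ≤ 2 * C1 := by positivity
      gcongr; linarith
    · calc ∫⁻ X in KK p t, ENNReal.ofReal (t ^ 2 * gradSq (η m) X)
          ≤ ∫⁻ X in KK p t, ENNReal.ofReal (2 * t) * ENNReal.ofReal (X.2 * ∑ m, gradSq (η m) X) := by
            refine setLIntegral_mono' hKm fun X hX => ?_
            rw [← ENNReal.ofReal_mul (by positivity)]
            refine ENNReal.ofReal_le_ofReal ?_
            have h1 : gradSq (η m) X ≤ ∑ m, gradSq (η m) X :=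
              Finset.single_le_sum (f := fun m => gradSq (η m) X) (fun i _ => gradSq_nonneg _ _) (Finset.mem_univ m)
            have h2 : t / 2 ≤ X.2 := hX.2.1
            have h0 := gradSq_nonneg (η m) X
            calc t ^ 2 * gradSq (η m) X ≤ (2 * t * X.2) * ∑ m, gradSq (η m) X := by
                  refine mul_le_mul (by nlinarith) h1 h0 (by nlinarith)
              _ = _ := by ring
        _ = ENNReal.ofReal (2 * t) * ∫⁻ X in KK p t, ENNReal.ofReal (X.2 * ∑ m, gradSq (η m) X) :=
            lintegral_const_mul' _ _ ENNReal.ofReal_ne_top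
        _ ≤ ENNReal.ofReal (2 * t) * ENNReal.ofReal (C1 * g ^ 2 * t ^ (n - 1)) := by
            gcongr
            exact (lintegral_mono_set hKQ).trans hQ
        _ ≤ _ := by
            rw [← ENNReal.ofReal_mul (by positivity)]
            refine ENNReal.ofReal_le_ofReal ?_
            have e : t ^ n = t * t ^ (n - 1) := by rw [← pow_succ']; congr 1; omega
            rw [e]
            have : 0 ≤ A * g ^ 2 * (t * t ^ (n - 1)) := by positivity
            nlinarith
  have D := WC_MData hn hlam hL hE hW p ht hg hM1 hV
  have hcb : Metric.closedBall ((p, t) : Pt n) (t / 8) ⊆ Metric.ball ((p, t) : Pt n) (t / 4) :=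
    Metric.closedBall_subset_ball (by linarith)
  have hcK : Metric.closedBall ((p, t) : Pt n) (t / 8) ⊆ KK p t := hcb.trans (ball_KK p ht)
  have hKU : KK p t ⊆ UHS n := fun X hX => lt_of_lt_of_le (by positivity : 0 < t / 2) hX.2.1
  have hm := hCs _ _ _ _ _ _ _ D (p, t) (t / 8) (by positivity) hcb (by
    rw [div_le_div_iff₀ ht (by positivity)]
    have : 0 ≤ 2 * √(N ^ 3 * C1) := by positivity
    nlinarith)
  rw [finrank_Pt hn] at hm
  have hcont : ∀ m, ContinuousOn (fun X => η m X ^ 2) (KK p t) := fun m X hX =>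
    (((hWη m).1 X (hKU hX)).continuousAt.pow 2).continuousWithinAt
  have hintg : ∀ m, IntegrableOn (fun X => η m X ^ 2) (KK p t) := fun m => (hcont m).integrableOn_compact (KK_cpt p t)
  have hone : ∀ m, ∫ X in KK p t, η m X ^ 2 ≤ Cm * g ^ 2 * t ^ n := by
    intro m
    rw [integral_eq_lintegral_of_nonneg_ae (Eventually.of_forall fun X => sq_nonneg _) (hintg m).1]
    exact ENNReal.toReal_le_of_le_ofReal (by positivity) (hmean m)
  have hvolr : volume.real (KK p t) ≤ kap0 n * t ^ n := ENNReal.toReal_le_of_le_ofReal (by positivity) (KK_vol hn p ht)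
  have hKfin : volume (KK p t) ≠ ⊤ := (KK_cpt p t).measure_lt_top.ne
  have hsum : Integrable (fun X => ∑ m, η m X ^ 2) (volume.restrict (KK p t)) := integrable_finsetSum _ fun m _ => hintg m
  have hcst : Integrable (fun _ : Pt n => g ^ 2) (volume.restrict (KK p t)) := integrableOn_const hKfin
  have hPint : IntegrableOn (Pf η g) (KK p t) := hsum.add hcst
  have hP : ∫ X in Metric.closedBall ((p, t) : Pt n) (t / 8), Pf η g X ≤ (N * Cm + kap0 n) * g ^ 2 * t ^ n := by
    calc ∫ X in Metric.closedBall ((p, t) : Pt n) (t / 8), Pf η g X ≤ ∫ X in KK p t, Pf η g X := by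
          refine setIntegral_mono_set hPint (Eventually.of_forall fun X => ?_) hcK.eventuallyLE
          exact add_nonneg (Finset.sum_nonneg fun _ _ => sq_nonneg _) (sq_nonneg _)
      _ = ∑ m, (∫ X in KK p t, η m X ^ 2) + volume.real (KK p t) * g ^ 2 := by
          unfold Pf
          rw [integral_add hsum hcst, integral_finsetSum _ fun m _ => hintg m, setIntegral_const, smul_eq_mul]
      _ ≤ ∑ m : Fin (n - 1), Cm * g ^ 2 * t ^ n + kap0 n * t ^ n * g ^ 2 := by
          gcongr with m
          exact hone m
      _ = _ := by
          simp [← hN]; ring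
  calc ∑ m, η m (p, t) ^ 2 ≤ Pf η g (p, t) := by unfold Pf; linarith [sq_nonneg g]
    _ ≤ _ := hm
    _ ≤ Cs / (t / 8) ^ n * ((N * Cm + kap0 n) * g ^ 2 * t ^ n) := by gcongr
    _ = _ := by
        rw [div_pow]
        field_simp

theorem MHL_use {d : ℕ} {R : Set (EuclideanSpace ℝ (Fin d))} {g : EuclideanSpace ℝ (Fin d) → ℝ≥0∞}
    {x z : EuclideanSpace ℝ (Fin d)} {ρ : ℝ} (hρ : 0 < ρ) (hx : x ∈ Metric.ball z ρ) (hR : Metric.ball z ρ ⊆ R) :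
    ∫⁻ y in Metric.ball z ρ, g y ≤ MHL R g x * volume (Metric.ball z ρ) := by
  have h : (volume (Metric.ball z ρ))⁻¹ * ∫⁻ y in Metric.ball z ρ, g y ≤ MHL R g x := by
    unfold MHL
    exact le_iSup_of_le z (le_iSup_of_le ρ (le_iSup_of_le hρ (le_iSup_of_le hx (le_iSup_of_le hR le_rfl))))
  have h0 : volume (Metric.ball z ρ) ≠ 0 := (Metric.measure_ball_pos _ _ hρ).ne'
  have h1 : volume (Metric.ball z ρ) ≠ ⊤ := measure_ball_lt_top.ne
  calc ∫⁻ y in Metric.ball z ρ, g y = ((volume (Metric.ball z ρ))⁻¹ * ∫⁻ y in Metric.ball z ρ, g y) * volume (Metric.ball z ρ) := by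
        rw [mul_comm, ← mul_assoc, ENNReal.mul_inv_cancel h0 h1, one_mul]
    _ ≤ _ := by gcongr

theorem rpow_half_le {A : ℝ≥0∞} {g : ℝ} (hg : 0 ≤ g) (h : A ^ (1 / 2 : ℝ) ≤ ENNReal.ofReal g) : A ≤ ENNReal.ofReal (g ^ 2) := by
  have h1 : (A ^ (1 / 2 : ℝ)) ^ 2 ≤ ENNReal.ofReal g ^ 2 := by gcongr
  rw [← ENNReal.ofReal_pow hg] at h1
  rwa [← ENNReal.rpow_natCast, ← ENNReal.rpow_mul, show (1 / 2 : ℝ) * ((2 : ℕ) : ℝ) = 1 by norm_num, ENNReal.rpow_one] at h1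

theorem ton {n : ℕ} {h : Pt n → ℝ≥0∞} (hm : Measurable h) {Q : Set (Pt n)} (hQ : MeasurableSet Q) {D : Set (EE n)} (hD : MeasurableSet D)
    (hQD : ∀ X ∈ Q, Metric.ball X.1 X.2 ⊆ D) :
    ∫⁻ X in Q, h X * volume (Metric.ball X.1 X.2) ≤ ∫⁻ y in D, ∫⁻ X in Q ∩ {X | dist y X.1 < X.2}, h X := by
  set W : Set (EE n × Pt n) := {z | dist z.1 z.2.1 < z.2.2} with hW
  have hWm : MeasurableSet W := (isOpen_lt (by fun_prop) (by fun_prop)).measurableSet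
  have hF : Measurable (W.indicator fun z => h z.2) := (hm.comp measurable_snd).indicator hWm
  have e1 : ∀ y, ∫⁻ X in Q ∩ {X | dist y X.1 < X.2}, h X = ∫⁻ X in Q, W.indicator (fun z => h z.2) (y, X) := by
    intro y
    have hS : MeasurableSet {X : Pt n | dist y X.1 < X.2} := (isOpen_lt (by fun_prop) (by fun_prop)).measurableSet
    rw [inter_comm, ← Measure.restrict_restrict hS, ← lintegral_indicator hS]
    rfl
  simp only [e1]
  rw [lintegral_lintegral_swap (f := fun y X => W.indicator (fun z => h z.2) (y, X)) hF.aemeasurable]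
  refine setLIntegral_mono' hQ fun X hX => ?_
  have e2 : ∀ y, W.indicator (fun z => h z.2) (y, X) = (Metric.ball X.1 X.2).indicator (fun _ => h X) y := by
    intro y; rfl
  simp only [e2]
  rw [lintegral_indicator measurableSet_ball, Measure.restrict_restrict measurableSet_ball, inter_eq_left.2 (hQD X hX), setLIntegral_const]

theorem SF_bound {n : ℕ} (hn : 2 ≤ n) (η : Fin (n - 1) → Pt n → ℝ) {p : EE n} {t d a g : ℝ} (ht : 0 < t) (htd : t < d) (ha : 1 ≤ a)
    (hS : ∫⁻ y in Metric.ball p ((2 + a) * t), SFon (coneTrunc 1 (2 * d) y) (fun X => ∑ m, gradSq (η m) X) ^ (2 : ℕ) ≤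
      ENNReal.ofReal (g ^ 2) * volume (Metric.ball p ((2 + a) * t))) :
    ∫⁻ X in Metric.ball p t ×ˢ Ioo 0 (2 * t), ENNReal.ofReal (X.2 * ∑ m, gradSq (η m) X) ≤
      ENNReal.ofReal ((2 + a) ^ (n - 1) * g ^ 2 * t ^ (n - 1)) := by
  have hk := kap0_pos n
  set G : Pt n → ℝ := fun X => ∑ m, gradSq (η m) X with hG
  have hG0 : ∀ X, 0 ≤ G X := fun X => Finset.sum_nonneg fun _ _ => gradSq_nonneg _ _
  have hGm : Measurable G := Finset.measurable_fun_sum _ fun m _ => gradSq_meas (η m)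
  set h : Pt n → ℝ≥0∞ := fun X => ENNReal.ofReal (G X) * ENNReal.ofReal (X.2 ^ ((2 : ℝ) - n)) with hh
  have hhm : Measurable h := hGm.ennreal_ofReal.mul (measurable_snd.pow_const _).ennreal_ofReal
  set Q := Metric.ball p t ×ˢ Ioo 0 (2 * t) with hQ
  have hQm : MeasurableSet Q := measurableSet_ball.prod measurableSet_Ioo
  have e : ∀ y, SFon (coneTrunc 1 (2 * d) y) G ^ (2 : ℕ) = ∫⁻ X in coneTrunc 1 (2 * d) y, h X := by
    intro y
    unfold SFon
    rw [← ENNReal.rpow_natCast, ← ENNReal.rpow_mul, show (1 / 2 : ℝ) * ((2 : ℕ) : ℝ) = 1 by norm_num, ENNReal.rpow_one]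
  have hsub : ∀ y, Q ∩ {X | dist y X.1 < X.2} ⊆ coneTrunc 1 (2 * d) y := by
    rintro y X ⟨hX, hy⟩
    have hy' : dist y X.1 < X.2 := hy
    have h0 : 0 < X.2 := hX.2.1
    refine ⟨⟨h0, ?_⟩, ?_⟩
    · unfold dist2
      rw [Real.sqrt_le_left (by linarith)]
      simp only [sub_zero]
      rw [dist_comm] at hy'
      nlinarith [dist_nonneg (x := X.1) (y := y)]
    · show X.2 < 2 * d
      linarith [hX.2.2]
  have h1 : ∫⁻ X in Q, h X * volume (Metric.ball X.1 X.2) ≤ ENNReal.ofReal (g ^ 2) * volume (Metric.ball p ((2 + a) * t)) := by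
    refine (ton (D := Metric.ball p ((2 + a) * t)) hhm hQm measurableSet_ball ?_).trans (le_trans ?_ hS)
    · intro X hX
      refine Metric.ball_subset_ball' ?_
      have := Metric.mem_ball.1 hX.1
      nlinarith [hX.2.2]
    · refine lintegral_mono fun y => ?_
      show _ ≤ SFon (coneTrunc 1 (2 * d) y) G ^ (2 : ℕ)
      rw [e y]
      exact lintegral_mono_set (hsub y)
  have h2 : ∫⁻ X in Q, h X * volume (Metric.ball X.1 X.2) = ENNReal.ofReal (kap0 n) * ∫⁻ X in Q, ENNReal.ofReal (X.2 * G X) := by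
    rw [← lintegral_const_mul' _ _ ENNReal.ofReal_ne_top]
    refine setLIntegral_congr_fun hQm fun X hX => ?_
    have h0 : 0 < X.2 := hX.2.1
    simp only [hh]
    rw [vol_b X.1 h0, ← ENNReal.ofReal_mul (hG0 X), ← ENNReal.ofReal_mul (mul_nonneg (hG0 X) (by positivity)), ← ENNReal.ofReal_mul hk.le]
    congr 1
    have e3 : X.2 ^ ((2 : ℝ) - n) * X.2 ^ (n - 1) = X.2 := by
      rw [← Real.rpow_natCast, ← Real.rpow_add h0, Nat.cast_sub (by omega)]
      norm_num
    calc G X * X.2 ^ ((2 : ℝ) - n) * (kap0 n * X.2 ^ (n - 1)) = kap0 n * G X * (X.2 ^ ((2 : ℝ) - n) * X.2 ^ (n - 1)) := by ring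
      _ = _ := by rw [e3]; ring
  rw [h2, vol_b p (by positivity), ← ENNReal.ofReal_mul (by positivity)] at h1
  have e4 : g ^ 2 * (kap0 n * ((2 + a) * t) ^ (n - 1)) = kap0 n * ((2 + a) ^ (n - 1) * g ^ 2 * t ^ (n - 1)) := by rw [mul_pow]; ring
  rw [e4, ENNReal.ofReal_mul hk.le] at h1
  exact (ENNReal.mul_le_mul_iff_right (ENNReal.ofReal_pos.2 hk).ne' ENNReal.ofReal_ne_top).1 h1

theorem NTv_ge {n m : ℕ} {a : ℝ} (w : Fin m → Pt n → ℝ) {q : EE n} {X : Pt n} (hX : X ∈ cone a q) :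
    ENNReal.ofReal (∑ k, w k X ^ 2) ≤ NTv a w q ^ (2 : ℕ) := by
  have h0 : 0 ≤ ∑ k, w k X ^ 2 := Finset.sum_nonneg fun _ _ => sq_nonneg _
  have h : ENNReal.ofReal (Real.sqrt (∑ k, w k X ^ 2)) ≤ NTv a w q := by
    unfold NTv
    exact le_iSup₂_of_le X hX le_rfl
  calc ENNReal.ofReal (∑ k, w k X ^ 2) = ENNReal.ofReal (Real.sqrt (∑ k, w k X ^ 2)) ^ 2 := by
        rw [← ENNReal.ofReal_pow (Real.sqrt_nonneg _), Real.sq_sqrt h0]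
    _ ≤ _ := by gcongr

theorem pt_bound {n m : ℕ} {a M g t : ℝ} (ha : 1 ≤ a) (ht : 0 < t) (hM : 0 ≤ M) (w : Fin m → Pt n → ℝ) (p : EE n) (Y : Pt n)
    (hY1 : dist Y.1 p < t / 4) (hY2 : 3 * t / 4 < Y.2)
    (h : ENNReal.ofReal M * ∫⁻ y in Metric.ball p ((2 + a) * t), NTv a w y ^ (2 : ℕ) ≤
      ENNReal.ofReal (g ^ 2) * volume (Metric.ball p ((2 + a) * t))) :
    M * ∑ k, w k Y ^ 2 ≤ (4 * (2 + a)) ^ (n - 1) * g ^ 2 := by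
  have hk := kap0_pos n
  have h0 : 0 ≤ ∑ k, w k Y ^ 2 := Finset.sum_nonneg fun _ _ => sq_nonneg _
  have h1 : ENNReal.ofReal (∑ k, w k Y ^ 2) * volume (Metric.ball p (t / 4)) ≤ ∫⁻ y in Metric.ball p ((2 + a) * t), NTv a w y ^ (2 : ℕ) := by
    rw [← setLIntegral_const]
    refine (setLIntegral_mono' measurableSet_ball fun y hy => ?_).trans (lintegral_mono_set (Metric.ball_subset_ball (by nlinarith)))
    refine NTv_ge w ⟨by linarith, ?_⟩
    unfold dist2
    rw [Real.sqrt_le_left (by nlinarith)]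
    simp only [sub_zero]
    have hy' := Metric.mem_ball'.1 hy
    have h3 : dist Y.1 y ≤ Y.2 := by linarith [dist_triangle Y.1 p y]
    have h4 : 2 * Y.2 ≤ (1 + a) * Y.2 := by nlinarith
    have h5 : 0 ≤ dist Y.1 y := dist_nonneg
    nlinarith
  have h2 : ENNReal.ofReal M * (ENNReal.ofReal (∑ k, w k Y ^ 2) * volume (Metric.ball p (t / 4))) ≤ _ := (mul_le_mul_right h1 _).trans h
  rw [vol_b p (by positivity), vol_b p (by positivity), ← ENNReal.ofReal_mul h0, ← ENNReal.ofReal_mul hM, ← ENNReal.ofReal_mul (by positivity),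
    ENNReal.ofReal_le_ofReal_iff (by positivity)] at h2
  have e : (2 + a) * t = (4 * (2 + a)) * (t / 4) := by ring
  rw [e, mul_pow] at h2
  have hpos : 0 < kap0 n * (t / 4) ^ (n - 1) := by positivity
  refine le_of_mul_le_mul_right ?_ hpos
  linarith

theorem SB_bound {n m : ℕ} (hn : 2 ≤ n) {a M g t : ℝ} (ha : 1 ≤ a) (ht : 0 < t) (hM : 0 ≤ M) (w : Fin m → Pt n → ℝ) (N : EE n → ℝ≥0∞) (p p' : EE n)
    (hpp : dist p' p ≤ t / 4) (hw : ∀ k, ∀ X ∈ UHS n, DifferentiableAt ℝ (w k) X)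
    (hN : ∀ X ∈ SB p' t, ENNReal.ofReal (∑ k, w k X ^ 2) ≤ N X.1)
    (h : ENNReal.ofReal M * ∫⁻ y in Metric.ball p ((2 + a) * t), N y ≤
      ENNReal.ofReal (g ^ 2) * volume (Metric.ball p ((2 + a) * t))) :
    ∫⁻ X in SB p' t, ENNReal.ofReal (M * ∑ k, w k X ^ 2) ≤ ENNReal.ofReal (kap0 n * (2 + a) ^ (n - 1) * g ^ 2 * t ^ n) := by
  have hk := kap0_pos n
  have hSm : MeasurableSet (SB p' t) := measurableSet_closedBall.prod measurableSet_Ioo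
  have hc : ContinuousOn (fun X => ∑ k, w k X ^ 2) (SB p' t) := fun X hX =>
    (tendsto_finsetSum _ fun k _ => ((hw k X hX.2.1).continuousAt.pow 2 : ContinuousAt (fun X => w k X ^ 2) X).tendsto.mono_left nhdsWithin_le_nhds)
  have hae : AEMeasurable (fun X => ENNReal.ofReal (∑ k, w k X ^ 2)) (volume.restrict (SB p' t)) := (hc.aemeasurable hSm).ennreal_ofReal
  have hsub : Metric.closedBall p' (t / 4) ⊆ Metric.ball p ((2 + a) * t) := by
    intro y hy
    rw [Metric.mem_ball]
    nlinarith [Metric.mem_closedBall.1 hy, dist_triangle y p' p]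
  have h1 : ∫⁻ X in SB p' t, ENNReal.ofReal (∑ k, w k X ^ 2) ≤ ENNReal.ofReal t * ∫⁻ y in Metric.ball p ((2 + a) * t), N y := by
    unfold SB at hae hN ⊢
    rw [Measure.volume_eq_prod, ← Measure.prod_restrict] at hae ⊢
    rw [lintegral_prod _ hae]
    calc ∫⁻ y in Metric.closedBall p' (t / 4), ∫⁻ s in Ioo 0 t, ENNReal.ofReal (∑ k, w k (y, s) ^ 2)
        ≤ ∫⁻ y in Metric.closedBall p' (t / 4), ENNReal.ofReal t * N y := by
          refine setLIntegral_mono' measurableSet_closedBall fun y hy => ?_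
          calc ∫⁻ s in Ioo 0 t, ENNReal.ofReal (∑ k, w k (y, s) ^ 2) ≤ ∫⁻ s in Ioo 0 t, N y :=
                setLIntegral_mono' measurableSet_Ioo fun s hs => hN (y, s) ⟨hy, hs⟩
            _ = _ := by rw [setLIntegral_const, Real.volume_Ioo, sub_zero, mul_comm]
      _ = ENNReal.ofReal t * ∫⁻ y in Metric.closedBall p' (t / 4), N y := lintegral_const_mul' _ _ ENNReal.ofReal_ne_top
      _ ≤ _ := by gcongr
  calc ∫⁻ X in SB p' t, ENNReal.ofReal (M * ∑ k, w k X ^ 2) = ENNReal.ofReal M * ∫⁻ X in SB p' t, ENNReal.ofReal (∑ k, w k X ^ 2) := by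
        rw [← lintegral_const_mul' _ _ ENNReal.ofReal_ne_top]
        refine lintegral_congr fun X => ENNReal.ofReal_mul hM
    _ ≤ ENNReal.ofReal M * (ENNReal.ofReal t * ∫⁻ y in Metric.ball p ((2 + a) * t), N y) := by gcongr
    _ = ENNReal.ofReal t * (ENNReal.ofReal M * ∫⁻ y in Metric.ball p ((2 + a) * t), N y) := by ring
    _ ≤ ENNReal.ofReal t * (ENNReal.ofReal (g ^ 2) * volume (Metric.ball p ((2 + a) * t))) := by gcongr
    _ = _ := by
        rw [vol_b p (by positivity), ← ENNReal.ofReal_mul (by positivity), ← ENNReal.ofReal_mul (by positivity)]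
        congr 1
        have e : t ^ n = t * t ^ (n - 1) := by rw [← pow_succ']; congr 1; omega
        rw [e, mul_pow]; ring

theorem bad_empty {n : ℕ} (hn : 2 ≤ n) {lam Lam : ℝ} (hlam : 0 < lam) (hL : 0 ≤ Lam) {a : ℝ} (ha : 1 ≤ a) :
    ∃ C : ℝ, 0 < C ∧ ∀ (B : Pt n → Fin (n - 1) → Fin (n - 1) → ℝ) (M : ℝ) (f : EE n → ℝ) (v η : Fin (n - 1) → Pt n → ℝ),
    EllipticOn (UHS n) B lam Lam → WCSetup B M f v η → ∀ (q₀ : EE n) (d : ℝ), 0 < d → ∀ (γ ν : ℝ), 0 < γ → γ < 1 → 0 < ν →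
    ∀ (mm : ℝ), 3 + a ≤ mm → ∀ x : EE n,
    ENNReal.ofReal ν < NTv a (fun m X => (Metric.ball q₀ d ×ˢ Ioo (0 : ℝ) d).indicator (η m) X) x →
    MHL (Metric.ball q₀ (mm * d)) (fun y => SFon (coneTrunc 1 (2 * d) y) (fun X => ∑ m, gradSq (η m) X) ^ (2 : ℕ)) x ≤
      ENNReal.ofReal ((γ * ν) ^ 2) →
    ENNReal.ofReal |M| * MHL (Metric.ball q₀ (mm * d))
      (fun y => NTv a (fun m X => (Metric.ball q₀ d ×ˢ Ioo (0 : ℝ) d).indicator (η m) X) y ^ (2 : ℕ)) x ≤ ENNReal.ofReal ((γ * ν) ^ 2) →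
    ENNReal.ofReal |M| * MHL (Metric.ball q₀ (mm * d)) (fun y => NTv a v y ^ (2 : ℕ)) x ≤ ENNReal.ofReal ((γ * ν) ^ 2) →
    1 < C * γ ^ 2 := by
  have hk := kap0_pos n
  have ha0 : 0 < 2 + a := by linarith
  set C1 : ℝ := (4 * (2 + a)) ^ (n - 1) * (1 + kap0 n) with hC1
  have hC10 : 0 ≤ C1 := by positivity
  have hle1 : (4 * (2 + a)) ^ (n - 1) ≤ C1 := le_mul_of_one_le_right (by positivity) (by linarith)
  have hle2 : (2 + a) ^ (n - 1) ≤ (4 * (2 + a)) ^ (n - 1) := pow_le_pow_left₀ ha0.le (by linarith) _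
  have hle3 : kap0 n * (2 + a) ^ (n - 1) ≤ C1 := by rw [hC1]; nlinarith [pow_pos ha0 (n - 1)]
  obtain ⟨C, hC0, hC⟩ := core_est hn lam Lam hlam hL C1 hC10
  refine ⟨C, hC0, ?_⟩
  intro B M f v η hE hW q₀ d hd γ ν hγ hγ1 hν mm hmm x hx hS hH hV
  set T := Metric.ball q₀ d ×ˢ Ioo (0 : ℝ) d with hT
  set w : Fin (n - 1) → Pt n → ℝ := fun m X => T.indicator (η m) X with hw
  have hM : 0 ≤ M := M_nonneg hW.2.2.1
  rw [abs_of_nonneg hM] at hH hV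
  have hx' := hx
  unfold NTv at hx'
  simp only [lt_iSup_iff] at hx'
  obtain ⟨X, hXc, hXv⟩ := hx'
  have hXv' : ν < √(∑ k, w k X ^ 2) := (ENNReal.ofReal_lt_ofReal_iff_of_nonneg hν.le).1 hXv
  have hwT : ∀ Y ∈ T, ∀ k, w k Y = η k Y := fun Y hY k => indicator_of_mem hY _
  have hXT : X ∈ T := by
    by_contra hcon
    have : ∀ k, w k X = 0 := fun k => indicator_of_notMem hcon _
    simp only [this] at hXv'
    simp at hXv'
    linarith
  obtain ⟨p, t⟩ := X
  have hpq : dist p q₀ < d := hXT.1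
  have ht : 0 < t := hXT.2.1
  have htd : t < d := hXT.2.2
  have hg : 0 < γ * ν := by positivity
  have hsq : ν ^ 2 < ∑ k, w k (p, t) ^ 2 := (Real.lt_sqrt hν.le).1 hXv'
  have hρ : 0 < (2 + a) * t := by positivity
  have hxD : x ∈ Metric.ball p ((2 + a) * t) := by
    have h1 := hXc.2
    unfold dist2 at h1
    rw [Metric.mem_ball']
    have h2 : dist p x ≤ √(dist p x ^ 2 + (t - 0) ^ 2) := Real.le_sqrt_of_sq_le (by nlinarith [sq_nonneg (t - 0)])
    have h3 : dist p x ≤ (1 + a) * t := h2.trans h1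
    linarith
  have hDR : Metric.ball p ((2 + a) * t) ⊆ Metric.ball q₀ (mm * d) := by
    refine Metric.ball_subset_ball' ?_
    have h1 : (2 + a) * t ≤ (2 + a) * d := by gcongr
    have h2 : (3 + a) * d ≤ mm * d := by gcongr
    linarith
  have bS := (MHL_use hρ hxD hDR).trans (mul_le_mul_left hS _)
  have bM : ∀ g : EE n → ℝ≥0∞, ENNReal.ofReal M * MHL (Metric.ball q₀ (mm * d)) g x ≤ ENNReal.ofReal ((γ * ν) ^ 2) →
      ENNReal.ofReal M * ∫⁻ y in Metric.ball p ((2 + a) * t), g y ≤ ENNReal.ofReal ((γ * ν) ^ 2) * volume (Metric.ball p ((2 + a) * t)) := by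
    intro g h
    calc ENNReal.ofReal M * ∫⁻ y in Metric.ball p ((2 + a) * t), g y
        ≤ ENNReal.ofReal M * (MHL (Metric.ball q₀ (mm * d)) g x * volume (Metric.ball p ((2 + a) * t))) := by
          gcongr; exact MHL_use hρ hxD hDR
      _ = (ENNReal.ofReal M * MHL (Metric.ball q₀ (mm * d)) g x) * volume (Metric.ball p ((2 + a) * t)) := (mul_assoc _ _ _).symm
      _ ≤ _ := by gcongr
  have bH := bM _ hH
  have bV := bM _ hV
  set p' : EE n := q₀ + (1 - t / (4 * d)) • (p - q₀) with hp'
  have htd4 : t / (4 * d) ≤ 1 / 4 := by rw [div_le_div_iff₀ (by positivity) (by norm_num)]; linarith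
  have htd0 : 0 < t / (4 * d) := by positivity
  have hdt : t / (4 * d) * d = t / 4 := by field_simp
  have hpp : dist p' p ≤ t / 4 := by
    have e : p' - p = (-(t / (4 * d))) • (p - q₀) := by rw [hp']; module
    rw [dist_eq_norm, e, norm_smul, norm_neg, Real.norm_of_nonneg htd0.le, ← dist_eq_norm, ← hdt]
    gcongr
  have hpq' : dist p' q₀ < d - t / 4 := by
    have e : p' - q₀ = (1 - t / (4 * d)) • (p - q₀) := by rw [hp']; module
    rw [dist_eq_norm, e, norm_smul, Real.norm_of_nonneg (by linarith), ← dist_eq_norm]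
    nlinarith
  have hSBT : SB p' t ⊆ T := by
    intro Y hY
    refine ⟨?_, hY.2.1, hY.2.2.trans htd⟩
    rw [Metric.mem_ball]
    linarith [Metric.mem_closedBall.1 hY.1, dist_triangle Y.1 p' q₀]
  have hcone : ∀ Y ∈ SB p' t, Y ∈ cone a Y.1 := by
    intro Y hY
    have h0 : 0 < Y.2 := hY.2.1
    refine ⟨h0, ?_⟩
    unfold dist2
    rw [Real.sqrt_le_left (by nlinarith)]
    simp only [sub_zero, dist_self]
    rw [zero_pow two_ne_zero, zero_add]
    exact pow_le_pow_left₀ h0.le (by nlinarith) 2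
  have hM1 : M ≤ C1 := by
    have h1 := pt_bound ha ht hM w p (p, t) (by simp; positivity) (by show 3 * t / 4 < t; linarith) bH
    have h2 : M * ν ^ 2 ≤ (4 * (2 + a)) ^ (n - 1) * (γ * ν) ^ 2 := le_trans (mul_le_mul_of_nonneg_left hsq.le hM) h1
    have h3 : (γ * ν) ^ 2 ≤ ν ^ 2 := by
      rw [mul_pow]
      nlinarith [mul_nonneg (sq_nonneg ν) (by nlinarith : 0 ≤ 1 - γ ^ 2)]
    have h4 : M * ν ^ 2 ≤ C1 * ν ^ 2 := h2.trans (mul_le_mul hle1 h3 (sq_nonneg _) hC10)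
    exact le_of_mul_le_mul_right h4 (by positivity)
  have hcore := hC B M f v η hE hW p p' t (γ * ν) ht hg hpp hM1
    ((SF_bound hn η ht htd ha bS).trans (ENNReal.ofReal_le_ofReal (by gcongr; exact hle2.trans hle1)))
    ((SB_bound hn ha ht hM v _ p p' hpp (fun k => (hW.2.2.2.2.2.1 k).1.1) (fun Y hY => NTv_ge v (hcone Y hY)) bV).trans
      (ENNReal.ofReal_le_ofReal (by gcongr)))
    ((SB_bound hn ha ht hM η _ p p' hpp (fun k => (hW.2.2.2.2.2.2 k).1) (fun Y hY => by
        have h1 := NTv_ge w (hcone Y hY)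
        simp only [hwT Y (hSBT hY)] at h1
        exact h1) bH).trans
      (ENNReal.ofReal_le_ofReal (by gcongr)))
    (fun Y hY => by
      have h2 := ball_low p Y hY
      rw [← ball_prod_same] at hY
      refine (pt_bound ha ht hM v p Y (Metric.mem_ball.1 hY.1) h2 bV).trans ?_
      gcongr)
  simp only [hwT (p, t) hXT] at hsq
  have h5 : ν ^ 2 < C * (γ * ν) ^ 2 := hsq.trans_le hcore
  have h6 : 1 * ν ^ 2 < (C * γ ^ 2) * ν ^ 2 := by linarith [h5, mul_pow γ ν 2, congrArg (C * ·) (mul_pow γ ν 2), mul_assoc C (γ ^ 2) (ν ^ 2)]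
  exact lt_of_mul_lt_mul_right h6 (sq_nonneg _)

/-- **Lemma 5.2 of the paper.** The localized good-`λ` inequality
for the solution `η` of the weakly coupled system, with the truncated square
function, the localized Hardy–Littlewood maximal function over balls contained in
the enlarged ball `Δ_{md}`, and a constant `C(γ) → 0` as `γ → 0`. -/
theorem localized_good_lambda (n : ℕ) (hn : 2 ≤ n) (lam Lam : ℝ)
    (hlam : 0 < lam) (hLam : lam ≤ Lam) :
    ∃ a₀ : ℝ, 0 < a₀ ∧ ∀ a : ℝ, a₀ ≤ a →
      ∃ (b : ℝ) (c : ℝ → ℝ) (mm : ℕ) (Cγ : ℝ → ℝ), 0 < b ∧ 2 ≤ mm ∧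
        (∀ M, 0 ≤ c M) ∧ Tendsto c (nhdsWithin 0 (Ici 0)) (nhds 0) ∧
        (∀ γ ∈ Ioo (0 : ℝ) 1, 0 < Cγ γ) ∧
        Tendsto Cγ (nhdsWithin 0 (Ioi 0)) (nhds 0) ∧
        ∀ (Bpar : Pt n → Fin (n - 1) → Fin (n - 1) → ℝ) (M : ℝ)
          (f : EE n → ℝ) (v η : Fin (n - 1) → Pt n → ℝ),
          EllipticOn (UHS n) Bpar lam Lam →
          WCSetup Bpar M f v η →
          ∀ (q₀ : EE n) (d : ℝ), 0 < d →
          ∀ γ ∈ Ioo (0 : ℝ) 1,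
          ∀ ν : ℝ, 2 * Real.sqrt (∑ m, (η m (q₀, d / 2)) ^ 2) < ν →
            volume {x : EE n |
              ENNReal.ofReal ν <
                NTv a (fun m X =>
                  (Metric.ball q₀ d ×ˢ Ioo (0 : ℝ) d).indicator (η m) X) x ∧
              (MHL (Metric.ball q₀ (mm * d))
                  (fun y => SFon (coneTrunc b (2 * d) y)
                    (fun X => ∑ m, gradSq (η m) X) ^ (2 : ℕ)) x) ^ (1 / 2 : ℝ) ≤
                ENNReal.ofReal (γ * ν) ∧
              (ENNReal.ofReal (c M) *
                  (MHL (Metric.ball q₀ (mm * d))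
                      (fun y => NTv a (fun m X =>
                        (Metric.ball q₀ d ×ˢ Ioo (0 : ℝ) d).indicator (η m) X) y
                          ^ (2 : ℕ)) x +
                    MHL (Metric.ball q₀ (mm * d))
                      (fun y => NTv a v y ^ (2 : ℕ)) x)) ^ (1 / 2 : ℝ) ≤
                ENNReal.ofReal (γ * ν) ∧
              (MHL (Metric.ball q₀ (mm * d))
                  (fun y => SFon (coneTrunc b (2 * d) y)
                    (fun X => ∑ m, gradSq (η m) X) ^ (2 : ℕ)) x *
                MHL (Metric.ball q₀ (mm * d))
                  (fun y => NTv a (fun m X =>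
                    (Metric.ball q₀ d ×ˢ Ioo (0 : ℝ) d).indicator (η m) X) y
                      ^ (2 : ℕ)) x) ^ (1 / 4 : ℝ) ≤
                ENNReal.ofReal (γ * ν)} ≤
            ENNReal.ofReal (Cγ γ) *
              volume {x : EE n |
                ENNReal.ofReal (ν / 32) <
                  NTv a (fun m X =>
                    (Metric.ball q₀ d ×ˢ Ioo (0 : ℝ) d).indicator (η m) X) x} := by
  refine ⟨1, one_pos, fun a ha => ?_⟩
  obtain ⟨C, hC0, hC⟩ := bad_empty hn hlam (hlam.le.trans hLam) ha
  have hg0 : 0 < 1 / (C + 1) := by positivity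
  refine ⟨1, fun M => |M|, ⌈3 + a⌉₊, fun γ => if γ < 1 / (C + 1) then γ else 1, one_pos, ?_, fun M => abs_nonneg M, ?_, ?_, ?_, ?_⟩
  · have h1 : (2 : ℝ) ≤ (⌈3 + a⌉₊ : ℝ) := le_trans (by linarith) (Nat.le_ceil (3 + a))
    exact_mod_cast h1
  · have h1 : Tendsto (fun M : ℝ => |M|) (nhds 0) (nhds |0|) := continuous_abs.tendsto 0
    rw [abs_zero] at h1
    exact h1.mono_left nhdsWithin_le_nhds
  · intro γ hγ
    dsimp only
    split_ifs
    · exact hγ.1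
    · exact one_pos
  · have h1 : Tendsto (fun γ : ℝ => γ) (nhdsWithin 0 (Ioi 0)) (nhds 0) := tendsto_id.mono_left nhdsWithin_le_nhds
    refine h1.congr' ?_
    have h2 : ∀ᶠ γ : ℝ in nhdsWithin 0 (Ioi 0), γ < 1 / (C + 1) := nhdsWithin_le_nhds (Iio_mem_nhds hg0)
    filter_upwards [h2] with γ hγ
    rw [if_pos hγ]
  · intro B M f v η hE hW q₀ d hd γ hγ ν hν0
    have hν : 0 < ν := lt_of_le_of_lt (by positivity) hν0
    dsimp only
    split_ifs with hcase
    · refine le_of_eq_of_le ?_ zero_le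
      convert measure_empty (μ := (volume : Measure (EE n)))
      refine eq_empty_iff_forall_notMem.2 fun x hx => ?_
      obtain ⟨h1, h2, h3, -⟩ := hx
      have hg : 0 ≤ γ * ν := (mul_pos hγ.1 hν).le
      have k2 := rpow_half_le hg h2
      have k3 := rpow_half_le hg h3
      rw [mul_add] at k3
      have h4 := hC B M f v η hE hW q₀ d hd γ ν hγ.1 hγ.2 hν _ (Nat.le_ceil (3 + a)) x h1 k2
        (le_self_add.trans k3) (le_add_self.trans k3)
      have h5 : γ * (C + 1) < 1 := (lt_div_iff₀ (by positivity)).1 hcase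
      nlinarith [hγ.1, hγ.2, mul_pos hC0 hγ.1]
    · rw [ENNReal.ofReal_one, one_mul]
      refine measure_mono fun x hx => ?_
      exact lt_of_le_of_lt (ENNReal.ofReal_le_ofReal (by linarith)) hx.1

end
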